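/- arXiv:2409.15826 — 6 statements merged into one kernel-verified Lean document; each statement's English description precedes it below -/
import Mathlib

section
/- Let H be a separable complex Hilbert space, let A be a densely defined maximally accretive operator on H, and let B : ℂ → H and C : H → ℂ be bounded, so BC is a rank-one (hence trace class) operator on H. Let 𝓔₀ be the unital complex subalgebra of ℒ(H) generated by I, BC, and the contractions (A − λI)(A + λI)^{−1} for all λ > 0. Then every commutator [V,W] = VW − WV of elements V, W of 𝓔₀ + ℒ¹(H) belongs to the trace class ℒ¹(H), so ℒ¹(H) is an ideal in 𝓔₀ + ℒ¹(H) and the quotient algebra 𝒜₀ = (𝓔₀ + ℒ¹(H))/ℒ¹(H) is a commutative unital complex algebra, giving an exact sequence 0 → ℒ¹(H) → 𝓔₀ + ℒ¹(H) → 𝒜₀ → 0. -/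
open Set
open scoped InnerProductSpace

/-- A bounded operator `T` on a Hilbert space is Hilbert–Schmidt if the sums `∑ ‖T e‖²` over
finite orthonormal families are uniformly bounded. -/
def IsHilbertSchmidt {H : Type*} [NormedAddCommGroup H] [InnerProductSpace ℂ H]
    (T : H →L[ℂ] H) : Prop :=
  ∃ c : ℝ, ∀ s : Finset H, (∀ e ∈ s, ‖e‖ = 1) →
    (∀ e ∈ s, ∀ f ∈ s, e ≠ f → ⟪e, f⟫_ℂ = 0) →
    ∑ e ∈ s, ‖T e‖ ^ 2 ≤ c

/-- A bounded operator on a Hilbert space is trace class if it is a product of two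
Hilbert–Schmidt operators. -/
def IsTraceClass {H : Type*} [NormedAddCommGroup H] [InnerProductSpace ℂ H]
    (T : H →L[ℂ] H) : Prop :=
  ∃ A B : H →L[ℂ] H, IsHilbertSchmidt A ∧ IsHilbertSchmidt B ∧ T = A.comp B

section

variable {H : Type*} [NormedAddCommGroup H] [InnerProductSpace ℂ H]

lemma orthonormal_coe_of_norm_of_inner {s : Finset H} (h1 : ∀ e ∈ s, ‖e‖ = 1)
    (h2 : ∀ e ∈ s, ∀ f ∈ s, e ≠ f → ⟪e, f⟫_ℂ = 0) :
    Orthonormal ℂ (fun e : s => (e : H)) :=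
  ⟨fun e => h1 e e.2, fun e f hef => h2 e e.2 f f.2 fun h => hef (Subtype.ext h)⟩

lemma HilbertBasis.hasSum_sq_norm_inner {ι : Type*} (b : HilbertBasis ι ℂ H) (x : H) :
    HasSum (fun i => ‖⟪b i, x⟫_ℂ‖ ^ 2) (‖x‖ ^ 2) := by
  have h := lp.hasSum_norm (p := 2) (by norm_num) (b.repr x)
  simpa [b.repr_apply_apply] using h

namespace IsHilbertSchmidt

lemma sum_norm_sq_le_of_adjoint [CompleteSpace H] {ι : Type*} (b : HilbertBasis ι ℂ H)
    {T : H →L[ℂ] H} {c : ℝ}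
    (hc : ∀ t : Finset ι, ∑ i ∈ t, ‖T.adjoint (b i)‖ ^ 2 ≤ c) {s : Finset H}
    (h1 : ∀ e ∈ s, ‖e‖ = 1) (h2 : ∀ e ∈ s, ∀ f ∈ s, e ≠ f → ⟪e, f⟫_ℂ = 0) :
    ∑ e ∈ s, ‖T e‖ ^ 2 ≤ c := by
  refine le_of_tendsto' (hasSum_sum fun e _ => b.hasSum_sq_norm_inner (T e)) fun t => ?_
  refine le_trans (Finset.sum_le_sum fun i _ => ?_) (hc t)
  have hb := (orthonormal_coe_of_norm_of_inner h1 h2).sum_inner_products_le (T.adjoint (b i))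
    (s := Finset.univ)
  rw [Finset.sum_coe_sort s fun e => ‖⟪e, T.adjoint (b i)⟫_ℂ‖ ^ 2] at hb
  simpa only [ContinuousLinearMap.adjoint_inner_right, norm_inner_symm (b i)] using hb

protected lemma adjoint [CompleteSpace H] {T : H →L[ℂ] H} (hT : IsHilbertSchmidt T) :
    IsHilbertSchmidt T.adjoint := by
  obtain ⟨c, hc⟩ := hT
  obtain ⟨w, b, hb⟩ := exists_hilbertBasis ℂ H
  refine ⟨c, fun s => sum_norm_sq_le_of_adjoint b fun t => ?_⟩
  have hinj : Function.Injective (b : w → H) := b.orthonormal.linearIndependent.injective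
  have h := hc (t.map ⟨b, hinj⟩) (by
    simp only [Finset.mem_map, Function.Embedding.coeFn_mk]
    rintro _ ⟨i, -, rfl⟩
    exact b.orthonormal.1 i) (by
    simp only [Finset.mem_map, Function.Embedding.coeFn_mk]
    rintro _ ⟨i, -, rfl⟩ _ ⟨j, -, rfl⟩ hij
    exact b.orthonormal.2 fun h => hij (congrArg b h))
  simpa using h

lemma of_finite_hilbertBasis [CompleteSpace H] {ι : Type*} [Finite ι] (b : HilbertBasis ι ℂ H)
    (T : H →L[ℂ] H) : IsHilbertSchmidt T := by
  have := Fintype.ofFinite ι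
  exact ⟨∑ i, ‖T.adjoint (b i)‖ ^ 2, fun s => sum_norm_sq_le_of_adjoint b fun t =>
    Finset.sum_le_univ_sum_of_nonneg fun _ => by positivity⟩

protected lemma zero : IsHilbertSchmidt (0 : H →L[ℂ] H) := ⟨0, by simp⟩

protected lemma add {S T : H →L[ℂ] H} (hS : IsHilbertSchmidt S) (hT : IsHilbertSchmidt T) :
    IsHilbertSchmidt (S + T) := by
  obtain ⟨c, hc⟩ := hS
  obtain ⟨d, hd⟩ := hT
  refine ⟨2 * c + 2 * d, fun s h1 h2 => ?_⟩
  calc ∑ e ∈ s, ‖(S + T) e‖ ^ 2 ≤ ∑ e ∈ s, (2 * ‖S e‖ ^ 2 + 2 * ‖T e‖ ^ 2) := by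
        refine Finset.sum_le_sum fun e _ => ?_
        have h := pow_le_pow_left₀ (norm_nonneg _) (norm_add_le (S e) (T e)) 2
        rw [add_apply]
        linarith [sq_nonneg (‖S e‖ - ‖T e‖), add_sq ‖S e‖ ‖T e‖, sub_sq ‖S e‖ ‖T e‖]
    _ = 2 * ∑ e ∈ s, ‖S e‖ ^ 2 + 2 * ∑ e ∈ s, ‖T e‖ ^ 2 := by
        rw [Finset.sum_add_distrib, Finset.mul_sum, Finset.mul_sum]
    _ ≤ 2 * c + 2 * d := by linarith [hc s h1 h2, hd s h1 h2]

lemma mul_left (S : H →L[ℂ] H) {T : H →L[ℂ] H} (hT : IsHilbertSchmidt T) :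
    IsHilbertSchmidt (S * T) := by
  obtain ⟨c, hc⟩ := hT
  refine ⟨‖S‖ ^ 2 * c, fun s h1 h2 => ?_⟩
  calc ∑ e ∈ s, ‖(S * T) e‖ ^ 2 ≤ ∑ e ∈ s, ‖S‖ ^ 2 * ‖T e‖ ^ 2 :=
        Finset.sum_le_sum fun e _ => by
          rw [← mul_pow]
          exact pow_le_pow_left₀ (norm_nonneg _) (S.le_opNorm (T e)) 2
    _ = ‖S‖ ^ 2 * ∑ e ∈ s, ‖T e‖ ^ 2 := by rw [Finset.mul_sum]
    _ ≤ ‖S‖ ^ 2 * c := by gcongr; exact hc s h1 h2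

lemma mul_right [CompleteSpace H] {T : H →L[ℂ] H} (hT : IsHilbertSchmidt T) (S : H →L[ℂ] H) :
    IsHilbertSchmidt (T * S) := by
  have h := (hT.adjoint.mul_left S.adjoint).adjoint
  rwa [ContinuousLinearMap.mul_def, ContinuousLinearMap.adjoint_comp,
    ContinuousLinearMap.adjoint_adjoint, ContinuousLinearMap.adjoint_adjoint] at h

lemma comp_functional [CompleteSpace H] (B : ℂ →L[ℂ] H) (C : H →L[ℂ] ℂ) :
    IsHilbertSchmidt (B.comp C) := by
  set c := (InnerProductSpace.toDual ℂ H).symm C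
  refine ⟨‖B‖ ^ 2 * ‖c‖ ^ 2, fun s h1 h2 => ?_⟩
  have hb := (orthonormal_coe_of_norm_of_inner h1 h2).sum_inner_products_le c (s := Finset.univ)
  rw [Finset.sum_coe_sort s fun e => ‖⟪e, c⟫_ℂ‖ ^ 2] at hb
  calc ∑ e ∈ s, ‖B.comp C e‖ ^ 2 ≤ ∑ e ∈ s, ‖B‖ ^ 2 * ‖⟪e, c⟫_ℂ‖ ^ 2 := by
        refine Finset.sum_le_sum fun e _ => ?_
        rw [norm_inner_symm, InnerProductSpace.toDual_symm_apply, ← mul_pow]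
        exact pow_le_pow_left₀ (norm_nonneg _) (B.le_opNorm (C e)) 2
    _ = ‖B‖ ^ 2 * ∑ e ∈ s, ‖⟪e, c⟫_ℂ‖ ^ 2 := by rw [Finset.mul_sum]
    _ ≤ ‖B‖ ^ 2 * ‖c‖ ^ 2 := by gcongr

end IsHilbertSchmidt

lemma HilbertBasis.exists_isometries_with_orthogonal_ranges [CompleteSpace H] {ι : Type*}
    [Infinite ι] (b : HilbertBasis ι ℂ H) :
    ∃ U V : H →L[ℂ] H, U.adjoint * U = 1 ∧ V.adjoint * V = 1 ∧
      U.adjoint * V = 0 ∧ V.adjoint * U = 0 := by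
  obtain ⟨e⟩ : Nonempty (ι ⊕ ι ≃ ι) := by
    rw [← Cardinal.eq]
    simp
  have hl : Orthonormal ℂ (b ∘ e ∘ Sum.inl) :=
    b.orthonormal.comp _ (e.injective.comp Sum.inl_injective)
  have hr : Orthonormal ℂ (b ∘ e ∘ Sum.inr) :=
    b.orthonormal.comp _ (e.injective.comp Sum.inr_injective)
  let U : H →ₗᵢ[ℂ] H := hl.orthogonalFamily.linearIsometry.comp b.repr.toLinearIsometry
  let V : H →ₗᵢ[ℂ] H := hr.orthogonalFamily.linearIsometry.comp b.repr.toLinearIsometry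
  have hUV (x y : H) : ⟪U x, V y⟫_ℂ = 0 := by
    have hU : HasSum (fun i => b.repr x i • b (e (Sum.inl i))) (U x) :=
      hl.orthogonalFamily.hasSum_linearIsometry (b.repr x)
    have hV : HasSum (fun i => b.repr y i • b (e (Sum.inr i))) (V y) :=
      hr.orthogonalFamily.hasSum_linearIsometry (b.repr y)
    have hUb (j : ι) : ⟪U x, b (e (Sum.inr j))⟫_ℂ = 0 := by
      rw [inner_eq_zero_symm]
      refine ((innerSL ℂ (b (e (Sum.inr j)))).hasSum hU).unique ?_
      convert! hasSum_zero with i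
      have h : ⟪b (e (Sum.inr j)), b (e (Sum.inl i))⟫_ℂ = 0 := b.orthonormal.2 (by simp)
      simp [h]
    refine ((innerSL ℂ (U x)).hasSum hV).unique ?_
    convert! hasSum_zero with j
    simp [hUb j]
  have hcomp (W : H →ₗᵢ[ℂ] H) :
      W.toContinuousLinearMap.adjoint * W.toContinuousLinearMap = 1 := by
    ext x
    refine ext_inner_right ℂ fun y => ?_
    simp [ContinuousLinearMap.adjoint_inner_left]
  refine ⟨U.toContinuousLinearMap, V.toContinuousLinearMap, hcomp U, hcomp V, ?_, ?_⟩
  · ext x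
    refine ext_inner_right ℂ fun y => ?_
    simp [ContinuousLinearMap.adjoint_inner_left, inner_eq_zero_symm.1 (hUV y x)]
  · ext x
    refine ext_inner_right ℂ fun y => ?_
    simp [ContinuousLinearMap.adjoint_inner_left, hUV x y]

namespace IsTraceClass

protected lemma zero : IsTraceClass (0 : H →L[ℂ] H) :=
  ⟨0, 0, IsHilbertSchmidt.zero, IsHilbertSchmidt.zero, by simp⟩

lemma mul_left (S : H →L[ℂ] H) {T : H →L[ℂ] H} (hT : IsTraceClass T) :
    IsTraceClass (S * T) := by
  obtain ⟨P, Q, hP, hQ, rfl⟩ := hT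
  exact ⟨S * P, Q, hP.mul_left S, hQ, rfl⟩

protected lemma neg {T : H →L[ℂ] H} (hT : IsTraceClass T) : IsTraceClass (-T) := by
  simpa using hT.mul_left (-1)

variable [CompleteSpace H]

lemma mul_right {T : H →L[ℂ] H} (hT : IsTraceClass T) (S : H →L[ℂ] H) :
    IsTraceClass (T * S) := by
  obtain ⟨P, Q, hP, hQ, rfl⟩ := hT
  exact ⟨P, Q * S, hP, hQ.mul_right S, rfl⟩

protected lemma add {S T : H →L[ℂ] H} (hS : IsTraceClass S) (hT : IsTraceClass T) :
    IsTraceClass (S + T) := by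
  obtain ⟨w, b, -⟩ := exists_hilbertBasis ℂ H
  cases finite_or_infinite w
  · exact ⟨S + T, 1, .of_finite_hilbertBasis b _, .of_finite_hilbertBasis b _, rfl⟩
  · obtain ⟨U, V, hU, hV, hUV, hVU⟩ := b.exists_isometries_with_orthogonal_ranges
    obtain ⟨P, Q, hP, hQ, rfl⟩ := hS
    obtain ⟨P', Q', hP', hQ', rfl⟩ := hT
    refine ⟨P * U.adjoint + P' * V.adjoint, U * Q + V * Q', (hP.mul_right _).add (hP'.mul_right _),
      (hQ.mul_left _).add (hQ'.mul_left _), ?_⟩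
    simp only [← ContinuousLinearMap.mul_def]
    calc P * Q + P' * Q' = P * (U.adjoint * U) * Q + P * (U.adjoint * V) * Q' +
          (P' * (V.adjoint * U) * Q + P' * (V.adjoint * V) * Q') := by simp [hU, hV, hUV, hVU]
      _ = (P * U.adjoint + P' * V.adjoint) * (U * Q + V * Q') := by noncomm_ring

protected lemma sub {S T : H →L[ℂ] H} (hS : IsTraceClass S) (hT : IsTraceClass T) :
    IsTraceClass (S - T) := by
  simpa [sub_eq_add_neg] using hS.add hT.neg

lemma comp_functional (B : ℂ →L[ℂ] H) (C : H →L[ℂ] ℂ) : IsTraceClass (B.comp C) := by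
  let D : H →L[ℂ] ℂ := ((‖B 1‖ ^ 2 : ℝ) : ℂ)⁻¹ • innerSL ℂ (B 1)
  refine ⟨B.comp D, B.comp C, .comp_functional B D, .comp_functional B C, ?_⟩
  have hB (z : ℂ) : B z = z • B 1 := by rw [← map_smul, smul_eq_mul, mul_one]
  ext x
  by_cases h : B 1 = 0
  · simp [hB (C x), h]
  · have hD : D (B 1) = 1 := by
      simp [D, inner_self_eq_norm_sq_to_K, h]
    simp only [ContinuousLinearMap.comp_apply]
    rw [hB (C x), map_smul, hD, smul_eq_mul, mul_one, hB (C x)]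

lemma commutator_of_mem_adjoin {s : Set (H →L[ℂ] H)}
    (hs : ∀ X ∈ s, ∀ Y ∈ s, IsTraceClass (X * Y - Y * X)) {X Y : H →L[ℂ] H}
    (hX : X ∈ Algebra.adjoin ℂ s) (hY : Y ∈ Algebra.adjoin ℂ s) :
    IsTraceClass (X * Y - Y * X) := by
  induction hX, hY using Algebra.adjoin_induction₂ with
  | mem_mem X Y hX hY => exact hs X hX Y hY
  | algebraMap_both r₁ r₂ =>
    rw [Algebra.commutes, sub_self]
    exact .zero
  | algebraMap_left r X =>
    rw [Algebra.commutes, sub_self]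
    exact .zero
  | algebraMap_right r X =>
    rw [Algebra.commutes, sub_self]
    exact .zero
  | add_left X Y Z _ _ _ hX hY =>
    convert hX.add hY using 1
    noncomm_ring
  | add_right X Y Z _ _ _ hX hY =>
    convert hX.add hY using 1
    noncomm_ring
  | mul_left X Y Z _ _ _ hX hY =>
    convert (hY.mul_left X).add (hX.mul_right Y) using 1
    noncomm_ring
  | mul_right X Y Z _ _ _ hX hY =>
    convert (hX.mul_right Z).add (hY.mul_left Y) using 1
    noncomm_ring

lemma commutator_add {X Y S T : H →L[ℂ] H} (h : IsTraceClass (X * Y - Y * X))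
    (hT : IsTraceClass T) (hS : IsTraceClass S) :
    IsTraceClass ((X + T) * (Y + S) - (Y + S) * (X + T)) := by
  convert (h.add ((hS.mul_left X).sub (hS.mul_right X))).add
    ((hT.mul_right (Y + S)).sub (hT.mul_left (Y + S))) using 1
  noncomm_ring

end IsTraceClass

/-- The Cayley transforms `K = (A - lam)(A + lam)⁻¹` and `L = (A - mu)(A + mu)⁻¹` are related by
a Möbius transformation. -/
lemma cayley_mul_eq {A : H →ₗ.[ℂ] H} {lam mu : ℝ}
    (hdense : Dense (Set.range fun f : A.domain => A f + lam • (f : H))) {K L : H →L[ℂ] H}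
    (hK : ∀ f : A.domain, K (A f + lam • (f : H)) = A f - lam • (f : H))
    (hL : ∀ f : A.domain, L (A f + mu • (f : H)) = A f - mu • (f : H)) :
    L * ((lam + mu) • 1 + (lam - mu) • K) = (lam - mu) • 1 + (lam + mu) • K := by
  refine ContinuousLinearMap.ext fun x => ?_
  refine congrFun (Continuous.ext_on hdense (by fun_prop) (by fun_prop) ?_) x
  rintro _ ⟨f, rfl⟩
  have h₁ : (lam + mu) • (A f + lam • (f : H)) + (lam - mu) • (A f - lam • (f : H)) =
      (2 * lam) • (A f + mu • (f : H)) := by module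
  have h₂ : (lam - mu) • (A f + lam • (f : H)) + (lam + mu) • (A f - lam • (f : H)) =
      (2 * lam) • (A f - mu • (f : H)) := by module
  simp only [mul_apply_eq_comp, add_apply, smul_apply, one_apply_eq_self, hK]
  rw [h₁, h₂, ← hL, ContinuousLinearMap.map_smul_of_tower]

lemma isUnit_add_smul_of_norm_le_one [CompleteSpace H] {K : H →L[ℂ] H} (hK : ‖K‖ ≤ 1) {lam mu : ℝ}
    (hlam : 0 < lam) (hmu : 0 < mu) : IsUnit ((lam + mu) • 1 + (lam - mu) • K) := by
  have hpos : 0 < lam + mu := by positivity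
  have ht : ‖((mu - lam) / (lam + mu)) • K‖ < 1 := by
    rw [norm_smul, Real.norm_eq_abs]
    refine (mul_le_of_le_one_right (abs_nonneg _) hK).trans_lt ?_
    rw [abs_div, abs_of_pos hpos, div_lt_one hpos, abs_lt]
    constructor <;> linarith
  have h := (isUnit_one_sub_of_norm_lt_one ht).smul (Units.mk0 (lam + mu) hpos.ne')
  convert h using 1
  rw [Units.smul_mk0, smul_sub, smul_smul, mul_div_cancel₀ _ hpos.ne']
  module

lemma commute_of_mul_eq {R : Type*} [Ring R] {T L M N : R} (hM : IsUnit M) (h : L * M = N)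
    (hTM : Commute T M) (hTN : Commute T N) : Commute T L := by
  refine hM.mul_right_cancel ?_
  rw [mul_assoc, h, hTN.eq, mul_assoc, hTM.eq, ← mul_assoc, h]

end

/-- Let `H` be a separable complex Hilbert space, `A` a densely defined maximally accretive
operator on `H`, `B : ℂ → H` and `C : H → ℂ` bounded (so `B C` is rank one, hence trace class).
Let `𝓔₀` be the unital subalgebra of `ℒ(H)` generated by `I`, `B C` and the contractions
`(A - λ)(A + λ)⁻¹` (`λ > 0`, given here as the operators `Cay λ` determined on the dense range
of `A + λ`).  Then every commutator of elements of `𝓔₀ + ℒ¹(H)` is trace class, `ℒ¹(H)` is an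
ideal in `𝓔₀ + ℒ¹(H)`, and hence the quotient `𝒜₀ = (𝓔₀ + ℒ¹(H))/ℒ¹(H)` is a commutative
unital complex algebra, giving an exact sequence `0 → ℒ¹(H) → 𝓔₀ + ℒ¹(H) → 𝒜₀ → 0`. -/
theorem stmt_9 {H : Type*} [NormedAddCommGroup H] [InnerProductSpace ℂ H] [CompleteSpace H]
    [TopologicalSpace.SeparableSpace H]
    (A : H →ₗ.[ℂ] H) (hdense : Dense (A.domain : Set H))
    (haccretive : ∀ f : A.domain, 0 ≤ (⟪A f, (f : H)⟫_ℂ).re)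
    (hmax : ∃ lam : ℝ, 0 < lam ∧
      Dense (Set.range fun f : A.domain => A f + lam • (f : H)))
    (B : ℂ →L[ℂ] H) (C : H →L[ℂ] ℂ)
    (Cay : ℝ → (H →L[ℂ] H))
    (hCay_contraction : ∀ lam : ℝ, 0 < lam → ‖Cay lam‖ ≤ 1)
    (hCay : ∀ lam : ℝ, 0 < lam → ∀ f : A.domain,
      Cay lam (A f + lam • (f : H)) = A f - lam • (f : H)) :
    -- commutators of `𝓔₀ + ℒ¹(H)` lie in `ℒ¹(H)`, so the quotient algebra is commutative
    (∀ V W : H →L[ℂ] H,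
      (∃ X ∈ Algebra.adjoin ℂ
          ({B.comp C} ∪ Set.range fun lam : {x : ℝ // 0 < x} => Cay lam),
        ∃ T : H →L[ℂ] H, IsTraceClass T ∧ V = X + T) →
      (∃ Y ∈ Algebra.adjoin ℂ
          ({B.comp C} ∪ Set.range fun lam : {x : ℝ // 0 < x} => Cay lam),
        ∃ S : H →L[ℂ] H, IsTraceClass S ∧ W = Y + S) →
      IsTraceClass (V * W - W * V))
    ∧
    -- `ℒ¹(H)` is an ideal in `𝓔₀ + ℒ¹(H)`
    (∀ V : H →L[ℂ] H,
      (∃ X ∈ Algebra.adjoin ℂ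
          ({B.comp C} ∪ Set.range fun lam : {x : ℝ // 0 < x} => Cay lam),
        ∃ T : H →L[ℂ] H, IsTraceClass T ∧ V = X + T) →
      ∀ T : H →L[ℂ] H, IsTraceClass T → IsTraceClass (V * T) ∧ IsTraceClass (T * V)) := by
  obtain ⟨lam, hlam, hrange⟩ := hmax
  have hcomm_of {T : H →L[ℂ] H} (hT : Commute T (Cay lam)) {mu : ℝ} (hmu : 0 < mu) :
      Commute T (Cay mu) :=
    commute_of_mul_eq (isUnit_add_smul_of_norm_le_one (hCay_contraction lam hlam) hlam hmu)
      (cayley_mul_eq hrange (hCay lam hlam) (hCay mu hmu))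
      (((Commute.one_right T).smul_right _).add_right (hT.smul_right _))
      (((Commute.one_right T).smul_right _).add_right (hT.smul_right _))
  have hBC : IsTraceClass (B.comp C) := .comp_functional B C
  refine ⟨?_, fun V _ T hT => ⟨hT.mul_left V, hT.mul_right V⟩⟩
  rintro _ _ ⟨X, hX, T, hT, rfl⟩ ⟨Y, hY, S, hS, rfl⟩
  refine IsTraceClass.commutator_add (IsTraceClass.commutator_of_mem_adjoin ?_ hX hY) hT hS
  rintro P (rfl | ⟨mu, rfl⟩) Q (rfl | ⟨nu, rfl⟩)
  · exact (hBC.mul_left _).sub (hBC.mul_left _)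
  · exact (hBC.mul_right _).sub (hBC.mul_left _)
  · exact (hBC.mul_left _).sub (hBC.mul_right _)
  · have h : Commute (Cay mu) (Cay nu) :=
      hcomm_of (hcomm_of (Commute.refl (Cay lam)) mu.2).symm nu.2
    rw [h.eq, sub_self]
    exact .zero
end

section
/- Let (−A,B,C) be a continuous-time linear system with state space a separable complex Hilbert space H and input/output space ℂ, where A is densely defined and maximally accretive (so −A generates a strongly continuous contraction semigroup (e^{−tA})_{t≥0}), and suppose the Hardy-space conditions hold: sup_{ε>0} ∫_ℝ ‖C((ε+iω)I + A)^{−1}‖²_{H′} dω < ∞ and sup_{ε>0} ∫_ℝ ‖((ε+iω)I + A)^{−1}B‖²_H dω < ∞. Then ∫₀^∞ ‖Ce^{−tA}‖²_{H′} dt and ∫₀^∞ ‖e^{−tA}B‖²_H dt are finite, the rank-one operators e^{−tA}BCe^{−tA} satisfy ∫₀^∞ ‖e^{−tA}BCe^{−tA}‖_{ℒ¹(H)} dt ≤ (∫₀^∞ ‖e^{−tA}B‖²_H dt)^{1/2} (∫₀^∞ ‖Ce^{−tA}‖²_{H′} dt)^{1/2} < ∞, so that R_x = ∫_x^∞ e^{−tA}BCe^{−tA}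 dt defines a trace class operator on H for every x ≥ 0; moreover (R_x)_{x≥0} satisfies Lyapunov's equation in the weak sense: for all f ∈ 𝒟(A) and h ∈ 𝒟(A†), the function x ↦ ⟨R_x f, h⟩ is differentiable with (d/dx)⟨R_x f, h⟩ = −⟨R_x A f, h⟩ − ⟨R_x f, A† h⟩, and at x = 0 this derivative equals −⟨BC f, h⟩. -/
open MeasureTheory Set
open scoped InnerProductSpace ENNReal NNReal

open scoped FourierTransform SchwartzMap in
/-- The Fourier integral of a function in `L¹ ∩ L²` represents its `L²` Fourier transform. -/
theorem coeFn_fourier_toLp_ae_eq {F : Type*} [NormedAddCommGroup F] [InnerProductSpace ℂ F]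
    [CompleteSpace F] {u : ℝ → F} (hu₁ : Integrable u) (hu₂ : MemLp u 2) :
    (𝓕 (hu₂.toLp u) : Lp F 2 (volume : Measure ℝ)) =ᵐ[volume] 𝓕 u := by
  have hcont : Continuous (𝓕 u) :=
    VectorFourier.fourierIntegral_continuous Real.continuous_fourierChar
      (L := innerₗ ℝ) continuous_inner hu₁
  refine ae_eq_of_integral_contDiff_smul_eq
    ((Lp.memLp _).locallyIntegrable (by norm_num)) hcont.locallyIntegrable ?_
  intro g hg hgs
  have hs : HasCompactSupport (fun x ↦ (g x : ℂ)) := hgs.comp_left (g := Complex.ofReal) rfl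
  have hd : ContDiff ℝ (⊤ : ℕ∞) (fun x ↦ (g x : ℂ)) := Complex.ofRealCLM.contDiff.comp hg
  let φ : 𝓢(ℝ, ℂ) := hs.toSchwartzMap hd
  have h := congrArg (fun L ↦ L φ) (Lp.fourier_toTemperedDistribution_eq (hu₂.toLp u))
  simp only [TemperedDistribution.fourier_apply, Lp.toTemperedDistribution_apply] at h
  have h2 : ∫ x, (𝓕 φ) x • (hu₂.toLp u) x = ∫ x, (𝓕 φ) x • u x := by
    refine integral_congr_ae ?_
    filter_upwards [hu₂.coeFn_toLp] with x hx
    rw [hx]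
  have h3 : ∫ x, (𝓕 φ) x • u x = ∫ x, φ x • 𝓕 u x := by
    simpa using! VectorFourier.integral_fourierIntegral_smul_eq_flip (L := innerₗ ℝ)
      Real.continuous_fourierChar continuous_inner φ.integrable hu₁
  have h4 := h.symm.trans (h2.trans h3)
  simpa [φ] using h4

open scoped FourierTransform in
/-- Plancherel's theorem on `L¹ ∩ L²`. -/
theorem lintegral_enorm_fourier_sq {F : Type*} [NormedAddCommGroup F] [InnerProductSpace ℂ F]
    [CompleteSpace F] {u : ℝ → F} (hu₁ : Integrable u) (hu₂ : MemLp u 2) :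
    ∫⁻ x, ‖𝓕 u x‖ₑ ^ 2 = ∫⁻ x, ‖u x‖ₑ ^ 2 := by
  have key : ∀ v : Lp F 2 (volume : Measure ℝ), ∫⁻ x, ‖v x‖ₑ ^ 2 = ‖v‖ₑ ^ 2 := by
    intro v
    rw [Lp.enorm_def, eLpNorm_eq_lintegral_rpow_enorm_toReal (by norm_num) (by norm_num)]
    simp only [ENNReal.toReal_ofNat, ENNReal.rpow_ofNat]
    rw [← ENNReal.rpow_natCast, ← ENNReal.rpow_mul]
    norm_num
  calc ∫⁻ x, ‖𝓕 u x‖ₑ ^ 2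
      = ∫⁻ x, ‖(𝓕 (hu₂.toLp u) : Lp F 2 (volume : Measure ℝ)) x‖ₑ ^ 2 := by
        refine lintegral_congr_ae ?_
        filter_upwards [coeFn_fourier_toLp_ae_eq hu₁ hu₂] with x hx
        rw [hx]
    _ = ‖hu₂.toLp u‖ₑ ^ 2 := by
        rw [key, ← ofReal_norm, Lp.norm_fourier_eq, ofReal_norm]
    _ = ∫⁻ x, ‖u x‖ₑ ^ 2 := by
        rw [← key]
        refine lintegral_congr_ae ?_
        filter_upwards [hu₂.coeFn_toLp] with x hx
        rw [hx]

theorem lintegral_comp_mul_left_eq (g : ℝ → ℝ≥0∞) {a : ℝ} (ha : 0 < a) :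
    ∫⁻ x, g x = ENNReal.ofReal a * ∫⁻ x, g (a * x) := by
  have h := Real.smul_map_volume_mul_left ha.ne'
  have he : MeasurableEmbedding (fun x : ℝ ↦ a * x) :=
    (Homeomorph.mulLeft₀ a ha.ne').measurableEmbedding
  conv_lhs => rw [← h]
  rw [lintegral_smul_measure, he.lintegral_map, abs_of_pos ha, smul_eq_mul]

/-- The easy half of the Paley–Wiener theorem: a bounded continuous function on the half line
whose Laplace transform lies in the Hardy space is square integrable. -/
theorem lintegral_enorm_sq_lt_top_of_laplace {F : Type*} [NormedAddCommGroup F]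
    [InnerProductSpace ℂ F] [CompleteSpace F] {u : ℝ → F} {K : ℝ}
    (hu : ContinuousOn u (Ici 0)) (hK : ∀ t, 0 ≤ t → ‖u t‖ ≤ K) {M : ℝ}
    (hM : ∀ ε : ℝ, 0 < ε → ∫⁻ ω : ℝ,
      ‖∫ t in Ioi (0 : ℝ), Complex.exp (-(((ε : ℂ) + (ω : ℂ) * Complex.I) * (t : ℂ))) • u t‖ₑ ^ 2
        ≤ ENNReal.ofReal M) :
    ∫⁻ t in Ioi (0 : ℝ), ‖u t‖ₑ ^ 2 < ⊤ := by
  have hus : AEStronglyMeasurable u (volume.restrict (Ioi 0)) :=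
    (hu.mono Ioi_subset_Ici_self).aestronglyMeasurable measurableSet_Ioi
  have hbound : ∀ ε : ℝ, 0 < ε →
      ∫⁻ t in Ioi (0 : ℝ), ‖(Real.exp (-ε * t)) • u t‖ₑ ^ 2 ≤ ENNReal.ofReal M := by
    intro ε hε
    set v : ℝ → F := fun t ↦ Real.exp (-ε * t) • u t with hv
    have hvs : AEStronglyMeasurable v (volume.restrict (Ioi 0)) :=
      (by fun_prop : Continuous fun t : ℝ ↦ Real.exp (-ε * t)).aestronglyMeasurable.smul hus
    have hvb : ∀ᵐ t ∂(volume.restrict (Ioi (0 : ℝ))), ‖v t‖ ≤ K * Real.exp (-ε * t) := by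
      refine (ae_restrict_iff' measurableSet_Ioi).2 (.of_forall fun t ht ↦ ?_)
      rw [hv, norm_smul, Real.norm_eq_abs, abs_of_pos (Real.exp_pos _), mul_comm]
      exact mul_le_mul_of_nonneg_right (hK t (le_of_lt ht)) (Real.exp_pos _).le
    have hint : Integrable (fun t ↦ K * Real.exp (-ε * t)) (volume.restrict (Ioi (0 : ℝ))) :=
      (exp_neg_integrableOn_Ioi 0 hε).const_mul K
    have hv₁ : Integrable v (volume.restrict (Ioi (0 : ℝ))) := hint.mono' hvs hvb
    have hv₂ : MemLp v 2 (volume.restrict (Ioi (0 : ℝ))) := by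
      refine (memLp_two_iff_integrable_sq_norm hvs).2 ?_
      refine Integrable.mono' (hint.const_mul K) (hvs.norm.pow 2) ?_
      refine (ae_restrict_iff' measurableSet_Ioi).2 (.of_forall fun t ht ↦ ?_)
      have h1 := hK t (le_of_lt ht)
      have h2 : Real.exp (-ε * t) ≤ 1 := by
        rw [Real.exp_le_one_iff]; nlinarith [mem_Ioi.1 ht]
      have h3 := Real.exp_pos (-ε * t)
      rw [hv, norm_pow, norm_norm, norm_smul, Real.norm_eq_abs, abs_of_pos h3, mul_pow]
      have h4 : Real.exp (-ε * t) ^ 2 ≤ Real.exp (-ε * t) := by nlinarith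
      have h5 : ‖u t‖ ^ 2 ≤ K * K := by nlinarith [norm_nonneg (u t)]
      calc _ ≤ Real.exp (-ε * t) * (K * K) := by gcongr
        _ = _ := by ring
    have hw₁ := (integrable_indicator_iff measurableSet_Ioi).2 hv₁
    have hw₂ := (memLp_indicator_iff_restrict measurableSet_Ioi).2 hv₂
    have hP := lintegral_enorm_fourier_sq hw₁ hw₂
    have hL : ∫⁻ t in Ioi (0 : ℝ), ‖v t‖ₑ ^ 2 = ∫⁻ t, ‖(Ioi (0 : ℝ)).indicator v t‖ₑ ^ 2 := by
      rw [← lintegral_indicator measurableSet_Ioi]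
      refine lintegral_congr fun t ↦ ?_
      by_cases ht : t ∈ Ioi (0 : ℝ) <;> simp [ht]
    rw [hL, ← hP]
    have hpi : (0 : ℝ) < 2 * Real.pi := by positivity
    have h6 := hM ε hε
    rw [lintegral_comp_mul_left_eq _ hpi] at h6
    have h7 : (1 : ℝ≥0∞) ≤ ENNReal.ofReal (2 * Real.pi) := by
      rw [← ENNReal.ofReal_one]
      exact ENNReal.ofReal_le_ofReal (by nlinarith [Real.pi_gt_three])
    refine le_trans (le_trans (le_of_eq ?_) (le_mul_of_one_le_left' h7)) h6
    refine lintegral_congr fun ω ↦ ?_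
    rw [Real.fourier_real_eq_integral_exp_smul, ← integral_indicator measurableSet_Ioi]
    congr 3
    funext t
    by_cases ht : t ∈ Ioi (0 : ℝ)
    · simp only [ht, indicator_of_mem, hv]
      rw [← Complex.coe_smul (Real.exp _), smul_smul, Complex.ofReal_exp, ← Complex.exp_add]
      congr 2
      push_cast
      ring
    · simp [ht]
  have hlim : ∀ t : ℝ, Filter.Tendsto
      (fun n : ℕ ↦ ‖Real.exp (-(1 / ((n : ℝ) + 1)) * t) • u t‖ₑ ^ 2) Filter.atTop
      (nhds (‖u t‖ₑ ^ 2)) := by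
    intro t
    have h0 : Filter.Tendsto (fun n : ℕ ↦ 1 / ((n : ℝ) + 1)) Filter.atTop (nhds 0) :=
      tendsto_one_div_add_atTop_nhds_zero_nat
    have hc : Continuous fun r : ℝ ↦ ‖Real.exp (-r * t) • u t‖ₑ ^ 2 :=
      (ENNReal.continuous_pow 2).comp (by fun_prop)
    simpa [Function.comp_def] using (hc.tendsto 0).comp h0
  refine lt_of_le_of_lt ?_ (ENNReal.ofReal_lt_top (r := M))
  calc ∫⁻ t in Ioi (0 : ℝ), ‖u t‖ₑ ^ 2
      = ∫⁻ t in Ioi (0 : ℝ), Filter.liminf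
        (fun n : ℕ ↦ ‖Real.exp (-(1 / ((n : ℝ) + 1)) * t) • u t‖ₑ ^ 2) Filter.atTop :=
        lintegral_congr fun t ↦ (hlim t).liminf_eq.symm
    _ ≤ Filter.liminf (fun n : ℕ ↦ ∫⁻ t in Ioi (0 : ℝ),
          ‖Real.exp (-(1 / ((n : ℝ) + 1)) * t) • u t‖ₑ ^ 2) Filter.atTop := by
        refine lintegral_liminf_le' fun n ↦ ?_
        refine AEMeasurable.pow_const ?_ 2
        exact ((by fun_prop : Continuous fun t : ℝ ↦
          Real.exp (-(1 / ((n : ℝ) + 1)) * t)).aestronglyMeasurable.smul hus).enorm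
    _ ≤ ENNReal.ofReal M :=
        Filter.liminf_le_of_le (by isBoundedDefault) fun b hb ↦ by
          obtain ⟨n, hn⟩ := hb.exists
          exact hn.trans (hbound _ (by positivity))

theorem IsHilbertSchmidt.of_norm_le {H : Type*} [NormedAddCommGroup H]
    [InnerProductSpace ℂ H] {S Y : H →L[ℂ] H}
    (hS : IsHilbertSchmidt S) (h : ∀ f, ‖Y f‖ ≤ ‖S f‖) : IsHilbertSchmidt Y := by
  obtain ⟨c, hc⟩ := hS
  refine ⟨c, fun s h₁ h₂ ↦ (Finset.sum_le_sum fun e _ ↦ ?_).trans (hc s h₁ h₂)⟩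
  gcongr
  exact h e

section TraceClass

variable {H : Type*} [NormedAddCommGroup H] [InnerProductSpace ℂ H] [CompleteSpace H]

/-- A factorization lemma of Douglas type. -/
theorem exists_comp_eq_of_norm_inner_le {R P S : H →L[ℂ] H} (hP : IsSelfAdjoint P)
    (h : ∀ f g, ‖⟪R f, g⟫_ℂ‖ ≤ ‖S f‖ * ‖P g‖) :
    ∃ Y : H →L[ℂ] H, R = P.comp Y ∧ ∀ f, ‖Y f‖ ≤ ‖S f‖ := by
  let V : Submodule ℂ H := P.range.topologicalClosure
  have hVc : CompleteSpace V := P.range.isClosed_topologicalClosure.completeSpace_coe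
  let e : H →L[ℂ] V := P.codRestrict V fun x ↦
    P.range.le_topologicalClosure (LinearMap.mem_range_self _ x)
  have he : ∀ g, ((e g : V) : H) = P g := fun g ↦ rfl
  have hd : DenseRange e := by
    intro v
    rw [Metric.mem_closure_iff]
    intro ε hε
    have hv : (v : H) ∈ closure (P.range : Set H) := v.2
    obtain ⟨_, ⟨x, rfl⟩, hx⟩ := Metric.mem_closure_iff.1 hv ε hε
    exact ⟨e x, ⟨x, rfl⟩, hx⟩
  have hbd : ∀ g, ‖(ContinuousLinearMap.adjoint R) g‖ ≤ ‖S‖ * ‖e g‖ := by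
    intro g
    set w := (ContinuousLinearMap.adjoint R) g with hw
    have h1 : ‖w‖ ^ 2 ≤ ‖S w‖ * ‖P g‖ := by
      refine le_trans ?_ (h w g)
      rw [← ContinuousLinearMap.adjoint_inner_right, ← hw, inner_self_eq_norm_sq_to_K]
      simp
    have h2 : ‖S w‖ ≤ ‖S‖ * ‖w‖ := S.le_opNorm w
    have h3 : ‖e g‖ = ‖P g‖ := rfl
    rw [h3]
    rcases (norm_nonneg w).eq_or_lt with h0 | h0
    · rw [← h0]; positivity
    · have : ‖w‖ * ‖w‖ ≤ (‖S‖ * ‖P g‖) * ‖w‖ := by nlinarith [norm_nonneg (P g)]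
      exact le_of_mul_le_mul_right this h0
  let Z : V →L[ℂ] H :=
    LinearMap.extendOfNorm (ContinuousLinearMap.adjoint R : H →L[ℂ] H).toLinearMap e.toLinearMap
  have hZ : ∀ g, Z (e g) = (ContinuousLinearMap.adjoint R) g := fun g ↦
    LinearMap.extendOfNorm_eq hd ⟨‖S‖, hbd⟩ g
  have hin : ∀ f g, ⟪(ContinuousLinearMap.adjoint Z) f, e g⟫_ℂ = ⟪R f, g⟫_ℂ := fun f g ↦ by
    rw [ContinuousLinearMap.adjoint_inner_left, hZ, ContinuousLinearMap.adjoint_inner_right]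
  refine ⟨V.subtypeL.comp (ContinuousLinearMap.adjoint Z), ?_, fun f ↦ ?_⟩
  · ext f
    refine ext_inner_right ℂ fun g ↦ ?_
    have h1 : ⟪P ((ContinuousLinearMap.adjoint Z f : V) : H), g⟫_ℂ
        = ⟪((ContinuousLinearMap.adjoint Z f : V) : H), P g⟫_ℂ := hP.isSymmetric _ _
    rw [← hin]
    exact h1.symm
  · set y := (ContinuousLinearMap.adjoint Z) f with hy
    have hall : ∀ v : V, ‖⟪y, v⟫_ℂ‖ ≤ ‖S f‖ * ‖v‖ := by
      refine fun v ↦ hd.induction_on (p := fun v ↦ ‖⟪y, v⟫_ℂ‖ ≤ ‖S f‖ * ‖v‖) v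
        (isClosed_le (by fun_prop) (by fun_prop)) fun g ↦ ?_
      rw [hy, hin]
      exact h f g
    have h1 := hall y
    rw [inner_self_eq_norm_sq_to_K] at h1
    have h2 : ‖y‖ ^ 2 ≤ ‖S f‖ * ‖y‖ := by simpa using h1
    change ‖y‖ ≤ ‖S f‖
    rcases (norm_nonneg y).eq_or_lt with h0 | h0
    · rw [← h0]; positivity
    · exact le_of_mul_le_mul_right (by nlinarith) h0

/-- The square root of the Gramian of a square integrable function. -/
theorem exists_sqrt_gramian {μ : Measure ℝ} {b : ℝ → H} (hb : MemLp b 2 μ) :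
    ∃ P : H →L[ℂ] H, IsSelfAdjoint P ∧ IsHilbertSchmidt P ∧
      ∀ g, ‖P g‖ ^ 2 = ∫ t, ‖⟪b t, g⟫_ℂ‖ ^ 2 ∂μ := by
  have hsq : Integrable (fun t ↦ ‖b t‖ ^ 2) μ := (memLp_two_iff_integrable_sq_norm hb.1).1 hb
  have hG : Integrable (fun t ↦ InnerProductSpace.rankOne ℂ (b t) (b t)) μ := by
    refine hsq.mono' ?_ (.of_forall fun t ↦ ?_)
    · have hc : Continuous fun x : H ↦ InnerProductSpace.rankOne ℂ x x :=
        ((ContinuousLinearMap.smulRightL ℂ H H).continuous.comp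
          (innerSL ℂ).continuous).clm_apply continuous_id
      exact hc.comp_aestronglyMeasurable hb.1
    · simp [sq]
  set Q : H →L[ℂ] H := ∫ t, InnerProductSpace.rankOne ℂ (b t) (b t) ∂μ with hQ
  have hQg : ∀ g, ⟪Q g, g⟫_ℂ = ((∫ t, ‖⟪b t, g⟫_ℂ‖ ^ 2 ∂μ : ℝ) : ℂ) := by
    intro g
    have hi := hG.apply_continuousLinearMap g
    rw [hQ, ContinuousLinearMap.integral_apply hG, ← inner_conj_symm, ← integral_inner hi,
      ← integral_conj, ← integral_complex_ofReal]
    refine integral_congr_ae (.of_forall fun t ↦ ?_)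
    simp only [InnerProductSpace.rankOne_apply, inner_smul_right, map_mul, inner_conj_symm]
    rw [← inner_conj_symm, mul_comm, RCLike.mul_conj]
    simp
  have hpos : 0 ≤ Q := by
    rw [ContinuousLinearMap.nonneg_iff_isPositive, ContinuousLinearMap.isPositive_iff_complex]
    intro x
    rw [hQg]
    refine ⟨by simp, ?_⟩
    simpa using integral_nonneg fun t ↦ by positivity
  have hPg : ∀ g, ‖(CFC.sqrt Q) g‖ ^ 2 = ∫ t, ‖⟪b t, g⟫_ℂ‖ ^ 2 ∂μ := by
    intro g
    have hsa : IsSelfAdjoint (CFC.sqrt Q) := (CFC.sqrt_nonneg Q).isSelfAdjoint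
    have h1 : ⟪CFC.sqrt Q (CFC.sqrt Q g), g⟫_ℂ = ⟪CFC.sqrt Q g, CFC.sqrt Q g⟫_ℂ :=
      hsa.isSymmetric _ _
    rw [← mul_apply_eq_comp, CFC.sqrt_mul_sqrt_self Q hpos, hQg,
      inner_self_eq_norm_sq_to_K] at h1
    exact Complex.ofReal_injective (by simpa using h1.symm)
  refine ⟨CFC.sqrt Q, (CFC.sqrt_nonneg Q).isSelfAdjoint, ⟨∫ t, ‖b t‖ ^ 2 ∂μ, ?_⟩, hPg⟩
  intro s h₁ h₂
  have hint : ∀ g, Integrable (fun t ↦ ‖⟪b t, g⟫_ℂ‖ ^ 2) μ := fun g ↦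
    (memLp_two_iff_integrable_sq_norm (hb.inner_const g).1).1 (hb.inner_const g)
  simp only [hPg]
  rw [← integral_finsetSum _ fun e _ ↦ hint e]
  refine integral_mono (integrable_finsetSum _ fun e _ ↦ hint e) hsq fun t ↦ ?_
  have ho : Orthonormal ℂ (fun e : s ↦ (e : H)) :=
    ⟨fun e ↦ h₁ e e.2, fun e f hef ↦ h₂ e e.2 f f.2 fun h ↦ hef (Subtype.ext h)⟩
  have := ho.sum_inner_products_le (b t) (s := Finset.univ)
  rw [Finset.sum_coe_sort s (fun e ↦ ‖⟪e, b t⟫_ℂ‖ ^ 2)] at this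
  simpa only [norm_inner_symm] using this

theorem isTraceClass_of_eq_integral {μ : Measure ℝ} {b c : ℝ → H} (hb : MemLp b 2 μ)
    (hc : MemLp c 2 μ) {R : H →L[ℂ] H} (hR : ∀ f, R f = ∫ t, ⟪c t, f⟫_ℂ • b t ∂μ) :
    IsTraceClass R := by
  obtain ⟨P, hPsa, hPhs, hP⟩ := exists_sqrt_gramian hb
  obtain ⟨S, -, hShs, hS⟩ := exists_sqrt_gramian hc
  obtain ⟨Y, hRY, hY⟩ := exists_comp_eq_of_norm_inner_le (R := R) (P := P) (S := S) hPsa <| by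
    intro f g
    have hcf := hc.inner_const (𝕜 := ℂ) f
    have hbg := hb.inner_const (𝕜 := ℂ) g
    have hi : Integrable (fun t ↦ ⟪c t, f⟫_ℂ • b t) μ := by
      exact memLp_one_iff_integrable.1 (hb.smul hcf)
    have h1 : ‖⟪R f, g⟫_ℂ‖ ≤ ∫ t, ‖⟪c t, f⟫_ℂ‖ * ‖⟪b t, g⟫_ℂ‖ ∂μ := by
      rw [norm_inner_symm, hR, ← integral_inner hi]
      refine (norm_integral_le_integral_norm _).trans_eq (integral_congr_ae (.of_forall fun t ↦ ?_))
      simp only [inner_smul_right, norm_mul]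
      rw [norm_inner_symm g]
    have h2 := integral_mul_le_Lp_mul_Lq_of_nonneg (μ := μ) Real.HolderConjugate.two_two
      (f := fun t ↦ ‖⟪c t, f⟫_ℂ‖) (g := fun t ↦ ‖⟪b t, g⟫_ℂ‖)
      (.of_forall fun t ↦ norm_nonneg _) (.of_forall fun t ↦ norm_nonneg _)
      (by simpa using hcf.norm) (by simpa using hbg.norm)
    refine h1.trans (h2.trans_eq ?_)
    simp only [Real.rpow_two]
    rw [← hS, ← hP, ← Real.sqrt_eq_rpow, ← Real.sqrt_eq_rpow, Real.sqrt_sq (norm_nonneg _),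
      Real.sqrt_sq (norm_nonneg _)]
  exact ⟨P, Y, hPhs, hShs.of_norm_le hY, hRY⟩

end TraceClass

/-- Strongly continuous semigroups of contractions. -/
structure IsContractionSemigroup {H : Type*} [NormedAddCommGroup H] [InnerProductSpace ℂ H]
    (T : ℝ → H →L[ℂ] H) : Prop where
  map_zero : T 0 = 1
  map_add : ∀ s t : ℝ, 0 ≤ s → 0 ≤ t → T (s + t) = (T s).comp (T t)
  norm_le : ∀ t : ℝ, 0 ≤ t → ‖T t‖ ≤ 1
  continuousOn : ∀ f : H, ContinuousOn (fun t ↦ T t f) (Ici (0 : ℝ))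

namespace IsContractionSemigroup

variable {H : Type*} [NormedAddCommGroup H] [InnerProductSpace ℂ H] {T : ℝ → H →L[ℂ] H}

theorem norm_apply_le (hT : IsContractionSemigroup T) {t : ℝ} (ht : 0 ≤ t) (f : H) :
    ‖T t f‖ ≤ ‖f‖ :=
  (T t).le_of_opNorm_le (hT.norm_le t ht) f |>.trans_eq (one_mul _)

theorem apply_comm (hT : IsContractionSemigroup T) {s t : ℝ} (hs : 0 ≤ s) (ht : 0 ≤ t) (f : H) :
    T s (T t f) = T t (T s f) := by
  rw [← ContinuousLinearMap.comp_apply, ← hT.map_add s t hs ht, add_comm, hT.map_add t s ht hs,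
    ContinuousLinearMap.comp_apply]

/-- Orbits, extended by a constant to the negative half line, are continuous. -/
theorem continuous_max (hT : IsContractionSemigroup T) (f : H) :
    Continuous fun t : ℝ ↦ T (max t 0) f :=
  (hT.continuousOn f).comp_continuous (continuous_id.max continuous_const)
    fun _ ↦ mem_Ici.2 (le_max_right _ _)

/-- The infinitesimal generator of a contraction semigroup is dissipative. -/
theorem re_inner_nonneg_of_hasDerivWithinAt (hT : IsContractionSemigroup T) {w z : H}
    (h : HasDerivWithinAt (fun t ↦ T t w) (-z) (Ici (0 : ℝ)) 0) : 0 ≤ (⟪w, z⟫_ℂ).re := by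
  have h1 : HasDerivWithinAt (fun t ↦ (⟪w, T t w⟫_ℂ).re) (⟪w, -z⟫_ℂ).re (Ici (0 : ℝ)) 0 :=
    ((Complex.reCLM.comp ((innerSL ℂ w).restrictScalars ℝ)).hasFDerivAt).comp_hasDerivWithinAt 0 h
  have h2 := (hasDerivWithinAt_iff_tendsto_slope.1 h1)
  have h3 : (⟪w, -z⟫_ℂ).re ≤ 0 := by
    have : (nhdsWithin (0 : ℝ) (Ici 0 \ {0})).NeBot := by
      have h0 : Ici (0 : ℝ) \ {0} = Ioi 0 := by ext t; simp [lt_iff_le_and_ne, eq_comm]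
      rw [h0]; infer_instance
    refine le_of_tendsto h2 ?_
    filter_upwards [self_mem_nhdsWithin] with t ht
    have ht0 : (0 : ℝ) ≤ t := ht.1
    rw [slope_def_field]
    refine div_nonpos_of_nonpos_of_nonneg ?_ (by simpa using ht0)
    have h4 : (⟪w, T t w⟫_ℂ).re ≤ ‖w‖ * ‖w‖ :=
      ((Complex.re_le_norm _).trans (norm_inner_le_norm _ _)).trans
        (mul_le_mul_of_nonneg_left (hT.norm_apply_le ht0 w) (norm_nonneg _))
    have h5 : (⟪w, T 0 w⟫_ℂ).re = ‖w‖ * ‖w‖ := by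
      have := inner_self_eq_norm_mul_norm (𝕜 := ℂ) w
      simpa [hT.map_zero] using this
    rw [h5]
    linarith
  rw [inner_neg_right] at h3
  simpa using h3

theorem hasDerivWithinAt_Ici (hT : IsContractionSemigroup T) {w z : H}
    (h : HasDerivWithinAt (fun t ↦ T t w) (-z) (Ici (0 : ℝ)) 0) {t : ℝ} (ht : 0 ≤ t) :
    HasDerivWithinAt (fun s ↦ T s w) (-(T t z)) (Ici t) t := by
  have h1 : HasDerivWithinAt (fun s ↦ T t (T s w)) (T t (-z)) (Ici (0 : ℝ)) 0 :=
    (((T t).restrictScalars ℝ).hasFDerivAt).comp_hasDerivWithinAt 0 h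
  have h2 : HasDerivWithinAt (fun s : ℝ ↦ s - t) 1 (Ici t) t :=
    ((hasDerivAt_id t).sub_const t).hasDerivWithinAt
  have h3 := HasDerivWithinAt.scomp_of_eq t h1 h2
    (fun s hs ↦ sub_nonneg.2 (mem_Ici.1 hs)) (sub_self t).symm
  rw [one_smul, map_neg] at h3
  have h4 : ∀ s ∈ Ici t, T s w = T t (T (s - t) w) := fun s hs ↦ by
    rw [← ContinuousLinearMap.comp_apply, ← hT.map_add t (s - t) ht (sub_nonneg.2 hs),
      add_sub_cancel]
  exact h3.congr h4 (h4 t self_mem_Ici)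

theorem sub_eq_integral [CompleteSpace H] (hT : IsContractionSemigroup T) {w z : H}
    (h : HasDerivWithinAt (fun t ↦ T t w) (-z) (Ici (0 : ℝ)) 0) {t : ℝ} (ht : 0 ≤ t) :
    T t w = w - ∫ s in (0 : ℝ)..t, T (max s 0) z := by
  have h1 := intervalIntegral.integral_eq_sub_of_hasDeriv_right_of_le ht
    (f := fun s ↦ T s w) (f' := fun s ↦ -(T (max s 0) z))
    ((hT.continuousOn w).mono Icc_subset_Ici_self)
    (fun s hs ↦ by
      simpa [max_eq_left hs.1.le] using (hT.hasDerivWithinAt_Ici h hs.1.le).Ioi_of_Ici)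
    ((hT.continuous_max z).neg.intervalIntegrable 0 t)
  rw [intervalIntegral.integral_neg] at h1
  simp only [hT.map_zero, one_apply_eq_self] at h1
  rw [sub_eq_add_neg, h1]
  abel

theorem hasDerivAt [CompleteSpace H] (hT : IsContractionSemigroup T) {w z : H}
    (h : HasDerivWithinAt (fun t ↦ T t w) (-z) (Ici (0 : ℝ)) 0) {t : ℝ} (ht : 0 < t) :
    HasDerivAt (fun s ↦ T s w) (-(T t z)) t := by
  have h1 : HasDerivAt (fun u : ℝ ↦ w - ∫ s in (0 : ℝ)..u, T (max s 0) z)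
      (-(T (max t 0) z)) t :=
    ((hT.continuous_max z).integral_hasStrictDerivAt 0 t).hasDerivAt.const_sub w
  rw [max_eq_left ht.le] at h1
  refine h1.congr_of_eventuallyEq ?_
  filter_upwards [Ioi_mem_nhds ht] with u hu
  exact hT.sub_eq_integral h (le_of_lt hu)

theorem continuous_integral [CompleteSpace H] (hT : IsContractionSemigroup T) (t : ℝ) :
    Continuous fun f : H ↦ ∫ s in (0 : ℝ)..t, T (max s 0) f := by
  refine (LipschitzWith.of_dist_le_mul (K := ‖t‖₊) fun f g ↦ ?_).continuous
  rw [dist_eq_norm, dist_eq_norm, ← intervalIntegral.integral_sub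
    ((hT.continuous_max f).intervalIntegrable 0 t) ((hT.continuous_max g).intervalIntegrable 0 t)]
  refine (intervalIntegral.norm_integral_le_of_norm_le_const (C := ‖f - g‖) fun s _ ↦ ?_).trans_eq
    (by simp [mul_comm])
  rw [← map_sub]
  exact hT.norm_apply_le (le_max_right _ _) _

section Adjoint

variable [CompleteSpace H]

theorem norm_adjoint_apply_le (hT : IsContractionSemigroup T) {t : ℝ} (ht : 0 ≤ t) (x : H) :
    ‖ContinuousLinearMap.adjoint (T t) x‖ ≤ ‖x‖ := by
  refine ((ContinuousLinearMap.adjoint (T t)).le_of_opNorm_le (c := 1) ?_ x).trans_eq (one_mul _)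
  rw [LinearIsometryEquiv.norm_map]
  exact hT.norm_le t ht

theorem norm_adjoint_sub_sq_le (hT : IsContractionSemigroup T) {t : ℝ} (ht : 0 ≤ t) (x : H) :
    ‖ContinuousLinearMap.adjoint (T t) x - x‖ ^ 2 ≤ 2 * ‖x‖ * ‖T t x - x‖ := by
  have h1 := hT.norm_adjoint_apply_le ht x
  have h2 := norm_sub_sq (𝕜 := ℂ) (ContinuousLinearMap.adjoint (T t) x) x
  rw [ContinuousLinearMap.adjoint_inner_left] at h2
  have h3 : RCLike.re ⟪x, T t x⟫_ℂ = ‖x‖ ^ 2 + RCLike.re ⟪x, T t x - x⟫_ℂ := by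
    rw [inner_sub_right, map_sub, inner_self_eq_norm_sq]; ring
  have h4 : -RCLike.re ⟪x, T t x - x⟫_ℂ ≤ ‖x‖ * ‖T t x - x‖ :=
    (neg_le_abs _).trans ((RCLike.abs_re_le_norm _).trans (norm_inner_le_norm _ _))
  nlinarith [norm_nonneg (ContinuousLinearMap.adjoint (T t) x), norm_nonneg x]

/-- The adjoint semigroup is strongly continuous. -/
theorem continuousOn_adjoint (hT : IsContractionSemigroup T) (x : H) :
    ContinuousOn (fun t ↦ ContinuousLinearMap.adjoint (T t) x) (Ici (0 : ℝ)) := by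
  have key : ∀ s t : ℝ, 0 ≤ s → s ≤ t →
      ‖ContinuousLinearMap.adjoint (T t) x - ContinuousLinearMap.adjoint (T s) x‖ ^ 2
        ≤ 2 * ‖x‖ * ‖T |t - s| x - x‖ := by
    intro s t hs hst
    have hts := sub_nonneg.2 hst
    rw [abs_of_nonneg hts]
    refine le_trans ?_ (hT.norm_adjoint_sub_sq_le hts x)
    have h1 : T t = (T (t - s)).comp (T s) := by rw [← hT.map_add _ _ hts hs, sub_add_cancel]
    rw [h1, ContinuousLinearMap.adjoint_comp, ContinuousLinearMap.comp_apply, ← map_sub]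
    gcongr
    exact hT.norm_adjoint_apply_le hs _
  intro s hs
  have hlim : Filter.Tendsto (fun t : ℝ ↦ √(2 * ‖x‖ * ‖T |t - s| x - x‖))
      (nhdsWithin s (Ici 0)) (nhds 0) := by
    have h1 : Continuous fun t : ℝ ↦ √(2 * ‖x‖ * ‖T (max |t - s| 0) x - x‖) := by
      have := (hT.continuous_max x).comp (by fun_prop : Continuous fun t : ℝ ↦ |t - s|)
      exact Real.continuous_sqrt.comp (continuous_const.mul (this.sub continuous_const).norm)
    have h2 := (h1.tendsto s).mono_left (nhdsWithin_le_nhds (s := Ici (0 : ℝ)))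
    simpa [hT.map_zero] using h2
  refine tendsto_iff_norm_sub_tendsto_zero.2 (squeeze_zero' (.of_forall fun _ ↦ norm_nonneg _) ?_
    hlim)
  filter_upwards [self_mem_nhdsWithin] with t ht
  refine Real.le_sqrt_of_sq_le ?_
  rcases le_total s t with hst | hst
  · exact key s t hs hst
  · rw [norm_sub_rev, abs_sub_comm]
    exact key t s ht hst

/-- If the semigroup is generated on the range of a densely defined operator with `A + lam`
of dense range, then `A†` is adjoint to the whole generator. -/
theorem inner_eq_inner_adjoint (hT : IsContractionSemigroup T) {A : H →ₗ.[ℂ] H}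
    (hdense : Dense (A.domain : Set H)) {lam : ℝ} (hlam : 0 < lam)
    (hrange : Dense (Set.range fun f : A.domain ↦ A f + lam • (f : H)))
    (hgen : ∀ f : A.domain,
      HasDerivWithinAt (fun t ↦ T t (f : H)) (-(A f)) (Ici (0 : ℝ)) 0)
    {w z : H} (h : HasDerivWithinAt (fun t ↦ T t w) (-z) (Ici (0 : ℝ)) 0)
    (g : A.adjoint.domain) : ⟪(g : H), z⟫_ℂ = ⟪A.adjoint g, w⟫_ℂ := by
  obtain ⟨y, hy, hylim⟩ := mem_closure_iff_seq_limit.1 (hrange (z + lam • w))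
  choose f hf using hy
  have hest : ∀ n, lam * ‖(f n : H) - w‖ ≤ ‖y n - (z + lam • w)‖ := by
    intro n
    have hd : HasDerivWithinAt (fun t ↦ T t ((f n : H) - w)) (-(A (f n) - z)) (Ici (0 : ℝ)) 0 := by
      have hd' := (hgen (f n)).sub h
      rw [neg_sub_neg, ← neg_sub (A (f n)) z] at hd'
      exact hd'.congr (fun t _ ↦ map_sub (T t) _ _) (map_sub (T 0) _ _)
    have h0 := hT.re_inner_nonneg_of_hasDerivWithinAt hd
    set v := (f n : H) - w with hv
    have h1 : y n - (z + lam • w) = (A (f n) - z) + lam • v := by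
      rw [← hf, hv, smul_sub]
      dsimp only
      abel
    rw [h1]
    have h2 : (⟪v, (A (f n) - z) + lam • v⟫_ℂ).re = (⟪v, A (f n) - z⟫_ℂ).re + lam * ‖v‖ ^ 2 := by
      rw [inner_add_right, inner_smul_right_eq_smul, Complex.add_re, Complex.smul_re]
      have := inner_self_eq_norm_sq (𝕜 := ℂ) v
      simp only [RCLike.re_to_complex] at this
      rw [this, smul_eq_mul]
    have h3 : (⟪v, (A (f n) - z) + lam • v⟫_ℂ).re ≤ ‖v‖ * ‖(A (f n) - z) + lam • v‖ :=
      (Complex.re_le_norm _).trans (norm_inner_le_norm _ _)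
    rcases (norm_nonneg v).eq_or_lt with h4 | h4
    · rw [← h4]; simp
    · exact le_of_mul_le_mul_left (by nlinarith) h4
  have hflim : Filter.Tendsto (fun n ↦ (f n : H)) Filter.atTop (nhds w) := by
    rw [tendsto_iff_norm_sub_tendsto_zero] at hylim ⊢
    have h5 := hylim.const_mul lam⁻¹
    rw [mul_zero] at h5
    refine squeeze_zero (fun _ ↦ norm_nonneg _) (fun n ↦ ?_) h5
    rw [inv_mul_eq_div, le_div_iff₀ hlam, mul_comm]
    exact hest n
  have hAlim : Filter.Tendsto (fun n ↦ A (f n)) Filter.atTop (nhds z) := by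
    have h6 := hylim.sub (hflim.const_smul lam)
    rw [add_sub_cancel_right] at h6
    refine h6.congr fun n ↦ ?_
    rw [← hf]; simp
  refine tendsto_nhds_unique ((tendsto_const_nhds (x := (g : H))).inner hAlim) ?_
  refine ((tendsto_const_nhds (x := A.adjoint g)).inner hflim).congr fun n ↦ ?_
  exact LinearPMap.adjoint_isFormalAdjoint hdense g (f n)

/-- Weak differentiability of arbitrary orbits against the domain of the adjoint. -/
theorem hasDerivAt_inner_adjoint (hT : IsContractionSemigroup T) {A : H →ₗ.[ℂ] H}
    (hdense : Dense (A.domain : Set H)) {lam : ℝ} (hlam : 0 < lam)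
    (hrange : Dense (Set.range fun f : A.domain ↦ A f + lam • (f : H)))
    (hgen : ∀ f : A.domain,
      HasDerivWithinAt (fun t ↦ T t (f : H)) (-(A f)) (Ici (0 : ℝ)) 0)
    (g : A.adjoint.domain) (b : H) {t : ℝ} (ht : 0 < t) :
    HasDerivAt (fun s ↦ ⟪(g : H), T s b⟫_ℂ) (-⟪A.adjoint g, T t b⟫_ℂ) t := by
  have key : ∀ u : ℝ, 0 ≤ u → ∀ b : H, ⟪(g : H), T u b⟫_ℂ =
      ⟪(g : H), b⟫_ℂ - ⟪A.adjoint g, ∫ s in (0 : ℝ)..u, T (max s 0) b⟫_ℂ := by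
    intro u hu b
    have hcont := hT.continuous_integral u
    refine hdense.induction (P := fun b ↦ ⟪(g : H), T u b⟫_ℂ =
      ⟪(g : H), b⟫_ℂ - ⟪A.adjoint g, ∫ s in (0 : ℝ)..u, T (max s 0) b⟫_ℂ) ?_
      (isClosed_eq (by fun_prop) (by fun_prop)) b
    intro f hf
    have h1 := hT.sub_eq_integral (hgen ⟨f, hf⟩) hu
    simp only at h1
    rw [h1, inner_sub_right]
    congr 1
    have i1 := ((innerSL ℂ (g : H)).restrictScalars ℝ).intervalIntegral_comp_comm
      ((hT.continuous_max (A ⟨f, hf⟩)).intervalIntegrable (μ := volume) 0 u)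
    have i2 := ((innerSL ℂ (A.adjoint g)).restrictScalars ℝ).intervalIntegral_comp_comm
      ((hT.continuous_max f).intervalIntegrable (μ := volume) 0 u)
    simp only [ContinuousLinearMap.coe_restrictScalars', innerSL_apply_apply] at i1 i2
    rw [← i1, ← i2]
    refine intervalIntegral.integral_congr fun s _ ↦ ?_
    refine hT.inner_eq_inner_adjoint hdense hlam hrange hgen ?_ g
    have h2 : HasDerivWithinAt (fun s' ↦ T (max s 0) (T s' f)) (T (max s 0) (-(A ⟨f, hf⟩)))
        (Ici (0 : ℝ)) 0 :=
      (((T (max s 0)).restrictScalars ℝ).hasFDerivAt).comp_hasDerivWithinAt 0 (hgen ⟨f, hf⟩)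
    rw [map_neg] at h2
    exact h2.congr (fun s' hs' ↦ hT.apply_comm hs' (le_max_right _ _) f)
      (hT.apply_comm le_rfl (le_max_right _ _) f)
  have h1 : HasDerivAt (fun u : ℝ ↦ ∫ s in (0 : ℝ)..u, T (max s 0) b) (T (max t 0) b) t :=
    ((hT.continuous_max b).integral_hasStrictDerivAt 0 t).hasDerivAt
  have h2 : HasDerivAt (fun u : ℝ ↦
      ⟪(g : H), b⟫_ℂ - ⟪A.adjoint g, ∫ s in (0 : ℝ)..u, T (max s 0) b⟫_ℂ)
      (-⟪A.adjoint g, T (max t 0) b⟫_ℂ) t :=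
    ((((innerSL ℂ (A.adjoint g)).restrictScalars ℝ).hasFDerivAt).comp_hasDerivAt t h1).const_sub _
  rw [max_eq_left ht.le] at h2
  refine h2.congr_of_eventuallyEq ?_
  filter_upwards [Ioi_mem_nhds ht] with u hu
  exact key u (le_of_lt hu) b

end Adjoint

end IsContractionSemigroup

theorem norm_eq_norm_apply_one {H : Type*} [NormedAddCommGroup H] [InnerProductSpace ℂ H]
    (L : ℂ →L[ℂ] H) : ‖L‖ = ‖L 1‖ := by
  conv_lhs => rw [show L = ContinuousLinearMap.toSpanSingleton ℂ (L 1) by ext; simp]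
  exact ContinuousLinearMap.norm_toSpanSingleton _

theorem integrableOn_laplace {F : Type*} [NormedAddCommGroup F] [NormedSpace ℂ F]
    {u : ℝ → F} {K : ℝ} (hu : ContinuousOn u (Ici 0)) (hK : ∀ t, 0 ≤ t → ‖u t‖ ≤ K)
    {s : ℂ} (hs : 0 < s.re) :
    IntegrableOn (fun t : ℝ ↦ Complex.exp (-(s * (t : ℂ))) • u t) (Ioi 0) := by
  have hint : IntegrableOn (fun t ↦ K * Real.exp (-s.re * t)) (Ioi (0 : ℝ)) :=
    (exp_neg_integrableOn_Ioi 0 hs).const_mul K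
  refine Integrable.mono' hint ?_ ?_
  · have hc : Continuous fun t : ℝ ↦ Complex.exp (-(s * (t : ℂ))) := by fun_prop
    exact ((hc.continuousOn.smul hu).mono Ioi_subset_Ici_self).aestronglyMeasurable
      measurableSet_Ioi
  · refine (ae_restrict_iff' measurableSet_Ioi).2 (.of_forall fun t ht ↦ ?_)
    rw [norm_smul, Complex.norm_exp, mul_comm]
    have : (-(s * (t : ℂ))).re = -s.re * t := by simp
    rw [this]
    exact mul_le_mul_of_nonneg_right (hK t (le_of_lt ht)) (Real.exp_pos _).le

/-- Duality between the Laplace transforms of a semigroup and of its adjoint. -/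
theorem IsContractionSemigroup.laplace_adjoint {H : Type*} [NormedAddCommGroup H]
    [InnerProductSpace ℂ H] [CompleteSpace H] {T : ℝ → H →L[ℂ] H} (hT : IsContractionSemigroup T)
    (c f : H) {s : ℂ} (hs : 0 < s.re) :
    ⟪c, ∫ t in Ioi (0 : ℝ), Complex.exp (-(s * (t : ℂ))) • T t f⟫_ℂ =
      ⟪∫ t in Ioi (0 : ℝ), Complex.exp (-((starRingEnd ℂ) s * (t : ℂ))) •
        ContinuousLinearMap.adjoint (T t) c, f⟫_ℂ := by
  have h1 := integrableOn_laplace (hT.continuousOn f)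
    (fun t ht ↦ hT.norm_apply_le ht f) hs
  have h2 := integrableOn_laplace (hT.continuousOn_adjoint c)
    (fun t ht ↦ hT.norm_adjoint_apply_le ht c) (s := (starRingEnd ℂ) s) (by simpa using hs)
  rw [← integral_inner h1, ← inner_conj_symm, ← integral_inner h2, ← integral_conj]
  refine integral_congr_ae (.of_forall fun t ↦ ?_)
  simp only [inner_smul_right, map_mul, inner_conj_symm, ContinuousLinearMap.adjoint_inner_left,
    ← Complex.exp_conj, map_neg, Complex.conj_conj, Complex.conj_ofReal]

theorem memLp_two_of_lintegral_lt_top {F : Type*} [NormedAddCommGroup F] {μ : Measure ℝ}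
    {u : ℝ → F} (hu : AEStronglyMeasurable u μ) (h : ∫⁻ t, ‖u t‖ₑ ^ 2 ∂μ < ⊤) :
    MemLp u 2 μ := by
  refine ⟨hu, ?_⟩
  rw [eLpNorm_eq_lintegral_rpow_enorm_toReal (by norm_num) (by norm_num)]
  simp only [ENNReal.toReal_ofNat, ENNReal.rpow_ofNat]
  exact ENNReal.rpow_lt_top_of_nonneg (by norm_num) h.ne

/-- Tails of integrals of continuous functions on the half line are differentiable. -/
theorem hasDerivAt_integral_Ioi {φ : ℝ → ℂ} (hφ : ContinuousOn φ (Ici 0))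
    (hi : IntegrableOn φ (Ioi 0)) :
    (∀ x, 0 < x → HasDerivAt (fun y ↦ ∫ t in Ioi y, φ t) (-φ x) x) ∧
      HasDerivWithinAt (fun y ↦ ∫ t in Ioi y, φ t) (-φ 0) (Ici 0) 0 := by
  have hc : Continuous fun t : ℝ ↦ φ (max t 0) :=
    hφ.comp_continuous (by fun_prop) fun _ ↦ mem_Ici.2 (le_max_right _ _)
  have heq : ∀ y, 0 ≤ y → ∫ t in Ioi y, φ t =
      (∫ t in Ioi (0 : ℝ), φ t) - ∫ t in (0 : ℝ)..y, φ (max t 0) := by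
    intro y hy
    have h1 : ∫ t in (0 : ℝ)..y, φ (max t 0) = ∫ t in (0 : ℝ)..y, φ t := by
      refine intervalIntegral.integral_congr fun t ht ↦ ?_
      rw [uIcc_of_le hy] at ht
      simp [max_eq_left ht.1]
    rw [h1, ← intervalIntegral.integral_interval_add_Ioi' (a := 0) (b := y)
      ((intervalIntegrable_iff_integrableOn_Ioc_of_le hy).2 (hi.mono_set Ioc_subset_Ioi_self))
      (hi.mono_set (Ioi_subset_Ioi hy))]
    ring
  have hd : ∀ x, 0 ≤ x → HasDerivAt (fun y ↦
      (∫ t in Ioi (0 : ℝ), φ t) - ∫ t in (0 : ℝ)..y, φ (max t 0)) (-φ x) x := by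
    intro x hx
    have := (hc.integral_hasStrictDerivAt 0 x).hasDerivAt.const_sub (∫ t in Ioi (0 : ℝ), φ t)
    simpa [max_eq_left hx] using this
  refine ⟨fun x hx ↦ (hd x hx.le).congr_of_eventuallyEq ?_,
    (hd 0 le_rfl).hasDerivWithinAt.congr (fun y hy ↦ heq y hy) (heq 0 le_rfl)⟩
  filter_upwards [Ioi_mem_nhds hx] with y hy
  exact heq y (le_of_lt hy)

/-- Let `(-A, B, C)` be a continuous-time linear system on a separable complex Hilbert space `H`
with input/output space `ℂ`, where `A` is densely defined maximally accretive so that `-A`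
generates a strongly continuous contraction semigroup `Tsem t = e^{-tA}`, and suppose the
Hardy-space conditions hold for `C (sI + A)⁻¹` and `(sI + A)⁻¹ B` (with the resolvent given by
the Laplace transform of the semigroup).  Then `∫₀^∞ ‖C e^{-tA}‖² dt` and
`∫₀^∞ ‖e^{-tA} B‖² dt` are finite, the rank-one operators `e^{-tA} B C e^{-tA}` satisfy the
stated trace-norm (= operator-norm, for rank one) bound, `R x = ∫ₓ^∞ e^{-tA} B C e^{-tA} dt`
is trace class for every `x ≥ 0`, and `(R x)` satisfies Lyapunov's equation weakly. -/
theorem stmt_11 {H : Type*} [NormedAddCommGroup H] [InnerProductSpace ℂ H] [CompleteSpace H]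
    [TopologicalSpace.SeparableSpace H]
    (A : H →ₗ.[ℂ] H) (hdense : Dense (A.domain : Set H))
    (haccretive : ∀ f : A.domain, 0 ≤ (⟪A f, (f : H)⟫_ℂ).re)
    (hmax : ∃ lam : ℝ, 0 < lam ∧
      Dense (Set.range fun f : A.domain => A f + lam • (f : H)))
    (Tsem : ℝ → H →L[ℂ] H)
    (hT0 : Tsem 0 = 1)
    (hTsg : ∀ s t : ℝ, 0 ≤ s → 0 ≤ t → Tsem (s + t) = (Tsem s).comp (Tsem t))
    (hTcontr : ∀ t : ℝ, 0 ≤ t → ‖Tsem t‖ ≤ 1)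
    (hTcont : ∀ f : H, ContinuousOn (fun t => Tsem t f) (Ici (0 : ℝ)))
    (hgen : ∀ f : A.domain,
      HasDerivWithinAt (fun t => Tsem t (f : H)) (-(A f)) (Ici (0 : ℝ)) 0)
    (B : ℂ →L[ℂ] H) (C : H →L[ℂ] ℂ)
    (Res : ℂ → H →L[ℂ] H)
    (hRes : ∀ s : ℂ, 0 < s.re → ∀ f : H,
      Res s f = ∫ t in Ioi (0 : ℝ), Complex.exp (-(s * (t : ℂ))) • Tsem t f)
    (hHardyC : ∃ M : ℝ, ∀ ε : ℝ, 0 < ε →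
      (∫⁻ ω : ℝ, (‖C.comp (Res ((ε : ℂ) + (ω : ℂ) * Complex.I))‖₊ : ℝ≥0∞) ^ 2)
        ≤ ENNReal.ofReal M)
    (hHardyB : ∃ M : ℝ, ∀ ε : ℝ, 0 < ε →
      (∫⁻ ω : ℝ, (‖(Res ((ε : ℂ) + (ω : ℂ) * Complex.I)).comp B‖₊ : ℝ≥0∞) ^ 2)
        ≤ ENNReal.ofReal M)
    (R : ℝ → H →L[ℂ] H)
    (hR : ∀ x : ℝ, 0 ≤ x → ∀ f : H,
      R x f = ∫ t in Ioi x, Tsem t (B (C (Tsem t f)))) :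
    -- `∫₀^∞ ‖C e^{-tA}‖² dt < ∞`
    ((∫⁻ t in Ioi (0 : ℝ), (‖C.comp (Tsem t)‖₊ : ℝ≥0∞) ^ 2) < ⊤)
    ∧
    -- `∫₀^∞ ‖e^{-tA} B‖² dt < ∞`
    ((∫⁻ t in Ioi (0 : ℝ), (‖(Tsem t).comp B‖₊ : ℝ≥0∞) ^ 2) < ⊤)
    ∧
    -- the trace-norm bound on the rank-one operators `e^{-tA} B C e^{-tA}`
    ((∫⁻ t in Ioi (0 : ℝ), (‖((Tsem t).comp ((B.comp C).comp (Tsem t)))‖₊ : ℝ≥0∞))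
      ≤ (∫⁻ t in Ioi (0 : ℝ), (‖(Tsem t).comp B‖₊ : ℝ≥0∞) ^ 2) ^ ((1 : ℝ) / 2)
          * (∫⁻ t in Ioi (0 : ℝ), (‖C.comp (Tsem t)‖₊ : ℝ≥0∞) ^ 2) ^ ((1 : ℝ) / 2)
      ∧ (∫⁻ t in Ioi (0 : ℝ), (‖((Tsem t).comp ((B.comp C).comp (Tsem t)))‖₊ : ℝ≥0∞)) < ⊤)
    ∧
    -- `R x` is trace class for every `x ≥ 0`
    (∀ x : ℝ, 0 ≤ x → IsTraceClass (R x))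
    ∧
    -- the weak Lyapunov equation
    (∀ (f : A.domain) (g : A.adjoint.domain),
      (∀ x : ℝ, 0 < x →
        HasDerivAt (fun y : ℝ => ⟪(g : H), R y (f : H)⟫_ℂ)
          (-⟪(g : H), R x (A f)⟫_ℂ - ⟪(A.adjoint g : H), R x (f : H)⟫_ℂ) x)
      ∧ HasDerivWithinAt (fun y : ℝ => ⟪(g : H), R y (f : H)⟫_ℂ)
          (-⟪(g : H), B (C (f : H))⟫_ℂ) (Ici (0 : ℝ)) 0) := by
  have hT : IsContractionSemigroup Tsem := ⟨hT0, hTsg, hTcontr, hTcont⟩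
  obtain ⟨lam, hlam, hrange⟩ := hmax
  obtain ⟨M₁, hM₁⟩ := hHardyC
  obtain ⟨M₂, hM₂⟩ := hHardyB
  set b : ℝ → H := fun t ↦ Tsem t (B 1) with hb
  set c₀ : H := (InnerProductSpace.toDual ℂ H).symm C with hc₀
  have hC : ∀ f, C f = ⟪c₀, f⟫_ℂ := fun f ↦ by rw [hc₀, InnerProductSpace.toDual_symm_apply]
  set c : ℝ → H := fun t ↦ ContinuousLinearMap.adjoint (Tsem t) c₀ with hc
  have hCT : ∀ t f, C (Tsem t f) = ⟪c t, f⟫_ℂ := fun t f ↦ by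
    rw [hC, hc, ContinuousLinearMap.adjoint_inner_left]
  have hnb : ∀ t, ‖(Tsem t).comp B‖ₑ = ‖b t‖ₑ := fun t ↦ by
    rw [← ofReal_norm, norm_eq_norm_apply_one, ofReal_norm]; rfl
  have hnc : ∀ t, ‖C.comp (Tsem t)‖ₑ = ‖c t‖ₑ := fun t ↦ by
    have : C.comp (Tsem t) = innerSL ℂ (c t) := by ext f; simp [hCT]
    rw [this, ← ofReal_norm, innerSL_apply_norm, ofReal_norm]
  have hbcont : ContinuousOn b (Ici 0) := hTcont (B 1)
  have hccont : ContinuousOn c (Ici 0) := hT.continuousOn_adjoint c₀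
  have hbm : AEStronglyMeasurable b (volume.restrict (Ioi 0)) :=
    (hbcont.mono Ioi_subset_Ici_self).aestronglyMeasurable measurableSet_Ioi
  have hcm : AEStronglyMeasurable c (volume.restrict (Ioi 0)) :=
    (hccont.mono Ioi_subset_Ici_self).aestronglyMeasurable measurableSet_Ioi
  have hb2 : ∫⁻ t in Ioi (0 : ℝ), ‖b t‖ₑ ^ 2 < ⊤ := by
    refine lintegral_enorm_sq_lt_top_of_laplace hbcont
      (fun t ht ↦ hT.norm_apply_le ht (B 1)) (M := M₂) fun ε hε ↦ ?_
    refine (lintegral_congr fun ω ↦ ?_).trans_le (hM₂ ε hε)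
    rw [← hRes _ (by simpa using hε), ← enorm_eq_nnnorm, ← ofReal_norm, ← ofReal_norm,
      norm_eq_norm_apply_one]
    rfl
  have hc2 : ∫⁻ t in Ioi (0 : ℝ), ‖c t‖ₑ ^ 2 < ⊤ := by
    refine lintegral_enorm_sq_lt_top_of_laplace hccont
      (fun t ht ↦ hT.norm_adjoint_apply_le ht c₀) (M := M₁) fun ε hε ↦ ?_
    refine le_trans (le_of_eq ?_) (hM₁ ε hε)
    rw [← (Measure.measurePreserving_neg (volume : Measure ℝ)).lintegral_comp_emb
      (MeasurableEquiv.neg ℝ).measurableEmbedding]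
    refine lintegral_congr fun ω ↦ ?_
    have hs : 0 < ((ε : ℂ) + (ω : ℂ) * Complex.I).re := by simpa using hε
    have h1 : C.comp (Res ((ε : ℂ) + (ω : ℂ) * Complex.I)) = innerSL ℂ
        (∫ t in Ioi (0 : ℝ), Complex.exp (-(((ε : ℂ) + ((-ω : ℝ) : ℂ) * Complex.I) * (t : ℂ)))
          • c t) := by
      ext f
      rw [ContinuousLinearMap.comp_apply, hRes _ hs, hC, hT.laplace_adjoint c₀ f hs]
      simp [hc]
    rw [h1, ← enorm_eq_nnnorm, ← ofReal_norm, ← ofReal_norm, innerSL_apply_norm]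
  have hbL : MemLp b 2 (volume.restrict (Ioi 0)) := memLp_two_of_lintegral_lt_top hbm hb2
  have hcL : MemLp c 2 (volume.restrict (Ioi 0)) := memLp_two_of_lintegral_lt_top hcm hc2
  have hB1 : ∀ z, B z = z • B 1 := fun z ↦ by rw [← map_smul, smul_eq_mul, mul_one]
  have hRbc : ∀ x : ℝ, 0 ≤ x → ∀ f, R x f = ∫ t in Ioi x, ⟪c t, f⟫_ℂ • b t := fun x hx f ↦ by
    rw [hR x hx]
    refine integral_congr_ae (.of_forall fun t ↦ ?_)
    simp only [hb]
    rw [hCT, hB1, map_smul]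
  simp only [← enorm_eq_nnnorm, hnb, hnc]
  have hholder : (∫⁻ t in Ioi (0 : ℝ), ‖(Tsem t).comp ((B.comp C).comp (Tsem t))‖ₑ)
      ≤ (∫⁻ t in Ioi (0 : ℝ), ‖b t‖ₑ ^ 2) ^ ((1 : ℝ) / 2)
          * (∫⁻ t in Ioi (0 : ℝ), ‖c t‖ₑ ^ 2) ^ ((1 : ℝ) / 2) := by
    have h1 := ENNReal.lintegral_mul_le_Lp_mul_Lq (volume.restrict (Ioi (0 : ℝ)))
      Real.HolderConjugate.two_two hbm.enorm hcm.enorm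
    simp only [ENNReal.rpow_ofNat] at h1
    refine (lintegral_mono fun t ↦ ?_).trans h1
    rw [Pi.mul_apply, ← hnb, ← hnc, ← ofReal_norm, ← ofReal_norm, ← ofReal_norm,
      ← ENNReal.ofReal_mul (norm_nonneg _)]
    exact ENNReal.ofReal_le_ofReal (((Tsem t).comp B).opNorm_comp_le (C.comp (Tsem t)))
  refine ⟨hc2, hb2, ⟨hholder, hholder.trans_lt (ENNReal.mul_lt_top
    (ENNReal.rpow_lt_top_of_nonneg (by norm_num) hb2.ne)
    (ENNReal.rpow_lt_top_of_nonneg (by norm_num) hc2.ne))⟩, fun x hx ↦ ?_, fun f g ↦ ?_⟩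
  · have hle : volume.restrict (Ioi x) ≤ volume.restrict (Ioi (0 : ℝ)) :=
      Measure.restrict_mono (Ioi_subset_Ioi hx) le_rfl
    exact isTraceClass_of_eq_integral (hbL.mono_measure hle) (hcL.mono_measure hle) (hRbc x hx)
  · have hint : ∀ k h : H, IntegrableOn (fun t ↦ ⟪h, b t⟫_ℂ * ⟪c t, k⟫_ℂ) (Ioi 0) := fun k h ↦
      memLp_one_iff_integrable.1 ((hcL.inner_const (𝕜 := ℂ) k).mul (hbL.const_inner (𝕜 := ℂ) h))
    have hRin : ∀ x : ℝ, 0 ≤ x → ∀ k h : H,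
        ⟪h, R x k⟫_ℂ = ∫ t in Ioi x, ⟪h, b t⟫_ℂ * ⟪c t, k⟫_ℂ := fun x hx k h ↦ by
      have hle : volume.restrict (Ioi x) ≤ volume.restrict (Ioi (0 : ℝ)) :=
        Measure.restrict_mono (Ioi_subset_Ioi hx) le_rfl
      have hi : IntegrableOn (fun t ↦ ⟪c t, k⟫_ℂ • b t) (Ioi x) :=
        memLp_one_iff_integrable.1 ((hbL.mono_measure hle).smul
          ((hcL.mono_measure hle).inner_const (𝕜 := ℂ) k))
      rw [hRbc x hx, ← integral_inner hi]
      refine integral_congr_ae (.of_forall fun t ↦ ?_)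
      simp only [inner_smul_right, mul_comm]
    set φ : ℝ → ℂ := fun t ↦ ⟪(g : H), b t⟫_ℂ * ⟪c t, (f : H)⟫_ℂ with hφ
    have hφc : ContinuousOn φ (Ici 0) :=
      (continuousOn_const.inner hbcont).mul (hccont.inner continuousOn_const)
    obtain ⟨hd, hd0⟩ := hasDerivAt_integral_Ioi hφc (hint f g)
    have hφd : ∀ t, 0 < t → HasDerivAt φ (-(⟪A.adjoint g, b t⟫_ℂ * ⟪c t, (f : H)⟫_ℂ)
        - ⟪(g : H), b t⟫_ℂ * ⟪c t, A f⟫_ℂ) t := by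
      intro t ht
      have h1 := hT.hasDerivAt_inner_adjoint hdense hlam hrange hgen g (B 1) ht
      have h2 : HasDerivAt (fun s ↦ ⟪c s, (f : H)⟫_ℂ) (-⟪c t, A f⟫_ℂ) t := by
        have h3 := ((C.restrictScalars ℝ).hasFDerivAt).comp_hasDerivAt t
          (hT.hasDerivAt (hgen f) ht)
        simpa [Function.comp_def, hCT] using h3
      refine (h1.mul h2).congr_deriv ?_
      simp only [hb]
      ring
    have hneg : IntegrableOn (fun t ↦ -(⟪A.adjoint g, b t⟫_ℂ * ⟪c t, (f : H)⟫_ℂ)) (Ioi 0) :=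
      (hint f (A.adjoint g)).neg
    have hφi := hneg.sub (hint (A f) g)
    have hlim := tendsto_zero_of_hasDerivAt_of_integrableOn_Ioi (a := 0)
      (fun t ht ↦ hφd t ht) hφi (hint f g)
    refine ⟨fun x hx ↦ ?_, ?_⟩
    · have hsub : Ioi x ⊆ Ioi (0 : ℝ) := Ioi_subset_Ioi hx.le
      have h1 := integral_Ioi_of_hasDerivAt_of_tendsto' (a := x)
        (fun t ht ↦ hφd t (lt_of_lt_of_le hx ht)) (hφi.mono_set hsub) hlim
      rw [integral_sub (hneg.mono_set hsub) ((hint (A f) g).mono_set hsub),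
        integral_neg, ← hRin x hx.le, ← hRin x hx.le, zero_sub] at h1
      refine ((hd x hx).congr_of_eventuallyEq ?_).congr_deriv ?_
      · filter_upwards [Ioi_mem_nhds hx] with y hy
        exact hRin y (le_of_lt hy) f g
      · rw [← h1]; ring
    · refine (hd0.congr (fun y hy ↦ hRin y hy f g) (hRin 0 le_rfl f g)).congr_deriv ?_
      simp only [hφ, hb]
      rw [← hCT, hT0, one_apply_eq_self, one_apply_eq_self, hB1 (C f), inner_smul_right, mul_comm]
end

section
/- Let 𝒯 be the set of measurable functions T : (0,∞)×(0,∞) → ℂ with T(x,y) = 0 for 0 < y < x and ∫₀^∞ ∫_x^∞ |T(x,y)|² dy dx < ∞, for T ∈ 𝒯 let V_T f(x) = f(x) + ∫_x^∞ T(x,y) f(y) dy on L²((0,∞);ℂ), and let 𝒢 = {V_T : T ∈ 𝒯, V_T invertible in ℒ(L²((0,∞);ℂ))}. Then: (a) for every V ∈ 𝒢 and every a > 0, V maps the subspace L²((0,a);ℂ) (functions vanishing a.e. on (a,∞)) into itself; (b) 𝒢 is a group under operator composition: the product of two elements of 𝒢 lies in 𝒢, and the inverse of V_T ∈ 𝒢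 has the form V_H = I + H for some H ∈ 𝒯, so lies in 𝒢. -/
open MeasureTheory Set
open scoped ENNReal NNReal

/-- The class `𝒯` of upper-triangular Hilbert–Schmidt kernels on `(0,∞) × (0,∞)`. -/
def MemT (T : ℝ → ℝ → ℂ) : Prop :=
  Measurable (Function.uncurry T)
    ∧ (∀ x y : ℝ, 0 < y → y < x → T x y = 0)
    ∧ (∫⁻ x in Ioi (0 : ℝ), ∫⁻ y in Ioi x, (‖T x y‖₊ : ℝ≥0∞) ^ 2) < ⊤

/-- `V` is the operator `V_T = I + (integral operator with kernel T)` on `L²((0,∞);ℂ)`. -/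
def RepresentsVT (T : ℝ → ℝ → ℂ)
    (V : Lp ℂ 2 (volume.restrict (Ioi (0 : ℝ))) →L[ℂ] Lp ℂ 2 (volume.restrict (Ioi (0 : ℝ)))) :
    Prop :=
  ∀ f : Lp ℂ 2 (volume.restrict (Ioi (0 : ℝ))),
    ∀ᵐ x ∂(volume.restrict (Ioi (0 : ℝ))),
      (V f : ℝ → ℂ) x = f x + ∫ y in Ioi x, T x y * f y

section HilbertSchmidt

variable {α β : Type*} [MeasurableSpace α] [MeasurableSpace β] {μ : Measure α}

/-- A map into `L²` represented by a jointly measurable kernel is strongly measurable. -/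
theorem stronglyMeasurable_of_coeFn_ae_eq [SFinite μ] [MeasurableSpace.CountablyGenerated α]
    {k : β → α → ℂ} (hk : Measurable (Function.uncurry k)) {G : β → Lp ℂ 2 μ}
    (hG : ∀ b, G b =ᵐ[μ] k b) : StronglyMeasurable G := by
  let m : MeasurableSpace (Lp ℂ 2 μ) := borel _
  have : BorelSpace (Lp ℂ 2 μ) := ⟨rfl⟩
  have : Fact ((2 : ℝ≥0∞) ≠ ∞) := ⟨by simp⟩
  refine Measurable.stronglyMeasurable ?_
  have hdist : ∀ c : Lp ℂ 2 μ, Measurable fun b => edist (G b) c := by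
    intro c
    have hc : Measurable fun b => ∫⁻ x, ‖k b x - c x‖ₑ ^ 2 ∂μ := by
      refine Measurable.lintegral_prod_right' (f := fun p : β × α => ‖k p.1 p.2 - c p.2‖ₑ ^ 2) ?_
      exact ((hk.sub ((Lp.stronglyMeasurable c).measurable.comp measurable_snd)).enorm).pow_const 2
    have heq : (fun b => edist (G b) c)
        = fun b => (∫⁻ x, ‖k b x - c x‖ₑ ^ 2 ∂μ) ^ (1 / 2 : ℝ) := by
      ext b
      rw [Lp.edist_def, eLpNorm_eq_lintegral_rpow_enorm_toReal (by simp) (by simp)]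
      simp only [ENNReal.toReal_ofNat, ENNReal.rpow_ofNat]
      congr 1
      refine lintegral_congr_ae ?_
      filter_upwards [hG b] with x hx
      simp [hx]
    rw [heq]
    exact hc.pow_const _
  refine measurable_of_isOpen fun s hs => ?_
  obtain ⟨t, ht, htU⟩ := TopologicalSpace.isOpen_iUnion_countable
    (fun p : {p : Lp ℂ 2 μ × ℝ≥0∞ // Metric.eball p.1 p.2 ⊆ s} => Metric.eball p.1.1 p.1.2)
    (fun p => Metric.isOpen_eball)
  have hsU : s = ⋃ p : {p : Lp ℂ 2 μ × ℝ≥0∞ // Metric.eball p.1 p.2 ⊆ s},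
      Metric.eball p.1.1 p.1.2 := by
    refine Subset.antisymm (fun x hx => ?_) (iUnion_subset fun p => p.2)
    obtain ⟨ε, hε, hεs⟩ := EMetric.isOpen_iff.1 hs x hx
    exact mem_iUnion.2 ⟨⟨(x, ε), hεs⟩, Metric.mem_eball_self hε⟩
  rw [hsU, ← htU, preimage_iUnion₂]
  refine MeasurableSet.biUnion ht fun p _ => ?_
  exact measurableSet_lt (hdist p.1.1) measurable_const

/-- The integral operator with square-integrable kernel `S` is the Bochner integral of the
columns of `S`. -/
theorem integralOperator_eq_integral_smul [SigmaFinite μ]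
    {S : α → α → ℂ}
    (hS : Measurable (Function.uncurry S))
    (hS2 : ∫⁻ x, ∫⁻ y, ‖S x y‖ₑ ^ 2 ∂μ ∂μ < ⊤) {G : α → Lp ℂ 2 μ}
    (hG : ∀ y, G y =ᵐ[μ] fun x => S x y) {P : Lp ℂ 2 μ →L[ℂ] Lp ℂ 2 μ} {f : Lp ℂ 2 μ}
    (hP : ∀ᵐ x ∂μ, P f x = ∫ y, S x y * f y ∂μ) (hint : Integrable (fun y => f y • G y) μ) :
    P f = ∫ y, f y • G y ∂μ := by
  have hSL : MemLp (Function.uncurry S) 2 (μ.prod μ) := by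
    refine ⟨hS.aestronglyMeasurable, ?_⟩
    rw [eLpNorm_lt_top_iff_lintegral_rpow_enorm_lt_top (by simp) (by simp)]
    rw [lintegral_prod _ (by fun_prop)]
    simpa using hS2
  refine ext_inner_left ℂ fun g => ?_
  have hgf : MemLp (fun p : α × α => (starRingEnd ℂ) (g p.1) * f p.2) 2 (μ.prod μ) := by
    have hf := (Lp.stronglyMeasurable f).comp_measurable (measurable_snd : Measurable (Prod.snd : α × α → α))
    have hg := (Lp.stronglyMeasurable g).comp_measurable (measurable_fst : Measurable (Prod.fst : α × α → α))
    refine (memLp_two_iff_integrable_sq_norm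
      ((Complex.continuous_conj.comp_stronglyMeasurable hg).mul hf).aestronglyMeasurable).2 ?_
    have := ((memLp_two_iff_integrable_sq_norm (Lp.memLp g).1).1 (Lp.memLp g)).mul_prod
      ((memLp_two_iff_integrable_sq_norm (Lp.memLp f).1).1 (Lp.memLp f))
    simpa [mul_pow] using this
  have hF : Integrable (Function.uncurry fun x y => (starRingEnd ℂ) (g x) * (S x y * f y))
      (μ.prod μ) := by
    refine (hSL.integrable_mul hgf).congr (Filter.Eventually.of_forall fun p => ?_)
    simp only [Pi.mul_apply, Function.uncurry]
    ring
  calc inner ℂ g (P f) = ∫ x, ∫ y, (starRingEnd ℂ) (g x) * (S x y * f y) ∂μ ∂μ := by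
        rw [L2.inner_def]
        refine integral_congr_ae ?_
        filter_upwards [hP] with x hx
        rw [integral_const_mul, ← hx, RCLike.inner_apply, mul_comm]
    _ = ∫ y, ∫ x, (starRingEnd ℂ) (g x) * (S x y * f y) ∂μ ∂μ := integral_integral_swap hF
    _ = ∫ y, inner ℂ g (f y • G y) ∂μ := by
        refine integral_congr_ae (Filter.Eventually.of_forall fun y => ?_)
        simp only [inner_smul_right, L2.inner_def]
        rw [← integral_const_mul]
        refine integral_congr_ae ?_
        filter_upwards [hG y] with x hx
        rw [RCLike.inner_apply, hx]
        ring
    _ = inner ℂ g (∫ y, f y • G y ∂μ) := integral_inner hint g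

end HilbertSchmidt

/-- Lebesgue measure on `(0, ∞)`. -/
noncomputable abbrev halfLine : Measure ℝ := volume.restrict (Ioi 0)

/-- The Hilbert space `L²((0, ∞); ℂ)`. -/
noncomputable abbrev LTwo : Type := Lp ℂ 2 halfLine

/-- Strictly upper triangular Hilbert–Schmidt kernels, extended by zero below the diagonal. -/
structure IsTriangularKernel (S : ℝ → ℝ → ℂ) : Prop where
  measurable : Measurable (Function.uncurry S)
  eq_zero : ∀ x y, y ≤ x → S x y = 0
  lintegral_lt_top : ∫⁻ x, ∫⁻ y, ‖S x y‖ₑ ^ 2 ∂halfLine ∂halfLine < ⊤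

/-- `P` is the integral operator with kernel `S`. -/
def HasKernel (S : ℝ → ℝ → ℂ) (P : LTwo →L[ℂ] LTwo) : Prop :=
  ∀ f : LTwo, ∀ᵐ x ∂halfLine, P f x = ∫ y, S x y * f y ∂halfLine

/-- `Q` maps functions supported in `(0, a)` to functions supported in `(0, a)`. -/
def PreservesInitial (Q : LTwo →L[ℂ] LTwo) : Prop :=
  ∀ a : ℝ, 0 < a → ∀ f : LTwo, (∀ᵐ x ∂halfLine, a < x → f x = 0) →
    ∀ᵐ x ∂halfLine, a < x → Q f x = 0

theorem memLp_two_of_lintegral_lt_top_s12 {α : Type*} [MeasurableSpace α] {μ : Measure α} {k : α → ℂ}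
    (hk : Measurable k) (h : ∫⁻ x, ‖k x‖ₑ ^ 2 ∂μ < ⊤) : MemLp k 2 μ := by
  refine ⟨hk.aestronglyMeasurable, ?_⟩
  rw [eLpNorm_lt_top_iff_lintegral_rpow_enorm_lt_top (by simp) (by simp)]
  simpa using h

/-- The Cauchy–Schwarz inequality for the pairing of two functions. -/
theorem enorm_integral_mul_sq_le {α : Type*} [MeasurableSpace α] {μ : Measure α} {f g : α → ℂ}
    (hf : AEStronglyMeasurable f μ) (hg : AEStronglyMeasurable g μ) :
    ‖∫ x, f x * g x ∂μ‖ₑ ^ 2 ≤ (∫⁻ x, ‖f x‖ₑ ^ 2 ∂μ) * ∫⁻ x, ‖g x‖ₑ ^ 2 ∂μ := by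
  have h := ENNReal.lintegral_mul_le_Lp_mul_Lq μ Real.HolderConjugate.two_two
    hf.enorm hg.enorm
  have h' : ‖∫ x, f x * g x ∂μ‖ₑ ≤ ∫⁻ x, ((fun x => ‖f x‖ₑ) * fun x => ‖g x‖ₑ) x ∂μ := by
    refine (enorm_integral_le_lintegral_enorm _).trans (le_of_eq ?_)
    simp
  calc _ ≤ ((∫⁻ x, ‖f x‖ₑ ^ (2 : ℝ) ∂μ) ^ (1 / 2 : ℝ)
          * (∫⁻ x, ‖g x‖ₑ ^ (2 : ℝ) ∂μ) ^ (1 / 2 : ℝ)) ^ 2 := by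
        gcongr
        exact h'.trans h
    _ = _ := by
        rw [mul_pow, ← ENNReal.rpow_natCast, ← ENNReal.rpow_natCast, ← ENNReal.rpow_mul,
          ← ENNReal.rpow_mul]
        simp

namespace IsTriangularKernel

variable {S S' : ℝ → ℝ → ℂ}

theorem measurable_row (hS : IsTriangularKernel S) (x : ℝ) : Measurable (S x) :=
  hS.measurable.comp measurable_prodMk_left

theorem measurable_col (hS : IsTriangularKernel S) (y : ℝ) : Measurable fun x => S x y :=
  hS.measurable.comp measurable_prodMk_right

theorem measurable_lintegral_row (hS : IsTriangularKernel S) :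
    Measurable fun x => ∫⁻ y, ‖S x y‖ₑ ^ 2 ∂halfLine :=
  Measurable.lintegral_prod_right' (f := fun p : ℝ × ℝ => ‖S p.1 p.2‖ₑ ^ 2)
    (hS.measurable.enorm.pow_const 2)

theorem ae_memLp_row (hS : IsTriangularKernel S) : ∀ᵐ x ∂halfLine, MemLp (S x) 2 halfLine := by
  filter_upwards [ae_lt_top hS.measurable_lintegral_row hS.lintegral_lt_top.ne] with x hx
  exact memLp_two_of_lintegral_lt_top_s12 (hS.measurable_row x) hx

theorem neg (hS : IsTriangularKernel S) : IsTriangularKernel fun x y => -S x y where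
  measurable := hS.measurable.neg
  eq_zero x y h := by simp [hS.eq_zero x y h]
  lintegral_lt_top := by simpa using hS.lintegral_lt_top

theorem add (hS : IsTriangularKernel S) (hS' : IsTriangularKernel S') :
    IsTriangularKernel fun x y => S x y + S' x y where
  measurable := hS.measurable.add hS'.measurable
  eq_zero x y h := by simp [hS.eq_zero x y h, hS'.eq_zero x y h]
  lintegral_lt_top := by
    have hle : ∀ x, ∫⁻ y, ‖S x y + S' x y‖ₑ ^ 2 ∂halfLine
        ≤ 2 * (∫⁻ y, ‖S x y‖ₑ ^ 2 ∂halfLine + ∫⁻ y, ‖S' x y‖ₑ ^ 2 ∂halfLine) := by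
      intro x
      have hm := (hS.measurable_row x).enorm.pow_const 2
      rw [← lintegral_add_left hm, ← lintegral_const_mul' _ _ (by simp)]
      refine lintegral_mono fun y => ?_
      calc ‖S x y + S' x y‖ₑ ^ 2 ≤ (‖S x y‖ₑ + ‖S' x y‖ₑ) ^ 2 := by
            gcongr
            exact enorm_add_le _ _
        _ ≤ 2 * (‖S x y‖ₑ ^ 2 + ‖S' x y‖ₑ ^ 2) := by
            have h := ENNReal.rpow_add_le_mul_rpow_add_rpow ‖S x y‖ₑ ‖S' x y‖ₑ one_le_two
            rw [show (2 : ℝ) - 1 = 1 by norm_num, ENNReal.rpow_one] at h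
            simpa using h
    refine (lintegral_mono hle).trans_lt ?_
    rw [lintegral_const_mul' _ _ (by simp),
      lintegral_add_left hS.measurable_lintegral_row]
    exact ENNReal.mul_lt_top (by simp)
      (ENNReal.add_lt_top.2 ⟨hS.lintegral_lt_top, hS'.lintegral_lt_top⟩)

theorem integral_eq_setIntegral_Ioi (hS : IsTriangularKernel S) {x : ℝ} (hx : 0 < x)
    (f : ℝ → ℂ) : ∫ y, S x y * f y ∂halfLine = ∫ y in Ioi x, S x y * f y := by
  refine setIntegral_eq_of_subset_of_forall_sdiff_eq_zero measurableSet_Ioi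
    (Ioi_subset_Ioi hx.le) fun y hy => ?_
  rw [hS.eq_zero x y (not_lt.1 hy.2), zero_mul]

theorem memT (hS : IsTriangularKernel S) : MemT S := by
  refine ⟨hS.measurable, fun x y _ h => hS.eq_zero x y h.le, ?_⟩
  refine lt_of_le_of_lt ?_ hS.lintegral_lt_top
  refine setLIntegral_mono' measurableSet_Ioi fun x hx => ?_
  exact lintegral_mono_set (Ioi_subset_Ioi (le_of_lt hx))

theorem representsVT (hS : IsTriangularKernel S) {P : LTwo →L[ℂ] LTwo} (hP : HasKernel S P) :
    RepresentsVT S (1 + P) := by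
  intro f
  filter_upwards [hP f, Lp.coeFn_add f (P f), ae_restrict_mem measurableSet_Ioi] with x h1 h2 hx
  rw [← hS.integral_eq_setIntegral_Ioi hx, ← h1]
  exact h2

end IsTriangularKernel

namespace HasKernel

variable {S S' : ℝ → ℝ → ℂ} {P P' : LTwo →L[ℂ] LTwo}

theorem neg (hP : HasKernel S P) : HasKernel (fun x y => -S x y) (-P) := by
  intro f
  filter_upwards [hP f, Lp.coeFn_neg (P f)] with x h1 h2
  simp only [neg_mul, integral_neg, ← h1]
  exact h2

theorem add (hS : IsTriangularKernel S) (hS' : IsTriangularKernel S') (hP : HasKernel S P)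
    (hP' : HasKernel S' P') : HasKernel (fun x y => S x y + S' x y) (P + P') := by
  intro f
  filter_upwards [hP f, hP' f, Lp.coeFn_add (P f) (P' f), hS.ae_memLp_row, hS'.ae_memLp_row]
    with x h1 h2 h3 m1 m2
  have i1 : Integrable (fun y => S x y * f y) halfLine := m1.integrable_mul (Lp.memLp f)
  have i2 : Integrable (fun y => S' x y * f y) halfLine := m2.integrable_mul (Lp.memLp f)
  simp only [add_mul]
  rw [integral_add i1 i2, ← h1, ← h2]
  exact h3

theorem preservesInitial (hS : IsTriangularKernel S) (hP : HasKernel S P) :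
    PreservesInitial P := by
  intro a _ f hf
  filter_upwards [hP f] with x h1 hx
  rw [h1]
  refine integral_eq_zero_of_ae ?_
  filter_upwards [hf] with y hy
  rcases le_or_gt y x with h | h
  · simp [hS.eq_zero x y h]
  · simp [hy (hx.trans h)]

end HasKernel

theorem PreservesInitial.one_add {P : LTwo →L[ℂ] LTwo} (hP : PreservesInitial P) :
    PreservesInitial (1 + P) := by
  intro a ha f hf
  filter_upwards [hf, hP a ha f hf, Lp.coeFn_add f (P f)] with x h1 h2 h3 hx
  refine h3.trans ?_
  simp [h1 hx, h2 hx]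

/-- Every operator `V_T` is `I` plus an integral operator whose kernel has square-integrable rows
and columns without exception. -/
theorem exists_hasKernel_sub_one {T : ℝ → ℝ → ℂ} {V : LTwo →L[ℂ] LTwo} (hT : MemT T)
    (hV : RepresentsVT T V) :
    ∃ S, IsTriangularKernel S ∧ (∀ x, MemLp (S x) 2 halfLine) ∧
      (∀ y, MemLp (fun x => S x y) 2 halfLine) ∧ HasKernel S (V - 1) := by
  classical
  obtain ⟨hTm, -, hT2⟩ := hT
  set U : ℝ → ℝ → ℂ := fun x y => if x < y then T x y else 0 with hU
  have hUm : Measurable (Function.uncurry U) :=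
    Measurable.ite (measurableSet_lt measurable_fst measurable_snd) hTm measurable_const
  set A : ℝ → ℝ≥0∞ := fun x => ∫⁻ y, ‖U x y‖ₑ ^ 2 ∂halfLine with hA
  set B : ℝ → ℝ≥0∞ := fun y => ∫⁻ x, ‖U x y‖ₑ ^ 2 ∂halfLine with hB
  have hAm : Measurable A := Measurable.lintegral_prod_right'
    (f := fun p : ℝ × ℝ => ‖U p.1 p.2‖ₑ ^ 2) (hUm.enorm.pow_const 2)
  have hBm : Measurable B := Measurable.lintegral_prod_left'
    (f := fun p : ℝ × ℝ => ‖U p.1 p.2‖ₑ ^ 2) (hUm.enorm.pow_const 2)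
  have hA2 : ∫⁻ x, A x ∂halfLine < ⊤ := by
    refine lt_of_le_of_lt ?_ hT2
    refine setLIntegral_mono' measurableSet_Ioi fun x hx => ?_
    have heq : ∀ y, ‖U x y‖ₑ ^ 2 = (Ioi x).indicator (fun y => ‖T x y‖ₑ ^ 2) y := by
      intro y
      by_cases h : x < y <;> simp [hU, h]
    simp only [hA, heq]
    rw [lintegral_indicator measurableSet_Ioi, Measure.restrict_restrict measurableSet_Ioi]
    exact lintegral_mono_set inter_subset_left
  have hB2 : ∫⁻ y, B y ∂halfLine < ⊤ := by
    rwa [lintegral_lintegral_swap (hUm.enorm.pow_const 2).aemeasurable] at hA2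
  set S : ℝ → ℝ → ℂ := fun x y => if A x < ⊤ ∧ B y < ⊤ then U x y else 0 with hS
  have hSm : Measurable (Function.uncurry S) :=
    Measurable.ite ((measurableSet_lt (hAm.comp measurable_fst) measurable_const).inter
      (measurableSet_lt (hBm.comp measurable_snd) measurable_const)) hUm measurable_const
  have hSU : ∀ x y, ‖S x y‖ₑ ^ 2 ≤ ‖U x y‖ₑ ^ 2 := by
    intro x y
    by_cases h : A x < ⊤ ∧ B y < ⊤ <;> simp [hS, h]
  have hSk : IsTriangularKernel S := by
    refine ⟨hSm, fun x y h => ?_, ?_⟩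
    · simp [hS, hU, not_lt.2 h]
    · exact lt_of_le_of_lt (lintegral_mono fun x => lintegral_mono fun y => hSU x y) hA2
  refine ⟨S, hSk, fun x => ?_, fun y => ?_, fun f => ?_⟩
  · refine memLp_two_of_lintegral_lt_top_s12 (hSk.measurable_row x) ?_
    by_cases h : A x < ⊤
    · exact lt_of_le_of_lt (lintegral_mono fun y => hSU x y) h
    · simp [hS, h]
  · refine memLp_two_of_lintegral_lt_top_s12 (hSk.measurable_col y) ?_
    by_cases h : B y < ⊤
    · exact lt_of_le_of_lt (lintegral_mono fun x => hSU x y) h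
    · simp [hS, h]
  · filter_upwards [hV f, Lp.coeFn_sub (V f) f, ae_restrict_mem measurableSet_Ioi,
      ae_lt_top hAm hA2.ne] with x h1 h2 hx hAx
    have h3 : ∫ y, S x y * f y ∂halfLine = ∫ y in Ioi x, T x y * f y := by
      rw [hSk.integral_eq_setIntegral_Ioi hx]
      refine integral_congr_ae ?_
      filter_upwards [ae_restrict_mem measurableSet_Ioi,
        ae_restrict_of_ae_restrict_of_subset (Ioi_subset_Ioi (le_of_lt hx))
          (ae_lt_top hBm hB2.ne)] with y hy hBy
      simp [hS, hU, hAx, hBy, mem_Ioi.1 hy]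
    rw [h3]
    refine Eq.trans h2 ?_
    simp [h1]

theorem enorm_sq_eq_lintegral {α : Type*} [MeasurableSpace α] {μ : Measure α} {k : α → ℂ}
    {g : Lp ℂ 2 μ} (h : g =ᵐ[μ] k) : ‖g‖ₑ ^ 2 = ∫⁻ x, ‖k x‖ₑ ^ 2 ∂μ := by
  rw [Lp.enorm_def, eLpNorm_congr_ae h,
    eLpNorm_eq_lintegral_rpow_enorm_toReal (by simp) (by simp), ← ENNReal.rpow_natCast,
    ← ENNReal.rpow_mul]
  simp

/-- If `P`, `P'` have triangular Hilbert–Schmidt kernels and `Q` is a bounded operator leaving all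
the spaces `L²((0, a))` invariant, then `P Q P'` has a triangular Hilbert–Schmidt kernel. -/
theorem exists_hasKernel_comp {S S' : ℝ → ℝ → ℂ} {P P' Q : LTwo →L[ℂ] LTwo}
    (hS : IsTriangularKernel S) (hrow : ∀ x, MemLp (S x) 2 halfLine) (hP : HasKernel S P)
    (hS' : IsTriangularKernel S') (hcol : ∀ y, MemLp (fun x => S' x y) 2 halfLine)
    (hP' : HasKernel S' P') (hQ : PreservesInitial Q) :
    ∃ K, IsTriangularKernel K ∧ HasKernel K (P.comp (Q.comp P')) := by
  classical
  set R : ℝ → LTwo := fun x => (hrow x).star.toLp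
  set C : ℝ → LTwo := fun y => (hcol y).toLp
  have hR : ∀ x, R x =ᵐ[halfLine] fun y => (starRingEnd ℂ) (S x y) :=
    fun x => (hrow x).star.coeFn_toLp
  have hC : ∀ y, C y =ᵐ[halfLine] fun x => S' x y := fun y => (hcol y).coeFn_toLp
  have hRm : StronglyMeasurable R :=
    stronglyMeasurable_of_coeFn_ae_eq (k := fun x y => (starRingEnd ℂ) (S x y))
      (Complex.continuous_conj.measurable.comp hS.measurable) hR
  have hCm : StronglyMeasurable C :=
    stronglyMeasurable_of_coeFn_ae_eq (k := fun y x => S' x y)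
      (hS'.measurable.comp measurable_swap) hC
  have hR2 : ∫⁻ x, ‖R x‖ₑ ^ 2 ∂halfLine < ⊤ := by
    simp only [fun x => enorm_sq_eq_lintegral (hR x)]
    simpa [enorm_eq_nnnorm] using hS.lintegral_lt_top
  have hC2 : ∫⁻ y, ‖C y‖ₑ ^ 2 ∂halfLine < ⊤ := by
    simp only [fun y => enorm_sq_eq_lintegral (hC y)]
    rw [lintegral_lintegral_swap]
    · exact hS'.lintegral_lt_top
    · exact ((hS'.measurable.comp measurable_swap).enorm.pow_const 2).aemeasurable
  have hinner : ∀ x g, inner ℂ (R x) g = ∫ z, S x z * g z ∂halfLine := by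
    intro x g
    rw [L2.inner_def]
    refine integral_congr_ae ?_
    filter_upwards [hR x] with z hz
    rw [RCLike.inner_apply, hz]
    simp [mul_comm]
  have htri : ∀ x y, 0 < y → y ≤ x → inner ℂ (R x) (Q (C y)) = 0 := by
    intro x y hy hyx
    rw [hinner]
    refine integral_eq_zero_of_ae ?_
    have hCy : ∀ᵐ z ∂halfLine, y < z → C y z = 0 := by
      filter_upwards [hC y] with z hz hyz
      rw [hz, hS'.eq_zero z y hyz.le]
    filter_upwards [hQ y hy _ hCy] with z hz
    rcases le_or_gt z x with h | h
    · simp [hS.eq_zero x z h]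
    · simp [hz (hyx.trans_lt h)]
  set K : ℝ → ℝ → ℂ := fun x y => if x < y then inner ℂ (R x) (Q (C y)) else 0 with hK
  have hKeq : ∀ x y, 0 < y → K x y = inner ℂ (R x) (Q (C y)) := by
    intro x y hy
    by_cases h : x < y
    · simp [hK, h]
    · simp only [hK, h, if_false]
      exact (htri x y hy (not_lt.1 h)).symm
  refine ⟨K, ⟨?_, fun x y h => by simp [hK, not_lt.2 h], ?_⟩, fun f => ?_⟩
  · refine Measurable.ite (measurableSet_lt measurable_fst measurable_snd) ?_ measurable_const
    exact ((hRm.comp_measurable measurable_fst).inner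
      (Q.continuous.comp_stronglyMeasurable (hCm.comp_measurable measurable_snd))).measurable
  · have hbound : ∀ x y, ‖K x y‖ₑ ^ 2 ≤ ‖R x‖ₑ ^ 2 * (‖Q‖ₑ ^ 2 * ‖C y‖ₑ ^ 2) := by
      intro x y
      by_cases h : x < y
      · simp only [hK, h, if_true, ← mul_pow]
        gcongr
        have h1 : ‖inner ℂ (R x) (Q (C y))‖ ≤ ‖R x‖ * (‖Q‖ * ‖C y‖) :=
          (norm_inner_le_norm _ _).trans (by gcongr; exact Q.le_opNorm _)
        simp only [← ofReal_norm]
        rw [← ENNReal.ofReal_mul (norm_nonneg _), ← ENNReal.ofReal_mul (norm_nonneg _)]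
        exact ENNReal.ofReal_le_ofReal h1
      · simp [hK, h]
    refine (lintegral_mono fun x => lintegral_mono fun y => hbound x y).trans_lt ?_
    have hRm2 : Measurable fun x => ‖R x‖ₑ ^ 2 := hRm.enorm.pow_const 2
    have hCm2 : Measurable fun y => ‖C y‖ₑ ^ 2 := hCm.enorm.pow_const 2
    simp only [lintegral_const_mul _ (hCm2.const_mul (‖Q‖ₑ ^ 2)), lintegral_const_mul _ hCm2,
      lintegral_mul_const _ hRm2]
    exact ENNReal.mul_lt_top hR2 (ENNReal.mul_lt_top (by simp) hC2)
  · have hCL : MemLp C 2 halfLine := by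
      refine ⟨hCm.aestronglyMeasurable, ?_⟩
      rw [eLpNorm_lt_top_iff_lintegral_rpow_enorm_lt_top (by simp) (by simp)]
      simpa using hC2
    have hint : Integrable (fun y => f y • C y) halfLine :=
      memLp_one_iff_integrable.1 (hCL.smul (Lp.memLp f))
    have hP'f := integralOperator_eq_integral_smul hS'.measurable hS'.lintegral_lt_top hC
      (hP' f) hint
    filter_upwards [hP (Q (P' f))] with x hx
    calc P (Q (P' f)) x = inner ℂ (R x) (Q (P' f)) := by rw [hx, hinner]
      _ = inner ℂ (R x) (∫ y, Q (f y • C y) ∂halfLine) := by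
          rw [hP'f, Q.integral_comp_comm hint]
      _ = ∫ y, inner ℂ (R x) (Q (f y • C y)) ∂halfLine :=
          (integral_inner (Q.integrable_comp hint) _).symm
      _ = ∫ y, K x y * f y ∂halfLine := by
          refine setIntegral_congr_fun measurableSet_Ioi fun y hy => ?_
          simp only [hKeq x y hy, map_smul, inner_smul_right, mul_comm]

/-- A right inverse of `I + P`, with `P` of triangular Hilbert–Schmidt kernel, leaves all the
spaces `L²((0, a))` invariant. -/
theorem PreservesInitial.of_one_add_comp_eq_one {S : ℝ → ℝ → ℂ} {P W : LTwo →L[ℂ] LTwo}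
    (hS : IsTriangularKernel S) (hP : HasKernel S P) (hW : (1 + P).comp W = 1) :
    PreservesInitial W := by
  intro a ha f hf
  set g : LTwo := W f
  have hgf : g + P g = f := by
    have := DFunLike.congr_fun hW f
    exact this
  set A : ℝ → ℝ≥0∞ := fun x => ∫⁻ y, ‖S x y‖ₑ ^ 2 ∂halfLine with hA
  set φ : ℝ → ℝ≥0∞ := fun t => ∫⁻ y in Ioi t, ‖g y‖ₑ ^ 2 with hφ
  have hA2 : ∫⁻ x, A x ∂halfLine ≠ ⊤ := hS.lintegral_lt_top.ne
  have hφ_top : ∀ t, a ≤ t → φ t ≠ ⊤ := by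
    intro t hat
    have h0 : ∫⁻ y, ‖g y‖ₑ ^ 2 ∂halfLine ≠ ⊤ := by
      rw [← enorm_sq_eq_lintegral (Filter.EventuallyEq.refl _ (g : ℝ → ℂ))]
      simp
    exact ne_top_of_le_ne_top h0 (lintegral_mono_set (Ioi_subset_Ioi (ha.le.trans hat)))
  have hbound : ∀ᵐ x ∂volume.restrict (Ioi a), ‖g x‖ₑ ^ 2 ≤ A x * φ x := by
    have h1 : ∀ᵐ x ∂halfLine, a < x → ‖g x‖ₑ ^ 2 ≤ A x * φ x := by
      filter_upwards [hf, hP g, Lp.coeFn_add g (P g), ae_restrict_mem measurableSet_Ioi]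
        with x h1 h2 h3 hx hax
      rw [hgf, h1 hax, Pi.add_apply] at h3
      rw [eq_neg_of_add_eq_zero_left h3.symm, h2, enorm_neg,
        hS.integral_eq_setIntegral_Ioi hx]
      have hle : volume.restrict (Ioi x) ≤ halfLine :=
        Measure.restrict_mono (Ioi_subset_Ioi (le_of_lt hx)) le_rfl
      refine (enorm_integral_mul_sq_le (hS.measurable_row x).aestronglyMeasurable
        (Lp.stronglyMeasurable g).aestronglyMeasurable).trans ?_
      gcongr
      exact lintegral_mono' hle le_rfl
    filter_upwards [ae_restrict_of_ae_restrict_of_subset (Ioi_subset_Ioi ha.le) h1,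
      ae_restrict_mem measurableSet_Ioi] with x h hx using h hx
  have hstep : ∀ t, a ≤ t → ∀ s : Set ℝ, MeasurableSet s → s ⊆ Ioi t →
      φ t = ∫⁻ y in s, ‖g y‖ₑ ^ 2 → ∫⁻ x in s, A x ∂halfLine < 1 → φ t = 0 := by
    intro t hat s hs hst heq hlt
    have hres : halfLine.restrict s = volume.restrict s := by
      rw [Measure.restrict_restrict hs,
        inter_eq_left.2 (hst.trans (Ioi_subset_Ioi (ha.le.trans hat)))]
    rw [hres] at hlt
    by_contra hne
    have hle : φ t ≤ (∫⁻ x in s, A x) * φ t := by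
      calc φ t = ∫⁻ y in s, ‖g y‖ₑ ^ 2 := heq
        _ ≤ ∫⁻ y in s, A y * φ t := by
            refine lintegral_mono_ae ?_
            filter_upwards [ae_restrict_of_ae_restrict_of_subset
              (hst.trans (Ioi_subset_Ioi hat)) hbound, ae_restrict_mem hs] with x hx hxs
            refine hx.trans ?_
            gcongr
            exact lintegral_mono_set (Ioi_subset_Ioi (le_of_lt (hst hxs)))
        _ = _ := lintegral_mul_const _ hS.measurable_lintegral_row
    refine absurd hle (not_le.2 ?_)
    calc (∫⁻ x in s, A x) * φ t < 1 * φ t :=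
          ENNReal.mul_lt_mul_left hne (hφ_top t hat) hlt
      _ = φ t := one_mul _
  obtain ⟨s, has, hφs⟩ : ∃ s, a ≤ s ∧ φ s = 0 := by
    have hν : (halfLine.withDensity A) univ ≠ ⊤ := by
      rwa [withDensity_apply _ MeasurableSet.univ, Measure.restrict_univ]
    have hlim := tendsto_measure_iInter_atTop (μ := halfLine.withDensity A)
      (s := fun n : ℕ => Ioi (n : ℝ)) (fun n => measurableSet_Ioi.nullMeasurableSet)
      (fun m n hmn => Ioi_subset_Ioi (by exact_mod_cast hmn))
      ⟨0, ne_top_of_le_ne_top hν (measure_mono (subset_univ _))⟩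
    have hempty : ⋂ n : ℕ, Ioi (n : ℝ) = ∅ := by
      refine eq_empty_of_forall_notMem fun x hx => ?_
      obtain ⟨n, hn⟩ := exists_nat_gt x
      exact lt_asymm hn (mem_iInter.1 hx n)
    rw [hempty, measure_empty] at hlim
    obtain ⟨n, hn, han⟩ := ((hlim.eventually (gt_mem_nhds one_pos)).and
      (Filter.eventually_ge_atTop ⌈a⌉₊)).exists
    have han' : a ≤ n := (Nat.le_ceil a).trans (by exact_mod_cast han)
    refine ⟨n, han', hstep n han' _ measurableSet_Ioi subset_rfl rfl ?_⟩
    rwa [Function.comp_apply, withDensity_apply _ measurableSet_Ioi] at hn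
  obtain ⟨δ, hδ, hδA⟩ := exists_pos_setLIntegral_lt_of_measure_lt hA2 one_ne_zero
  obtain ⟨d, hd0, hdδ⟩ := ENNReal.lt_iff_exists_nnreal_btwn.1 hδ
  have hd : (0 : ℝ) < d := by exact_mod_cast hd0
  have hback : ∀ n : ℕ, φ (max a (s - n * d)) = 0 := by
    intro n
    induction n with
    | zero => simpa [has] using hφs
    | succ n ih =>
      set t := max a (s - (n + 1 : ℕ) * d) with ht
      set r := max a (s - n * d) with hr
      have htr : t ≤ r := by
        refine max_le_max le_rfl ?_
        push_cast
        linarith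
      have hrt : r - t ≤ d := by
        have h1 : s - (n + 1 : ℕ) * d ≤ t := le_max_right _ _
        have h2 : a ≤ t := le_max_left _ _
        have h3 : r ≤ t + d := by
          refine max_le (by linarith) ?_
          push_cast at h1
          linarith
        linarith
      refine hstep t (le_max_left _ _) (Ioc t r) measurableSet_Ioc Ioc_subset_Ioi_self ?_
        (hδA _ ?_)
      · simp only [hφ]
        rw [← Ioc_union_Ioi_eq_Ioi htr, lintegral_union measurableSet_Ioi
          (Ioc_disjoint_Ioi le_rfl)]
        exact (congrArg _ ih).trans (add_zero _)
      · refine lt_of_le_of_lt (Measure.restrict_apply_le _ _) (lt_of_le_of_lt ?_ hdδ)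
        rw [Real.volume_Ioc, ← ENNReal.ofReal_coe_nnreal]
        exact ENNReal.ofReal_le_ofReal hrt
  have hφa : φ a = 0 := by
    obtain ⟨n, hn⟩ := exists_nat_ge ((s - a) / d)
    rw [div_le_iff₀ hd] at hn
    have := hback n
    rwa [max_eq_left (by linarith)] at this
  have hzero := (lintegral_eq_zero_iff
    ((Lp.stronglyMeasurable g).measurable.enorm.pow_const 2)).1 hφa
  have hzero' := (ae_restrict_iff' measurableSet_Ioi).1 hzero
  filter_upwards [ae_restrict_of_ae hzero'] with x hx hax
  simpa using hx hax

/-- Let `𝒢` be the set of invertible operators of the form `V_T = I + (integral operator with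
upper-triangular Hilbert–Schmidt kernel T ∈ 𝒯)` on `L²((0,∞);ℂ)`.  Then:
(a) each `V ∈ 𝒢` maps the subspace `L²((0,a);ℂ)` (functions vanishing a.e. on `(a,∞)`) into
itself, for every `a > 0`;
(b) `𝒢` is a group under composition: products of elements of `𝒢` lie in `𝒢`, and the inverse
of an element of `𝒢` is again of the form `I + (integral operator with kernel in 𝒯)`. -/
theorem stmt_12 (T : ℝ → ℝ → ℂ) (hT : MemT T)
    (V : Lp ℂ 2 (volume.restrict (Ioi (0 : ℝ))) →L[ℂ] Lp ℂ 2 (volume.restrict (Ioi (0 : ℝ))))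
    (hV : RepresentsVT T V) (hVunit : IsUnit V) :
    -- (a)
    (∀ a : ℝ, 0 < a → ∀ f : Lp ℂ 2 (volume.restrict (Ioi (0 : ℝ))),
      (∀ᵐ x ∂(volume.restrict (Ioi (0 : ℝ))), a < x → f x = 0) →
      (∀ᵐ x ∂(volume.restrict (Ioi (0 : ℝ))), a < x → (V f : ℝ → ℂ) x = 0))
    ∧
    -- (b) closure under products
    (∀ (T' : ℝ → ℝ → ℂ)
      (V' : Lp ℂ 2 (volume.restrict (Ioi (0 : ℝ))) →L[ℂ]
        Lp ℂ 2 (volume.restrict (Ioi (0 : ℝ)))),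
      MemT T' → RepresentsVT T' V' → IsUnit V' →
      IsUnit (V.comp V') ∧ ∃ T'' : ℝ → ℝ → ℂ, MemT T'' ∧ RepresentsVT T'' (V.comp V'))
    ∧
    -- (b) the inverse is of the form `I + (kernel in 𝒯)`
    (∀ W : Lp ℂ 2 (volume.restrict (Ioi (0 : ℝ))) →L[ℂ]
        Lp ℂ 2 (volume.restrict (Ioi (0 : ℝ))),
      V.comp W = 1 → W.comp V = 1 →
      ∃ Hk : ℝ → ℝ → ℂ, MemT Hk ∧ RepresentsVT Hk W) := by

  obtain ⟨S, hS, hrow, hcol, hP⟩ := exists_hasKernel_sub_one hT hV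
  have hVP : 1 + (V - 1) = V := add_sub_cancel _ _
  refine ⟨?_, ?_, ?_⟩
  · have h := (hP.preservesInitial hS).one_add
    rw [hVP] at h
    exact h
  · intro T' V' hT' hV' hV'unit
    obtain ⟨S', hS', -, hcol', hP'⟩ := exists_hasKernel_sub_one hT' hV'
    obtain ⟨K, hK, hKP⟩ := exists_hasKernel_comp (Q := 1) hS hrow hP hS' hcol' hP'
      fun a _ f hf => hf
    refine ⟨hVunit.mul hV'unit, _, ((hS.add hS').add hK).memT, ?_⟩
    have h := ((hS.add hS').add hK).representsVT (.add (hS.add hS') hK (.add hS hS' hP hP') hKP)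
    convert h using 1
    change V * V' = 1 + (V - 1 + (V' - 1) + (V - 1) * (1 * (V' - 1)))
    noncomm_ring
  · intro W hVW hWV
    have hW : PreservesInitial W := .of_one_add_comp_eq_one hS hP (by rwa [hVP])
    obtain ⟨K, hK, hKP⟩ := exists_hasKernel_comp hS hrow hP hS hcol hP hW
    refine ⟨_, (hS.neg.add hK).memT, ?_⟩
    have h := (hS.neg.add hK).representsVT (.add hS.neg hK hP.neg hKP)
    convert h using 1
    change V * W = 1 at hVW
    change W * V = 1 at hWV
    change W = 1 + (-(V - 1) + (V - 1) * (W * (V - 1)))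
    rw [mul_sub W, hWV, mul_one, mul_sub, sub_mul _ _ W, hVW]
    noncomm_ring
end

section
/- Let 𝒯 be the set of measurable functions T : (0,∞)×(0,∞) → ℂ with T(x,y) = 0 for 0 < y < x and ∫₀^∞ ∫_x^∞ |T(x,y)|² dy dx < ∞, and for T ∈ 𝒯 let V_T f(x) = f(x) + ∫_x^∞ T(x,y) f(y) dy on L²((0,∞);ℂ). If T ∈ 𝒯 is such that V_T is invertible in ℒ(L²((0,∞);ℂ)) and V_T is unitary, then T = 0 almost everywhere, i.e. V_T = I. -/
open MeasureTheory Set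
open scoped ENNReal NNReal

section Hilbert

universe u

variable {H : Type u} [NormedAddCommGroup H] [InnerProductSpace ℂ H]

theorem HilbertBasis.tsum_ofReal_norm_inner_sq {ι : Type*} {S : Submodule ℂ H}
    [CompleteSpace S] (b : HilbertBasis ι ℂ S) (v : H) :
    ∑' i, ENNReal.ofReal (‖inner ℂ (b i : H) v‖ ^ 2)
      = ENNReal.ofReal (‖S.orthogonalProjectionOnto v‖ ^ 2) := by
  have h := (b.hasSum_inner_mul_inner (S.orthogonalProjectionOnto v)
    (S.orthogonalProjectionOnto v)).mapL Complex.reCLM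
  have h' : HasSum (fun i => ‖inner ℂ (b i : H) v‖ ^ 2) (‖S.orthogonalProjectionOnto v‖ ^ 2) := by
    convert h using 1
    · funext i
      rw [← Submodule.inner_orthogonalProjectionOnto_eq_of_mem_left, Complex.reCLM_apply,
        ← inner_conj_symm, RCLike.norm_conj, Complex.mul_conj']
      norm_cast
    · exact (inner_self_eq_norm_sq (𝕜 := ℂ) _).symm
  rw [← h'.tsum_eq, ENNReal.ofReal_tsum_of_nonneg (fun _ => by positivity) h'.summable]

/-- A Hilbert–Schmidt operator `K` with `‖K f‖ = ‖K† f‖` which leaves a closed subspace invariant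
also leaves its orthogonal complement invariant. -/
theorem ContinuousLinearMap.apply_mem_orthogonal_of_hilbertSchmidt [CompleteSpace H] (K : H →L[ℂ] H)
    (hK : ∀ f, ‖ContinuousLinearMap.adjoint K f‖ = ‖K f‖)
    {C : ℝ≥0∞} (hC : C ≠ ⊤)
    (hHS : ∀ (ι : Type u) (e : ι → H), Orthonormal ℂ e → ∀ s : Finset ι,
      ∑ i ∈ s, ENNReal.ofReal (‖K (e i)‖ ^ 2) ≤ C)
    (S : Submodule ℂ H) [CompleteSpace S] (hS : ∀ f ∈ S, K f ∈ S) {g : H} (hg : g ∈ Sᗮ) :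
    K g ∈ Sᗮ := by
  obtain ⟨w, b, -⟩ := exists_hilbertBasis ℂ S
  have hb : Orthonormal ℂ (fun i => (b i : H)) := b.orthonormal.comp_linearIsometry S.subtypeₗᵢ
  set K' := ContinuousLinearMap.adjoint K
  have hfin : ∑' i, ENNReal.ofReal (‖K (b i)‖ ^ 2) ≠ ⊤ :=
    ne_top_of_le_ne_top hC (ENNReal.tsum_eq_iSup_sum.trans_le (iSup_le (hHS _ _ hb)))
  have hswap : ∑' i, ENNReal.ofReal (‖K (b i)‖ ^ 2)
      = ∑' i, ENNReal.ofReal (‖S.orthogonalProjectionOnto (K' (b i))‖ ^ 2) := by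
    have h1 : ∀ i, ENNReal.ofReal (‖K (b i)‖ ^ 2)
        = ∑' j, ENNReal.ofReal (‖inner ℂ (b j : H) (K (b i))‖ ^ 2) := by
      intro i
      rw [b.tsum_ofReal_norm_inner_sq]
      congr 2
      conv_lhs => rw [← S.starProjection_eq_self_iff.2 (hS _ (b i).2)]
      rfl
    simp_rw [h1, ← b.tsum_ofReal_norm_inner_sq]
    rw [ENNReal.tsum_comm]
    refine tsum_congr fun i => tsum_congr fun j => ?_
    rw [ContinuousLinearMap.adjoint_inner_right, norm_inner_symm]
  have hsplit : ∑' i, ENNReal.ofReal (‖K (b i)‖ ^ 2)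
      = ∑' i, ENNReal.ofReal (‖S.orthogonalProjectionOnto (K' (b i))‖ ^ 2)
        + ∑' i, ENNReal.ofReal (‖Sᗮ.orthogonalProjectionOnto (K' (b i))‖ ^ 2) := by
    rw [← ENNReal.tsum_add]
    refine tsum_congr fun i => ?_
    rw [← hK, Submodule.norm_sq_eq_add_norm_sq_projection _ S,
      ENNReal.ofReal_add (by positivity) (by positivity)]
  have hzero : ∑' i, ENNReal.ofReal (‖Sᗮ.orthogonalProjectionOnto (K' (b i))‖ ^ 2) = 0 := by
    rw [← hswap] at hsplit
    exact (ENNReal.add_right_inj hfin).1 (hsplit.symm.trans (add_zero _).symm)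
  have hmem : ∀ i, inner ℂ (b i : H) (K g) = 0 := by
    intro i
    have h0 := ENNReal.tsum_eq_zero.1 hzero i
    have h1 : Sᗮ.orthogonalProjectionOnto (K' (b i)) = 0 := by
      rw [ENNReal.ofReal_eq_zero] at h0
      exact norm_eq_zero.1 (pow_eq_zero_iff two_ne_zero |>.1 (le_antisymm h0 (by positivity)))
    rw [← ContinuousLinearMap.adjoint_inner_left, ← inner_conj_symm,
      ← Submodule.inner_orthogonalProjectionOnto_eq_of_mem_left (⟨g, hg⟩ : Sᗮ), h1]
    simp
  have hproj := b.tsum_ofReal_norm_inner_sq (K g)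
  simp only [hmem] at hproj
  rw [← S.orthogonalProjectionOnto_eq_zero_iff]
  simpa [-Submodule.coe_orthogonalProjectionOnto_apply] using hproj.symm

end Hilbert

section L2

variable {α : Type*} [MeasurableSpace α] {μ : Measure α}

theorem MeasureTheory.eLpNorm_two_sq {f : α → ℂ} :
    eLpNorm f 2 μ ^ 2 = ∫⁻ y, ‖f y‖ₑ ^ 2 ∂μ := by
  simpa using eLpNorm_nnreal_pow_eq_lintegral (p := 2) (f := f) (μ := μ) two_ne_zero

theorem MeasureTheory.Lp.enorm_sq_eq_lintegral (f : Lp ℂ 2 μ) :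
    ‖f‖ₑ ^ 2 = ∫⁻ y, ‖f y‖ₑ ^ 2 ∂μ := by
  rw [Lp.enorm_def, eLpNorm_two_sq]

/-- Bessel's inequality integrated over `α` bounds the Hilbert–Schmidt norm of an operator of the
form `f ↦ (x ↦ ⟪τ x, f⟫)`. -/
theorem sum_norm_sq_le_lintegral_of_ae_eq_inner (K : Lp ℂ 2 μ →L[ℂ] Lp ℂ 2 μ) (τ : α → Lp ℂ 2 μ)
    (hτ : ∀ f, ∀ᵐ x ∂μ, K f x = inner ℂ (τ x) f)
    {ι : Type*} {e : ι → Lp ℂ 2 μ} (he : Orthonormal ℂ e) (s : Finset ι) :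
    ∑ i ∈ s, ENNReal.ofReal (‖K (e i)‖ ^ 2) ≤ ∫⁻ x, ‖τ x‖ₑ ^ 2 ∂μ := by
  have h1 : ∀ i, ENNReal.ofReal (‖K (e i)‖ ^ 2) = ∫⁻ x, ‖K (e i) x‖ₑ ^ 2 ∂μ := fun i => by
    rw [← Lp.enorm_sq_eq_lintegral, ENNReal.ofReal_pow (norm_nonneg _), ofReal_norm]
  simp_rw [h1]
  rw [← lintegral_finsetSum' _
    fun i _ => (Lp.aestronglyMeasurable (K (e i))).enorm.pow_const 2]
  refine lintegral_mono_ae ?_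
  filter_upwards [(ae_ball_iff s.countable_toSet).2 fun i _ => hτ (e i)] with x hx
  calc ∑ i ∈ s, ‖K (e i) x‖ₑ ^ 2 = ENNReal.ofReal (∑ i ∈ s, ‖inner ℂ (e i) (τ x)‖ ^ 2) := by
        rw [ENNReal.ofReal_sum_of_nonneg fun _ _ => by positivity]
        refine Finset.sum_congr rfl fun i hi => ?_
        rw [hx i hi, ENNReal.ofReal_pow (norm_nonneg _), norm_inner_symm, ofReal_norm]
    _ ≤ ENNReal.ofReal (‖τ x‖ ^ 2) := ENNReal.ofReal_le_ofReal (he.sum_inner_products_le _)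
    _ = ‖τ x‖ₑ ^ 2 := by rw [ENNReal.ofReal_pow (norm_nonneg _), ofReal_norm]

end L2

section SupportedLeft

variable (μ : Measure ℝ) (a : ℝ)

/-- The closed subspace of `L²(μ)` of functions vanishing almost everywhere on `(a,∞)`. -/
noncomputable def supportedLeft : Submodule ℂ (Lp ℂ 2 μ) :=
  (LpToLpRestrictCLM ℝ ℂ ℂ μ 2 (Ioi a)).ker

instance : CompleteSpace (supportedLeft μ a) :=
  (LpToLpRestrictCLM ℝ ℂ ℂ μ 2 (Ioi a)).isClosed_ker.completeSpace_coe

variable {μ a}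

theorem mem_supportedLeft {f : Lp ℂ 2 μ} :
    f ∈ supportedLeft μ a ↔ ∀ᵐ y ∂μ, a < y → f y = 0 := by
  have h := LpToLpRestrictCLM_coeFn ℂ (Ioi a) f
  have h' : (∀ᵐ y ∂μ, a < y → f y = 0) ↔ f =ᵐ[μ.restrict (Ioi a)] 0 :=
    (ae_restrict_iff' measurableSet_Ioi).symm
  rw [h', supportedLeft, LinearMap.mem_ker]
  change LpToLpRestrictCLM ℝ ℂ ℂ μ 2 (Ioi a) f = 0 ↔ _
  rw [Lp.eq_zero_iff_ae_eq_zero]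
  exact ⟨fun h0 => h.symm.trans h0, fun h0 => h.trans h0⟩

theorem ae_eq_zero_of_mem_orthogonal_supportedLeft {f : Lp ℂ 2 μ}
    (hf : f ∈ (supportedLeft μ a)ᗮ) : ∀ᵐ y ∂μ, y ≤ a → f y = 0 := by
  have hmem := (Lp.memLp f).indicator (measurableSet_Iic (a := a))
  have hcoe := hmem.coeFn_toLp
  have hS : hmem.toLp ∈ supportedLeft μ a := by
    rw [mem_supportedLeft]
    filter_upwards [hcoe] with y hy hay
    rw [hy, indicator_of_notMem (by simpa using hay)]
  have hinner : inner ℂ hmem.toLp hmem.toLp = (0 : ℂ) := by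
    rw [← hf _ hS, L2.inner_def, L2.inner_def]
    refine integral_congr_ae ?_
    filter_upwards [hcoe] with y hy
    rw [hy]
    by_cases hya : y ∈ Iic a <;> simp [hya]
  rw [inner_self_eq_zero, Lp.eq_zero_iff_ae_eq_zero] at hinner
  filter_upwards [hcoe, hinner] with y hy hy0 hya
  rw [← indicator_of_mem (mem_Iic.2 hya) f, ← hy, hy0, Pi.zero_apply]

/-- If `K` is the operator `f ↦ (x ↦ ⟪τ x, f⟫)`, of Hilbert–Schmidt class, with `τ x` supported on
`(x,∞)`, and `‖K f‖ = ‖K† f‖`, then the kernel `τ` vanishes. -/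
theorem ae_eq_zero_of_triangular_of_norm_adjoint_eq [SFinite μ] (K : Lp ℂ 2 μ →L[ℂ] Lp ℂ 2 μ)
    (τ : ℝ → Lp ℂ 2 μ) (hτ : ∀ f, ∀ᵐ x ∂μ, K f x = inner ℂ (τ x) f)
    (hHS : ∫⁻ x, ‖τ x‖ₑ ^ 2 ∂μ ≠ ⊤) (htri : ∀ᵐ x ∂μ, ∀ᵐ y ∂μ, y ≤ x → τ x y = 0)
    (hK : ∀ f, ‖ContinuousLinearMap.adjoint K f‖ = ‖K f‖) :
    ∀ᵐ x ∂μ, τ x = 0 := by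
  have hinv : ∀ a : ℝ, ∀ f ∈ supportedLeft μ a, K f ∈ supportedLeft μ a := by
    intro a f hf
    rw [mem_supportedLeft] at hf ⊢
    filter_upwards [hτ f, htri] with x hx hxtri hax
    rw [hx, L2.inner_def]
    refine integral_eq_zero_of_ae ?_
    filter_upwards [hf, hxtri] with y hy hy'
    rcases le_or_gt y x with h | h
    · simp [hy' h]
    · simp [hy (hax.trans h)]
  have horth : ∀ a : ℝ, ∀ g ∈ (supportedLeft μ a)ᗮ, K g ∈ (supportedLeft μ a)ᗮ :=
    fun a g hg => K.apply_mem_orthogonal_of_hilbertSchmidt hK hHS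
      (fun _ _ he s => sum_norm_sq_le_lintegral_of_ae_eq_inner K τ hτ he s) _ (hinv a) hg
  have hmem : ∀ a : ℝ, ∀ᵐ x ∂μ, x ≤ a → τ x ∈ supportedLeft μ a := by
    intro a
    have : Fact ((2 : ℝ≥0∞) ≠ ⊤) := ⟨by simp⟩
    set P := (supportedLeft μ a)ᗮ.starProjection
    have hdense := TopologicalSpace.denseRange_denseSeq (Lp ℂ 2 μ)
    have h1 : ∀ n, ∀ᵐ x ∂μ, x ≤ a →
        inner ℂ (τ x) (P (TopologicalSpace.denseSeq (Lp ℂ 2 μ) n)) = 0 := by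
      intro n
      filter_upwards [hτ (P (TopologicalSpace.denseSeq _ n)),
        ae_eq_zero_of_mem_orthogonal_supportedLeft
          (horth a _ (Submodule.starProjection_apply_mem _ (TopologicalSpace.denseSeq _ n)))]
        with x hx hx0 hxa
      rw [← hx, hx0 hxa]
    filter_upwards [ae_all_iff.2 h1] with x hx hxa
    have hP : P (τ x) = 0 := by
      refine hdense.eq_zero_of_inner_left (𝕜 := ℂ) ?_
      intro n
      rw [Submodule.inner_starProjection_left_eq_right]
      exact hx n hxa
    rwa [Submodule.starProjection_apply_eq_zero_iff, Submodule.orthogonal_orthogonal] at hP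
  have hrat : ∀ᵐ x ∂μ, ∀ q : ℚ, x ≤ (q : ℝ) → τ x ∈ supportedLeft μ (q : ℝ) :=
    ae_all_iff.2 fun q => hmem q
  filter_upwards [hrat, htri] with x hx hxtri
  have hx' : ∀ᵐ y ∂μ, ∀ q : ℚ, x ≤ (q : ℝ) → (q : ℝ) < y → τ x y = 0 := by
    rw [ae_all_iff]
    intro q
    by_cases hq : x ≤ q
    · filter_upwards [mem_supportedLeft.1 (hx q hq)] with y hy _ using hy
    · exact .of_forall fun y h => absurd h hq
  rw [Lp.eq_zero_iff_ae_eq_zero]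
  filter_upwards [hx', hxtri] with y hy hy'
  rcases le_or_gt y x with h | h
  · exact hy' h
  · obtain ⟨q, hxq, hqy⟩ := exists_rat_btwn h
    exact hy q hxq.le hqy

end SupportedLeft

/-- The rows of a kernel in `𝒯`, conjugated and extended by zero to the left of the diagonal, as a
square-integrable family of vectors of `L²((0,∞);ℂ)`. -/
theorem MemT.exists_rows {T : ℝ → ℝ → ℂ} (hT : MemT T) :
    ∃ τ : ℝ → Lp ℂ 2 (volume.restrict (Ioi (0 : ℝ))),
      (∀ᵐ x ∂(volume.restrict (Ioi (0 : ℝ))), ∀ᵐ y ∂(volume.restrict (Ioi (0 : ℝ))),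
        τ x y = star ((Ioi x).indicator (T x) y))
      ∧ ∫⁻ x in Ioi (0 : ℝ), ‖τ x‖ₑ ^ 2 ≠ ⊤ := by
  classical
  obtain ⟨hmeas, -, hfin⟩ := hT
  set μ := volume.restrict (Ioi (0 : ℝ)) with hμ
  set F : ℝ → ℝ → ℂ := fun x y => star ((Ioi x).indicator (T x) y) with hF
  have hFmeas : Measurable (Function.uncurry F) := by
    have : Function.uncurry F
        = fun p => star ({p : ℝ × ℝ | p.1 < p.2}.indicator (Function.uncurry T) p) := by
      funext p
      simp [hF, Function.uncurry, indicator]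
    rw [this]
    exact continuous_star.measurable.comp
      (hmeas.indicator (measurableSet_lt measurable_fst measurable_snd))
  have hnorm : ∀ x : ℝ, 0 < x →
      ∫⁻ y, ‖F x y‖ₑ ^ 2 ∂μ = ∫⁻ y in Ioi x, (‖T x y‖₊ : ℝ≥0∞) ^ 2 := by
    intro x hx
    have h1 : ∀ y, ‖F x y‖ₑ ^ 2 = (Ioi x).indicator (fun y => (‖T x y‖₊ : ℝ≥0∞) ^ 2) y := by
      intro y
      by_cases hy : y ∈ Ioi x
      · simp only [hF, indicator_of_mem hy, enorm, nnnorm_star]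
      · simp [hF, indicator_of_notMem hy]
    simp_rw [h1]
    rw [lintegral_indicator measurableSet_Ioi, hμ, Measure.restrict_restrict measurableSet_Ioi,
      inter_eq_left.2 (Ioi_subset_Ioi hx.le)]
  have hint : ∫⁻ x, ∫⁻ y, ‖F x y‖ₑ ^ 2 ∂μ ∂μ < ⊤ := by
    rwa [setLIntegral_congr_fun measurableSet_Ioi (fun x hx => hnorm x hx)]
  have hmemLp : ∀ᵐ x ∂μ, MemLp (F x) 2 μ := by
    have hm : Measurable fun x => ∫⁻ y, ‖F x y‖ₑ ^ 2 ∂μ :=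
      (hFmeas.enorm.pow_const 2).lintegral_prod_right'
    filter_upwards [ae_lt_top hm hint.ne] with x hx
    refine ⟨(hFmeas.comp measurable_prodMk_left).aestronglyMeasurable, ?_⟩
    rw [← eLpNorm_two_sq] at hx
    exact (ENNReal.pow_lt_top_iff.1 hx).resolve_right two_ne_zero
  refine ⟨fun x => if h : MemLp (F x) 2 μ then h.toLp else 0, ?_, ?_⟩
  · filter_upwards [hmemLp] with x hx
    rw [dif_pos hx]
    exact hx.coeFn_toLp
  · refine ne_top_of_le_ne_top hint.ne (lintegral_mono_ae ?_)
    filter_upwards [hmemLp] with x hx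
    rw [dif_pos hx, Lp.enorm_toLp, eLpNorm_two_sq]

theorem RepresentsVT.ae_sub_one_eq_inner {T : ℝ → ℝ → ℂ}
    {V : Lp ℂ 2 (volume.restrict (Ioi (0 : ℝ))) →L[ℂ] Lp ℂ 2 (volume.restrict (Ioi (0 : ℝ)))}
    (hV : RepresentsVT T V) {τ : ℝ → Lp ℂ 2 (volume.restrict (Ioi (0 : ℝ)))}
    (hτ : ∀ᵐ x ∂(volume.restrict (Ioi (0 : ℝ))), ∀ᵐ y ∂(volume.restrict (Ioi (0 : ℝ))),
      τ x y = star ((Ioi x).indicator (T x) y))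
    (f : Lp ℂ 2 (volume.restrict (Ioi (0 : ℝ)))) :
    ∀ᵐ x ∂(volume.restrict (Ioi (0 : ℝ))), (V - 1) f x = inner ℂ (τ x) f := by
  filter_upwards [hV f, hτ, Lp.coeFn_sub (V f) f, ae_restrict_mem measurableSet_Ioi]
    with x hx hτx hsub hx0
  have h1 : (V - 1) f = V f - f := rfl
  rw [h1, hsub, Pi.sub_apply, hx, add_sub_cancel_left, L2.inner_def]
  have h2 : ∫ y in Ioi (0 : ℝ), inner ℂ (τ x y) (f y)
      = ∫ y in Ioi (0 : ℝ), (Ioi x).indicator (fun y => T x y * f y) y := by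
    refine integral_congr_ae ?_
    filter_upwards [hτx] with y hy
    rw [hy]
    by_cases hyx : y ∈ Ioi x
    · simp [indicator_of_mem hyx, mul_comm]
    · simp [indicator_of_notMem hyx]
  rw [h2, integral_indicator measurableSet_Ioi, Measure.restrict_restrict measurableSet_Ioi,
    inter_eq_left.2 (Ioi_subset_Ioi (le_of_lt hx0))]

theorem ContinuousLinearMap.norm_adjoint_sub_one_apply_of_unitary {H : Type*}
    [NormedAddCommGroup H] [InnerProductSpace ℂ H] [CompleteSpace H] {V : H →L[ℂ] H}
    (h₁ : (ContinuousLinearMap.adjoint V).comp V = 1)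
    (h₂ : V.comp (ContinuousLinearMap.adjoint V) = 1) (f : H) :
    ‖ContinuousLinearMap.adjoint (V - 1) f‖ = ‖(V - 1) f‖ := by
  have h3 : V (ContinuousLinearMap.adjoint (V - 1) f) = -((V - 1) f) := by
    have h4 : ContinuousLinearMap.adjoint (V - 1) f = ContinuousLinearMap.adjoint V f - f := by
      rw [map_sub, ← ContinuousLinearMap.star_eq_adjoint (1 : H →L[ℂ] H), star_one]
      rfl
    have h5 : V (ContinuousLinearMap.adjoint V f) = f := DFunLike.congr_fun h₂ f
    rw [h4, map_sub, h5]
    exact (neg_sub (V f) f).symm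
  rw [← norm_neg ((V - 1) f), ← h3,
    (ContinuousLinearMap.norm_map_iff_adjoint_comp_self V).2 h₁]

/-- If `T ∈ 𝒯` is such that `V_T` is invertible in `ℒ(L²((0,∞);ℂ))` and `V_T` is unitary, then
`T = 0` almost everywhere, i.e. `V_T = I`. -/
theorem stmt_13 (T : ℝ → ℝ → ℂ) (hT : MemT T)
    (V : Lp ℂ 2 (volume.restrict (Ioi (0 : ℝ))) →L[ℂ] Lp ℂ 2 (volume.restrict (Ioi (0 : ℝ))))
    (hV : RepresentsVT T V) (hVunit : IsUnit V)
    (hunitary : (ContinuousLinearMap.adjoint V).comp V = 1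
      ∧ V.comp (ContinuousLinearMap.adjoint V) = 1) :
    (∀ᵐ p : ℝ × ℝ ∂(volume.restrict ((Ioi (0 : ℝ)) ×ˢ (Ioi (0 : ℝ)))), T p.1 p.2 = 0)
    ∧ V = 1 := by
  obtain ⟨τ, hτ, hτfin⟩ := hT.exists_rows
  have hK := hV.ae_sub_one_eq_inner hτ
  have htri : ∀ᵐ x ∂(volume.restrict (Ioi (0 : ℝ))), ∀ᵐ y ∂(volume.restrict (Ioi (0 : ℝ))),
      y ≤ x → τ x y = 0 := by
    filter_upwards [hτ] with x hx
    filter_upwards [hx] with y hy hyx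
    rw [hy, indicator_of_notMem (by simpa using hyx), star_zero]
  have hzero := ae_eq_zero_of_triangular_of_norm_adjoint_eq (V - 1) τ hK hτfin htri
    (ContinuousLinearMap.norm_adjoint_sub_one_apply_of_unitary hunitary.1 hunitary.2)
  refine ⟨?_, ?_⟩
  · rw [Measure.volume_eq_prod, ← Measure.prod_restrict, Measure.ae_prod_iff_ae_ae
      (p := fun p : ℝ × ℝ => T p.1 p.2 = 0) (hT.1 (measurableSet_singleton 0))]
    change ∀ᵐ x ∂(volume.restrict (Ioi (0 : ℝ))), ∀ᵐ y ∂(volume.restrict (Ioi (0 : ℝ))), T x y = 0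
    filter_upwards [hzero, hτ] with x hx hτx
    rw [Lp.eq_zero_iff_ae_eq_zero] at hx
    filter_upwards [hx, hτx, ae_restrict_mem measurableSet_Ioi,
      ae_restrict_of_ae (Measure.ae_ne volume x)] with y hy hτy hy0 hyx
    rcases lt_or_gt_of_ne hyx with h | h
    · exact hT.2.1 x y hy0 h
    · rw [hy, Pi.zero_apply, indicator_of_mem (mem_Ioi.2 h)] at hτy
      exact star_eq_zero.1 hτy.symm
  · rw [← sub_eq_zero]
    ext1 f
    rw [zero_apply, Lp.eq_zero_iff_ae_eq_zero]
    filter_upwards [hK f, hzero] with x hx hx0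
    rw [hx, hx0, inner_zero_left, Pi.zero_apply]
end

section
/- Let T : (0,∞)×(0,∞) → ℂ be measurable with T(x,y) = 0 for 0 < y < x, continuous on {(x,y) : 0 < x < y}, and suppose there exist M < ∞ and ε > 0 such that |T(x,y)| ≤ M e^{−ε(x+y)} for all 0 < x < y. Then: (a) the iterated kernels satisfy ∫_{x<y₁<y₂<⋯<y_n<y} |T(x,y₁) T(y₁,y₂) ⋯ T(y_n,y)| dy₁⋯dy_n ≤ M^{n+1} e^{−ε(x+y)}/(εⁿ 2ⁿ n!); (b) consequently the Neumann series Σ_{j≥1} (−1)^j T^j (composition powers of the integral operator with kernel T) converges in Hilbert–Schmidt norm, the operator V_T f(x) = f(x) + ∫_x^∞ T(x,y) f(y) dy has spectrum {1}, and V_T is invertible in ℒ(L²((0,∞);ℂ)) with V_T^{−1} − I an integral operator with an upper-triangular L² kernel. -/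
open MeasureTheory Set
open scoped ENNReal NNReal

/-- The iterated (composition) kernels of `T` : `iterKernel T j` is the kernel of the
`(j+1)`-st composition power of the integral operator with kernel `T`. -/
noncomputable def iterKernel (T : ℝ → ℝ → ℂ) : ℕ → ℝ → ℝ → ℂ
  | 0 => T
  | j + 1 => fun x y => ∫ z in Ioi (0 : ℝ), T x z * iterKernel T j z y

local notation "μ₊" => (volume.restrict (Ioi (0 : ℝ)) : Measure ℝ)

/-- A measurable kernel supported in `{0 < x < y}` with `‖G x y‖ ≤ C e^{-ε(x+y)}`. -/
structure IsExpKernel (ε C : ℝ) (G : ℝ → ℝ → ℂ) : Prop where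
  measurable : Measurable (Function.uncurry G)
  eq_zero : ∀ x y, ¬(0 < x ∧ x < y) → G x y = 0
  norm_le : ∀ x y, ‖G x y‖ ≤ C * (Real.exp (-ε * x) * Real.exp (-ε * y))

lemma integrable_exp_neg_mul {ε : ℝ} (hε : 0 < ε) : Integrable (fun x => Real.exp (-ε * x)) μ₊ :=
  exp_neg_integrableOn_Ioi 0 hε

lemma memLp_exp_neg_mul {ε : ℝ} (hε : 0 < ε) : MemLp (fun x => Real.exp (-ε * x)) 2 μ₊ := by
  rw [memLp_two_iff_integrable_sq (by fun_prop)]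
  refine (integrable_exp_neg_mul (ε := 2 * ε) (by positivity)).congr (.of_forall fun x => ?_)
  simp only [pow_two, ← Real.exp_add]
  ring_nf

lemma integrable_exp_mul_norm {ε : ℝ} (hε : 0 < ε) {f : ℝ → ℂ} (hf : MemLp f 2 μ₊) :
    Integrable (fun y => Real.exp (-ε * y) * ‖f y‖) μ₊ :=
  (memLp_exp_neg_mul hε).integrable_mul hf.norm

lemma integral_exp_mul_norm_le {ε : ℝ} (hε : 0 < ε) (f : Lp ℂ 2 μ₊) :
    ∫ y, Real.exp (-ε * y) * ‖f y‖ ∂μ₊ ≤ ‖(memLp_exp_neg_mul hε).toLp _‖ * ‖f‖ := by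
  set E := (memLp_exp_neg_mul hε).toLp _
  set F := (Lp.memLp f).norm.toLp _
  have hF : ‖F‖ = ‖f‖ := by
    rw [Lp.norm_toLp, eLpNorm_norm, Lp.norm_def]
  have hE : ∫ y, Real.exp (-ε * y) * ‖f y‖ ∂μ₊ = inner ℝ E F := by
    rw [L2.inner_def]
    refine integral_congr_ae ?_
    filter_upwards [(memLp_exp_neg_mul hε).coeFn_toLp, (Lp.memLp f).norm.coeFn_toLp] with x h1 h2
    simp only [E, F, h1, h2, RCLike.inner_apply]
    simp [mul_comm]
  rw [hE, ← hF]
  exact real_inner_le_norm _ _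

namespace IsExpKernel

variable {ε C C' : ℝ} {G A B : ℝ → ℝ → ℂ}

lemma nonneg (h : IsExpKernel ε C G) : 0 ≤ C := by
  simpa using (norm_nonneg _).trans (h.norm_le 0 0)

lemma measurable_left (h : IsExpKernel ε C G) (x : ℝ) : Measurable (G x) :=
  h.measurable.comp measurable_prodMk_left

lemma measurable_right (h : IsExpKernel ε C G) (y : ℝ) : Measurable (fun x => G x y) :=
  h.measurable.comp measurable_prodMk_right

lemma const_mul (h : IsExpKernel ε C G) (c : ℂ) :
    IsExpKernel ε (‖c‖ * C) (fun x y => c * G x y) where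
  measurable := h.measurable.const_mul c
  eq_zero x y hxy := by rw [h.eq_zero x y hxy, mul_zero]
  norm_le x y := by
    rw [norm_mul, mul_assoc]
    exact mul_le_mul_of_nonneg_left (h.norm_le x y) (norm_nonneg c)

lemma norm_mul_le (h : IsExpKernel ε C G) (f : ℝ → ℂ) (x y : ℝ) :
    ‖G x y * f y‖ ≤ C * Real.exp (-ε * x) * (Real.exp (-ε * y) * ‖f y‖) := by
  rw [norm_mul]
  calc _ ≤ C * (Real.exp (-ε * x) * Real.exp (-ε * y)) * ‖f y‖ := by gcongr; exact h.norm_le x y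
    _ = _ := by ring

lemma integrable_mul (h : IsExpKernel ε C G) (hε : 0 < ε) {f : ℝ → ℂ} (hf : MemLp f 2 μ₊)
    (x : ℝ) : Integrable (fun y => G x y * f y) μ₊ :=
  ((integrable_exp_mul_norm hε hf).const_mul _).mono'
    ((h.measurable_left x).aestronglyMeasurable.mul hf.1) (.of_forall (h.norm_mul_le f x))

lemma norm_integral_le (h : IsExpKernel ε C G) (hε : 0 < ε) {f : ℝ → ℂ} (hf : MemLp f 2 μ₊)
    (x : ℝ) : ‖∫ y, G x y * f y ∂μ₊‖ ≤
      C * (∫ y, Real.exp (-ε * y) * ‖f y‖ ∂μ₊) * Real.exp (-ε * x) := by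
  refine (norm_integral_le_of_norm_le ((integrable_exp_mul_norm hε hf).const_mul _)
    (.of_forall (h.norm_mul_le f x))).trans_eq ?_
  rw [integral_const_mul]
  ring

lemma memLp_integral (h : IsExpKernel ε C G) (hε : 0 < ε) {f : ℝ → ℂ} (hf : MemLp f 2 μ₊) :
    MemLp (fun x => ∫ y, G x y * f y ∂μ₊) 2 μ₊ := by
  refine ((memLp_exp_neg_mul hε).const_mul
    (C * ∫ y, Real.exp (-ε * y) * ‖f y‖ ∂μ₊)).mono' ?_ (.of_forall (h.norm_integral_le hε hf))
  exact (h.measurable.aestronglyMeasurable.mul hf.1.comp_snd).integral_prod_right'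

/-- An exponentially bounded kernel defines a bounded integral operator. -/
lemma exists_operator (h : IsExpKernel ε C G) (hε : 0 < ε) :
    ∃ L : Lp ℂ 2 μ₊ →L[ℂ] Lp ℂ 2 μ₊, ∀ f, L f =ᵐ[μ₊] fun x => ∫ y, G x y * f y ∂μ₊ := by
  have hm (f : Lp ℂ 2 μ₊) := h.memLp_integral hε (Lp.memLp f)
  let L : Lp ℂ 2 μ₊ →ₗ[ℂ] Lp ℂ 2 μ₊ :=
    { toFun := fun f => (hm f).toLp _
      map_add' := fun f g => by
        rw [← MemLp.toLp_add]
        refine MemLp.toLp_congr _ _ (.of_forall fun x => ?_)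
        simp only [Pi.add_apply]
        rw [← integral_add (h.integrable_mul hε (Lp.memLp f) x)
          (h.integrable_mul hε (Lp.memLp g) x)]
        refine integral_congr_ae ?_
        filter_upwards [Lp.coeFn_add f g] with y hy
        rw [hy, Pi.add_apply, mul_add]
      map_smul' := fun c f => by
        rw [RingHom.id_apply, ← MemLp.toLp_const_smul]
        refine MemLp.toLp_congr _ _ (.of_forall fun x => ?_)
        simp only [Pi.smul_apply, smul_eq_mul]
        rw [← integral_const_mul]
        refine integral_congr_ae ?_
        filter_upwards [Lp.coeFn_smul c f] with y hy
        rw [hy, Pi.smul_apply, smul_eq_mul]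
        ring }
  set E := (memLp_exp_neg_mul hε).toLp _ with hE
  refine ⟨L.mkContinuous (C * ‖E‖ * ‖E‖) fun f => ?_, fun f => (hm f).coeFn_toLp⟩
  have key : ‖L f‖ ≤ C * (‖E‖ * ‖f‖) * ‖E‖ := by
    refine Lp.norm_le_mul_norm_of_ae_le_mul ?_
    filter_upwards [(hm f).coeFn_toLp, (memLp_exp_neg_mul hε).coeFn_toLp] with x h1 h2
    simp only [L, LinearMap.coe_mk, AddHom.coe_mk, hE]
    rw [h1, h2, Real.norm_of_nonneg (Real.exp_pos _).le]
    refine (h.norm_integral_le hε (Lp.memLp f) x).trans ?_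
    gcongr
    · exact h.nonneg
    · exact integral_exp_mul_norm_le hε f
  calc _ ≤ _ := key
    _ = _ := by ring

lemma norm_mul_kernel_le (hA : IsExpKernel ε C A) (hB : IsExpKernel ε C' B) (x z y : ℝ) :
    ‖A x z * B z y‖ ≤
      C * C' * (Real.exp (-ε * x) * Real.exp (-ε * y)) * Real.exp (-(2 * ε) * z) := by
  rw [norm_mul]
  have hz : Real.exp (-(2 * ε) * z) = Real.exp (-ε * z) * Real.exp (-ε * z) := by
    rw [← Real.exp_add]; ring_nf
  calc _ ≤ C * (Real.exp (-ε * x) * Real.exp (-ε * z)) *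
        (C' * (Real.exp (-ε * z) * Real.exp (-ε * y))) :=
        mul_le_mul (hA.norm_le x z) (hB.norm_le z y) (norm_nonneg _)
          ((norm_nonneg _).trans (hA.norm_le x z))
    _ = _ := by rw [hz]; ring

lemma integrable_mul_kernel (hA : IsExpKernel ε C A) (hB : IsExpKernel ε C' B) (hε : 0 < ε)
    (x y : ℝ) : Integrable (fun z => A x z * B z y) μ₊ :=
  ((integrable_exp_neg_mul (ε := 2 * ε) (by positivity)).const_mul _).mono'
    ((hA.measurable_left x).mul (hB.measurable_right y)).aestronglyMeasurable
    (.of_forall fun z => hA.norm_mul_kernel_le hB x z y)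

/-- Fubini: applying two exponentially bounded kernels successively amounts to applying their
composition. -/
lemma integral_mul_integral (hA : IsExpKernel ε C A) (hB : IsExpKernel ε C' B) (hε : 0 < ε)
    {f : ℝ → ℂ} (hf : MemLp f 2 μ₊) (x : ℝ) :
    ∫ z, A x z * ∫ y, B z y * f y ∂μ₊ ∂μ₊ = ∫ y, (∫ z, A x z * B z y ∂μ₊) * f y ∂μ₊ := by
  simp_rw [← integral_const_mul, ← integral_mul_const]
  rw [integral_integral_swap]
  · simp_rw [mul_assoc]
  have hbd : Integrable (fun p : ℝ × ℝ => (C * C' * Real.exp (-ε * x) *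
      Real.exp (-(2 * ε) * p.1)) * (Real.exp (-ε * p.2) * ‖f p.2‖)) (μ₊.prod μ₊) :=
    ((integrable_exp_neg_mul (ε := 2 * ε) (by positivity)).const_mul _).mul_prod
      (integrable_exp_mul_norm hε hf)
  refine hbd.mono' ?_ (.of_forall fun p => ?_)
  · exact ((hA.measurable_left x).comp measurable_fst).aestronglyMeasurable.mul
      (hB.measurable.aestronglyMeasurable.mul hf.1.comp_snd)
  · simp only [Function.uncurry]
    rw [← mul_assoc, norm_mul]
    calc _ ≤ C * C' * (Real.exp (-ε * x) * Real.exp (-ε * p.2)) * Real.exp (-(2 * ε) * p.1) *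
          ‖f p.2‖ := by gcongr; exact hA.norm_mul_kernel_le hB x p.1 p.2
      _ = _ := by ring

end IsExpKernel

/-- The constants `C^{j+1} / ((2ε)^j j!)` bounding the iterated kernels. -/
noncomputable def iterBound (ε C : ℝ) (j : ℕ) : ℝ := C ^ (j + 1) / ((2 * ε) ^ j * j.factorial)

lemma iterBound_nonneg {ε C : ℝ} (hε : 0 < ε) (hC : 0 ≤ C) (j : ℕ) : 0 ≤ iterBound ε C j := by
  unfold iterBound; positivity

lemma summable_iterBound (ε C : ℝ) : Summable (iterBound ε C) := by
  refine ((Real.summable_pow_div_factorial (C / (2 * ε))).mul_left C).congr fun j => ?_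
  rw [iterBound, div_pow, div_div]
  ring

namespace IsExpKernel

variable {ε C : ℝ} {G : ℝ → ℝ → ℂ}

lemma iterKernel_aux (h : IsExpKernel ε C G) (hε : 0 < ε) (j : ℕ) :
    Measurable (Function.uncurry (iterKernel G j)) ∧
    (∀ x y, ¬(0 < x ∧ x < y) → iterKernel G j x y = 0) ∧
    ∀ x y, ‖iterKernel G j x y‖ ≤ iterBound ε C j *
      (Real.exp (-ε * x) * Real.exp (-ε * y)) * Real.exp (-(2 * ε * j) * x) := by
  induction j with
  | zero => exact ⟨h.measurable, h.eq_zero, fun x y => by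
    simpa [iterBound, iterKernel] using h.norm_le x y⟩
  | succ j ih =>
    obtain ⟨hm, h0, hb⟩ := ih
    have hzero : ∀ x y, ¬(0 < x ∧ x < y) → iterKernel G (j + 1) x y = 0 := by
      intro x y hxy
      refine integral_eq_zero_of_ae (.of_forall fun z => ?_)
      by_cases h1 : 0 < x ∧ x < z
      · have h2 : ¬(0 < z ∧ z < y) := fun h => hxy ⟨h1.1, h1.2.trans h.2⟩
        simp [h0 z y h2]
      · simp [h.eq_zero x z h1]
    refine ⟨?_, hzero, fun x y => ?_⟩
    · have : Measurable (fun p : (ℝ × ℝ) × ℝ => G p.1.1 p.2 * iterKernel G j p.2 p.1.2) :=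
        (h.measurable.comp (by fun_prop : Measurable fun p : (ℝ × ℝ) × ℝ => (p.1.1, p.2))).mul
          (hm.comp (by fun_prop : Measurable fun p : (ℝ × ℝ) × ℝ => (p.2, p.1.2)))
      exact this.stronglyMeasurable.integral_prod_right'.measurable
    have hC := h.nonneg
    have hbn := iterBound_nonneg hε hC
    by_cases hxy : 0 < x ∧ x < y
    swap
    · rw [hzero x y hxy, norm_zero]
      have := hbn (j + 1)
      positivity
    set a : ℝ := 2 * ε * (j + 1) with ha
    have ha0 : 0 < a := by positivity
    have hint : IntegrableOn (fun z => Real.exp (-a * z)) (Ioi x) := exp_neg_integrableOn_Ioi x ha0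
    have hsub : ∫ z in Ioi (0 : ℝ), G x z * iterKernel G j z y =
        ∫ z in Ioi x, G x z * iterKernel G j z y := by
      refine setIntegral_eq_of_subset_of_forall_sdiff_eq_zero measurableSet_Ioi
        (Ioi_subset_Ioi hxy.1.le) fun z hz => ?_
      rw [h.eq_zero x z fun h => hz.2 h.2, zero_mul]
    have hpt : ∀ z, ‖G x z * iterKernel G j z y‖ ≤ C * iterBound ε C j *
        (Real.exp (-ε * x) * Real.exp (-ε * y)) * Real.exp (-a * z) := by
      intro z
      rw [norm_mul]
      have he : Real.exp (-a * z) =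
          Real.exp (-ε * z) * (Real.exp (-ε * z) * Real.exp (-(2 * ε * j) * z)) := by
        rw [← Real.exp_add, ← Real.exp_add, ha]; ring_nf
      calc _ ≤ C * (Real.exp (-ε * x) * Real.exp (-ε * z)) * (iterBound ε C j *
            (Real.exp (-ε * z) * Real.exp (-ε * y)) * Real.exp (-(2 * ε * j) * z)) :=
            mul_le_mul (h.norm_le x z) (hb z y) (norm_nonneg _) (by positivity)
        _ = _ := by rw [he]; ring
    change ‖∫ z in Ioi (0 : ℝ), G x z * iterKernel G j z y‖ ≤ _
    rw [hsub]
    refine (norm_integral_le_of_norm_le (hint.const_mul _) (.of_forall hpt)).trans_eq ?_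
    rw [integral_const_mul, integral_exp_mul_Ioi (by linarith), iterBound, iterBound,
      Nat.factorial_succ, neg_div_neg_eq]
    push_cast
    rw [← ha]
    field_simp
    rw [ha]
    ring

/-- The iterates of an exponentially bounded kernel are exponentially bounded. -/
lemma isExpKernel_iterKernel (h : IsExpKernel ε C G) (hε : 0 < ε) (j : ℕ) :
    IsExpKernel ε (iterBound ε C j) (iterKernel G j) where
  measurable := (h.iterKernel_aux hε j).1
  eq_zero := (h.iterKernel_aux hε j).2.1
  norm_le x y := by
    by_cases hxy : 0 < x ∧ x < y
    · have hb := iterBound_nonneg hε h.nonneg j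
      refine ((h.iterKernel_aux hε j).2.2 x y).trans (mul_le_of_le_one_right (by positivity) ?_)
      rw [Real.exp_le_one_iff, neg_mul, neg_nonpos]
      have := hxy.1
      positivity
    · rw [(h.iterKernel_aux hε j).2.1 x y hxy, norm_zero]
      have := iterBound_nonneg hε h.nonneg j
      positivity

/-- The kernel of `V_G⁻¹ - I`, namely the Neumann series `∑_{j ≥ 1} (-1)^j G^j`. -/
noncomputable def resolvent (G : ℝ → ℝ → ℂ) (x y : ℝ) : ℂ :=
  ∑' j, (-1) ^ (j + 1) * iterKernel G j x y

lemma norm_resolvent_term_le (h : IsExpKernel ε C G) (hε : 0 < ε) (x y : ℝ) (j : ℕ) :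
    ‖(-1) ^ (j + 1) * iterKernel G j x y‖ ≤
      iterBound ε C j * (Real.exp (-ε * x) * Real.exp (-ε * y)) := by
  simpa using (h.isExpKernel_iterKernel hε j).norm_le x y

lemma hasSum_resolvent (h : IsExpKernel ε C G) (hε : 0 < ε) (x y : ℝ) :
    HasSum (fun j => (-1) ^ (j + 1) * iterKernel G j x y) (resolvent G x y) :=
  (Summable.of_norm_bounded ((summable_iterBound ε C).mul_right _)
    (h.norm_resolvent_term_le hε x y)).hasSum

lemma resolvent_isExpKernel (h : IsExpKernel ε C G) (hε : 0 < ε) :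
    IsExpKernel ε (∑' j, iterBound ε C j) (resolvent G) where
  measurable := by
    refine measurable_of_tendsto_metrizable (f := fun n (p : ℝ × ℝ) =>
      ∑ j ∈ Finset.range n, (-1) ^ (j + 1) * iterKernel G j p.1 p.2) (fun n => ?_) ?_
    · exact Finset.measurable_fun_sum _ fun j _ => (h.isExpKernel_iterKernel hε j).measurable.const_mul _
    · exact tendsto_pi_nhds.2 fun p => (h.hasSum_resolvent hε p.1 p.2).tendsto_sum_nat
  eq_zero x y hxy := by simp [resolvent, (h.isExpKernel_iterKernel hε _).eq_zero x y hxy]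
  norm_le x y := tsum_of_norm_bounded ((summable_iterBound ε C).hasSum.mul_right _)
    (h.norm_resolvent_term_le hε x y)

/-- The resolvent identity `R + G + G ∘ R = 0`. -/
lemma resolvent_add (h : IsExpKernel ε C G) (hε : 0 < ε) (x y : ℝ) :
    resolvent G x y + G x y + ∫ z, G x z * resolvent G z y ∂μ₊ = 0 := by
  have hint (j : ℕ) : Integrable
      (fun z => (-1) ^ (j + 1) * (G x z * iterKernel G j z y)) μ₊ :=
    (h.integrable_mul_kernel (h.isExpKernel_iterKernel hε j) hε x y).const_mul _
  have hexp := integrable_exp_neg_mul (ε := 2 * ε) (by positivity)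
  have hsum : HasSum (fun j => ∫ z, (-1) ^ (j + 1) * (G x z * iterKernel G j z y) ∂μ₊)
      (∫ z, ∑' j, (-1) ^ (j + 1) * (G x z * iterKernel G j z y) ∂μ₊) := by
    refine hasSum_integral_of_summable_integral_norm hint ?_
    refine Summable.of_nonneg_of_le (fun j => integral_nonneg fun z => norm_nonneg _) (fun j => ?_)
      ((summable_iterBound ε C).mul_left (C * (Real.exp (-ε * x) * Real.exp (-ε * y)) *
        ∫ z, Real.exp (-(2 * ε) * z) ∂μ₊))
    refine (integral_mono (hint j).norm (hexp.const_mul _) fun z => ?_).trans_eq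
      (?_ : ∫ z, C * iterBound ε C j * (Real.exp (-ε * x) * Real.exp (-ε * y)) *
        Real.exp (-(2 * ε) * z) ∂μ₊ = _)
    · simpa using h.norm_mul_kernel_le (h.isExpKernel_iterKernel hε j) x z y
    · rw [integral_const_mul]
      ring
  have htail := (hasSum_nat_add_iff' 1).2 (h.hasSum_resolvent hε x y)
  have heq : ∫ z, G x z * resolvent G z y ∂μ₊ =
      ∫ z, ∑' j, (-1) ^ (j + 1) * (G x z * iterKernel G j z y) ∂μ₊ := by
    congr 1
    ext z
    rw [resolvent, ← tsum_mul_left]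
    congr 1
    ext j
    ring
  have hneg := htail.neg.unique (hsum.congr_fun fun j => ?_)
  · rw [heq, ← hneg]
    simp [iterKernel]
  · rw [integral_const_mul]
    simp only [iterKernel, pow_succ]
    ring

/-- `L` is the integral operator with kernel `G` on `L²((0,∞);ℂ)`. -/
def Represents (G : ℝ → ℝ → ℂ) (L : Lp ℂ 2 μ₊ →L[ℂ] Lp ℂ 2 μ₊) : Prop :=
  ∀ f, L f =ᵐ[μ₊] fun x => ∫ y, G x y * f y ∂μ₊

lemma exists_right_inverse (h : IsExpKernel ε C G) (hε : 0 < ε) {K : Lp ℂ 2 μ₊ →L[ℂ] Lp ℂ 2 μ₊}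
    (hK : Represents G K) : ∃ L, Represents (resolvent G) L ∧ (1 + K) * (1 + L) = 1 := by
  have hR := h.resolvent_isExpKernel hε
  obtain ⟨L, hL⟩ := hR.exists_operator hε
  refine ⟨L, hL, ?_⟩
  have key : L + K + K * L = 0 := by
    ext1 f
    refine Lp.ext ?_
    have hf := Lp.memLp f
    have e : (L + K + K * L) f = L f + K f + K (L f) := rfl
    rw [e]
    filter_upwards [hL f, hK f, hK (L f), Lp.coeFn_add (L f + K f) (K (L f)),
      Lp.coeFn_add (L f) (K f), Lp.coeFn_zero ℂ 2 μ₊] with x h1 h2 h3 h4 h5 h6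
    rw [h4, Pi.add_apply, h5, Pi.add_apply, h1, h2, h3]
    have h7 : ∫ z, G x z * L f z ∂μ₊ =
        ∫ z, G x z * ∫ y, resolvent G z y * f y ∂μ₊ ∂μ₊ := by
      refine integral_congr_ae ?_
      filter_upwards [hL f] with z hz
      rw [hz]
    have h8 : (fun y => (∫ z, G x z * resolvent G z y ∂μ₊) * f y) =
        fun y => -(resolvent G x y * f y + G x y * f y) := by
      ext y
      linear_combination f y * h.resolvent_add hε x y
    rw [h7, h.integral_mul_integral hR hε hf, h8, integral_neg,
      integral_add (hR.integrable_mul hε hf x) (h.integrable_mul hε hf x)]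
    simpa using h6.symm
  calc (1 + K) * (1 + L) = 1 + (L + K + K * L) := by noncomm_ring
    _ = 1 := by rw [key, add_zero]

lemma exists_inverse (h : IsExpKernel ε C G) (hε : 0 < ε) {K : Lp ℂ 2 μ₊ →L[ℂ] Lp ℂ 2 μ₊}
    (hK : Represents G K) :
    ∃ L, Represents (resolvent G) L ∧ (1 + K) * (1 + L) = 1 ∧ (1 + L) * (1 + K) = 1 := by
  obtain ⟨L, hL, h1⟩ := h.exists_right_inverse hε hK
  obtain ⟨L', -, h2⟩ := (h.resolvent_isExpKernel hε).exists_right_inverse hε hL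
  refine ⟨L, hL, h1, ?_⟩
  rwa [left_inv_eq_right_inv h1 h2]

end IsExpKernel

/-- The restriction of a kernel to `{0 < x < y}`. -/
noncomputable def truncKernel (T : ℝ → ℝ → ℂ) (x y : ℝ) : ℂ :=
  if 0 < x ∧ x < y then T x y else 0

lemma isExpKernel_truncKernel {T : ℝ → ℝ → ℂ} (hmeas : Measurable (Function.uncurry T))
    {M ε : ℝ} (hM : 0 ≤ M)
    (hbound : ∀ x y : ℝ, 0 < x → x < y → ‖T x y‖ ≤ M * Real.exp (-ε * (x + y))) :
    IsExpKernel ε M (truncKernel T) where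
  measurable := Measurable.ite ((measurableSet_lt measurable_const measurable_fst).inter
    (measurableSet_lt measurable_fst measurable_snd)) hmeas measurable_const
  eq_zero x y hxy := if_neg hxy
  norm_le x y := by
    by_cases hxy : 0 < x ∧ x < y
    · rw [truncKernel, if_pos hxy, ← Real.exp_add, ← mul_add]
      exact hbound x y hxy.1 hxy.2
    · rw [truncKernel, if_neg hxy, norm_zero]
      positivity

lemma truncKernel_of_lt {T : ℝ → ℝ → ℂ} {x y : ℝ} (hx : 0 < x) (hxy : x < y) :
    truncKernel T x y = T x y :=
  if_pos ⟨hx, hxy⟩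

lemma truncKernel_of_ne {T : ℝ → ℝ → ℂ} (htri : ∀ x y : ℝ, 0 < y → y < x → T x y = 0)
    {x y : ℝ} (hx : 0 < x) (hy : 0 < y) (hxy : x ≠ y) : truncKernel T x y = T x y := by
  rcases hxy.lt_or_gt with h | h
  · exact truncKernel_of_lt hx h
  · rw [htri x y hy h]
    exact if_neg fun hp => h.not_gt hp.2

lemma iterKernel_truncKernel {T : ℝ → ℝ → ℂ} (htri : ∀ x y : ℝ, 0 < y → y < x → T x y = 0)
    (j : ℕ) {x y : ℝ} (hx : 0 < x) (hy : 0 < y) (hxy : x ≠ y) :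
    iterKernel (truncKernel T) j x y = iterKernel T j x y := by
  induction j generalizing x with
  | zero => exact truncKernel_of_ne htri hx hy hxy
  | succ j ih =>
    refine integral_congr_ae ?_
    filter_upwards [ae_restrict_mem measurableSet_Ioi, Measure.ae_ne (volume.restrict (Ioi 0)) x,
      Measure.ae_ne (volume.restrict (Ioi 0)) y] with z hz hzx hzy
    rw [truncKernel_of_ne htri hx hz hzx.symm, ih hz hzy]

lemma setIntegral_Ioi_mul_eq {ε C : ℝ} {G T : ℝ → ℝ → ℂ} (hG : IsExpKernel ε C G)
    (hT : ∀ x y, 0 < x → x < y → G x y = T x y) (f : ℝ → ℂ) {x : ℝ} (hx : 0 < x) :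
    ∫ y in Ioi x, T x y * f y = ∫ y, G x y * f y ∂μ₊ := by
  rw [setIntegral_eq_of_subset_of_forall_sdiff_eq_zero measurableSet_Ioi
    (Ioi_subset_Ioi hx.le) fun y hy => by rw [hG.eq_zero x y fun h => hy.2 h.2, zero_mul]]
  exact setIntegral_congr_fun measurableSet_Ioi fun y hy => by simp only [hT x y hx hy]

lemma representsVT_iff {ε C : ℝ} {G T : ℝ → ℝ → ℂ} (hG : IsExpKernel ε C G)
    (hT : ∀ x y, 0 < x → x < y → G x y = T x y) (L : Lp ℂ 2 μ₊ →L[ℂ] Lp ℂ 2 μ₊) :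
    RepresentsVT T (1 + L) ↔ IsExpKernel.Represents G L := by
  refine forall_congr' fun f => ?_
  have e : (1 + L) f = f + L f := rfl
  constructor <;> intro h
  · filter_upwards [h, Lp.coeFn_add f (L f), ae_restrict_mem measurableSet_Ioi] with x h1 h2 hx
    rw [e, h2, Pi.add_apply, add_right_inj] at h1
    rw [h1, setIntegral_Ioi_mul_eq hG hT f hx]
  · filter_upwards [h, Lp.coeFn_add f (L f), ae_restrict_mem measurableSet_Ioi] with x h1 h2 hx
    rw [e, h2, Pi.add_apply, h1, setIntegral_Ioi_mul_eq hG hT f hx]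

lemma IsExpKernel.memT {ε C : ℝ} {G : ℝ → ℝ → ℂ} (h : IsExpKernel ε C G) (hε : 0 < ε) :
    MemT G := by
  refine ⟨h.measurable, fun x y _ hyx => h.eq_zero x y fun hp => hp.2.not_gt hyx, ?_⟩
  let E : ℝ → ℝ≥0∞ := fun x => ENNReal.ofReal (Real.exp (-(2 * ε) * x))
  have hE : ∫⁻ x, E x ∂μ₊ < ⊤ :=
    (integrable_exp_neg_mul (ε := 2 * ε) (by positivity)).lintegral_lt_top
  have hEm : Measurable E := by fun_prop
  have hpt : ∀ x y, (‖G x y‖₊ : ℝ≥0∞) ^ 2 ≤ ENNReal.ofReal (C ^ 2) * E x * E y := by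
    intro x y
    have hsq : C ^ 2 * Real.exp (-(2 * ε) * x) * Real.exp (-(2 * ε) * y) =
        (C * (Real.exp (-ε * x) * Real.exp (-ε * y))) ^ 2 := by
      have : ∀ t, Real.exp (-(2 * ε) * t) = Real.exp (-ε * t) ^ 2 := fun t => by
        rw [pow_two, ← Real.exp_add]; ring_nf
      rw [this, this]
      ring
    rw [← ENNReal.ofReal_mul (by positivity), ← ENNReal.ofReal_mul (by positivity), hsq,
      ← enorm_eq_nnnorm, ← ofReal_norm, ← ENNReal.ofReal_pow (norm_nonneg _)]
    exact ENNReal.ofReal_le_ofReal (pow_le_pow_left₀ (norm_nonneg _) (h.norm_le x y) 2)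
  calc _ ≤ ∫⁻ x, ∫⁻ y, ENNReal.ofReal (C ^ 2) * E x * E y ∂μ₊ ∂μ₊ := by
        refine setLIntegral_mono' measurableSet_Ioi fun x hx => ?_
        exact (lintegral_mono (hpt x)).trans (lintegral_mono_set (Ioi_subset_Ioi (le_of_lt hx)))
    _ = ENNReal.ofReal (C ^ 2) * (∫⁻ x, E x ∂μ₊) * ∫⁻ y, E y ∂μ₊ := by
        simp_rw [lintegral_const_mul _ hEm]
        rw [lintegral_mul_const _ (hEm.const_mul _), lintegral_const_mul _ hEm]
    _ < ⊤ := ENNReal.mul_lt_top (ENNReal.mul_lt_top ENNReal.ofReal_lt_top hE) hE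

lemma memLp_exp_mul_exp {ε : ℝ} (hε : 0 < ε) :
    MemLp (fun p : ℝ × ℝ => Real.exp (-ε * p.1) * Real.exp (-ε * p.2)) 2 (μ₊.prod μ₊) := by
  rw [memLp_two_iff_integrable_sq (by fun_prop)]
  simp_rw [mul_pow]
  exact (memLp_exp_neg_mul hε).integrable_sq.mul_prod (memLp_exp_neg_mul hε).integrable_sq

lemma ae_prod_ne_and_pos : ∀ᵐ p : ℝ × ℝ ∂(volume.restrict (Ioi (0 : ℝ) ×ˢ Ioi (0 : ℝ))),
    0 < p.1 ∧ 0 < p.2 ∧ p.1 ≠ p.2 := by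
  have hne : ∀ᵐ p : ℝ × ℝ ∂(volume.restrict (Ioi (0 : ℝ) ×ˢ Ioi (0 : ℝ))), p.1 ≠ p.2 := by
    rw [Measure.volume_eq_prod, ← Measure.prod_restrict, Measure.ae_prod_iff_ae_ae]
    · refine .of_forall fun x => ?_
      filter_upwards [Measure.ae_ne μ₊ x] with y hy using hy.symm
    · exact (measurableSet_eq_fun measurable_fst measurable_snd).compl
  filter_upwards [hne, ae_restrict_mem (measurableSet_Ioi.prod measurableSet_Ioi)] with p h1 h2
    using ⟨h2.1, h2.2, h1⟩

lemma IsExpKernel.eLpNorm_toReal_le {ε C : ℝ} {G : ℝ → ℝ → ℂ} (h : IsExpKernel ε C G)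
    (hε : 0 < ε) :
    (eLpNorm (fun p : ℝ × ℝ => G p.1 p.2) 2
      (volume.restrict (Ioi (0 : ℝ) ×ˢ Ioi (0 : ℝ)))).toReal ≤
    C * (eLpNorm (fun p : ℝ × ℝ => Real.exp (-ε * p.1) * Real.exp (-ε * p.2)) 2
      (μ₊.prod μ₊)).toReal := by
  rw [Measure.volume_eq_prod, ← Measure.prod_restrict]
  have hle := eLpNorm_le_mul_eLpNorm_of_ae_le_mul (p := 2) (μ := μ₊.prod μ₊)
    (f := fun p : ℝ × ℝ => G p.1 p.2)
    (g := fun p : ℝ × ℝ => Real.exp (-ε * p.1) * Real.exp (-ε * p.2)) (c := C)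
    (.of_forall fun p => by
      rw [Real.norm_of_nonneg (by positivity)]
      exact h.norm_le p.1 p.2)
  refine (ENNReal.toReal_mono ?_ hle).trans_eq ?_
  · exact ENNReal.mul_ne_top ENNReal.ofReal_ne_top (memLp_exp_mul_exp hε).eLpNorm_ne_top
  · rw [ENNReal.toReal_mul, ENNReal.toReal_ofReal h.nonneg]

lemma nontrivial_Lp_Ioi : Nontrivial (Lp ℂ 2 μ₊) := by
  have hE : MemLp (fun x => (Real.exp (-1 * x) : ℂ)) 2 μ₊ := (memLp_exp_neg_mul one_pos).ofReal
  refine nontrivial_of_ne (hE.toLp _) 0 fun h0 => ?_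
  have : (ae μ₊).NeBot := ae_neBot.2 (by simp)
  obtain ⟨x, h1, h2⟩ := (hE.coeFn_toLp.and (h0 ▸ Lp.coeFn_zero ℂ 2 μ₊)).exists
  rw [h1] at h2
  simp at h2

lemma IsExpKernel.spectrum_one_add {ε C : ℝ} {G : ℝ → ℝ → ℂ} (h : IsExpKernel ε C G)
    (hε : 0 < ε) {K : Lp ℂ 2 μ₊ →L[ℂ] Lp ℂ 2 μ₊} (hK : IsExpKernel.Represents G K) :
    spectrum ℂ (1 + K) = {1} := by
  have := nontrivial_Lp_Ioi
  refine (spectrum.nonempty (1 + K)).subset_singleton_iff.1 fun l hl => ?_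
  by_contra hne
  rw [mem_singleton_iff, ← sub_eq_zero] at hne
  set c : ℂ := -(l - 1)⁻¹ with hc
  have hcK : IsExpKernel.Represents (fun x y => c * G x y) (c • K) := by
    intro f
    have e : (c • K) f = c • K f := rfl
    rw [e]
    filter_upwards [hK f, Lp.coeFn_smul c (K f)] with x h1 h2
    rw [h2, Pi.smul_apply, h1, smul_eq_mul, ← integral_const_mul]
    simp_rw [mul_assoc]
  obtain ⟨L, -, h1, h2⟩ := (h.const_mul c).exists_inverse hε hcK
  have hu : IsUnit (1 + c • K) := ⟨⟨_, _, h1, h2⟩, rfl⟩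
  have e : algebraMap ℂ (Lp ℂ 2 μ₊ →L[ℂ] Lp ℂ 2 μ₊) l - (1 + K) = (l - 1) • (1 + c • K) := by
    rw [Algebra.algebraMap_eq_smul_one, smul_add, smul_smul, hc, mul_neg, mul_inv_cancel₀ hne,
      sub_smul]
    simp
    abel
  refine hl (spectrum.mem_resolventSet_iff.2 ?_)
  rw [e]
  exact hu.smul (Units.mk0 _ hne)

/-- The integral of `∏ e^{-a zᵢ}` over the ordered simplex above `x`. -/
lemma setLIntegral_simplex_prod_exp_le {a : ℝ} (ha : 0 < a) (n : ℕ) (x : ℝ) :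
    ∫⁻ z in {z : Fin n → ℝ | (∀ i j : Fin n, i < j → z i < z j) ∧ ∀ i, x < z i},
      ∏ i, ENNReal.ofReal (Real.exp (-a * z i)) ≤
    ENNReal.ofReal (Real.exp (-(a * n) * x) / (a ^ n * n.factorial)) := by
  induction n generalizing x with
  | zero =>
    refine (setLIntegral_le_lintegral _ _).trans ?_
    simp [lintegral_unique, volume_pi]
  | succ n ih =>
    set S : ℝ → Set (Fin n → ℝ) :=
      fun t => {z | (∀ i j : Fin n, i < j → z i < z j) ∧ ∀ i, t < z i} with hS
    set P : Set (ℝ × (Fin n → ℝ)) := {p | x < p.1 ∧ p.2 ∈ S p.1} with hP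
    let F : ℝ × (Fin n → ℝ) → ℝ≥0∞ := fun p =>
      ENNReal.ofReal (Real.exp (-a * p.1)) * ∏ i, ENNReal.ofReal (Real.exp (-a * p.2 i))
    have hF : Measurable F := by fun_prop
    have hSm (t : ℝ) : MeasurableSet (S t) := by
      simp only [hS]
      measurability
    have hPm : MeasurableSet P := by
      have : P = {p | x < p.1} ∩ ((⋂ i, ⋂ j, {p | i < j → p.2 i < p.2 j}) ∩
          ⋂ i, {p | p.1 < p.2 i}) := by
        ext p; simp [hP, hS]
      rw [this]
      refine (measurableSet_lt (by fun_prop) (by fun_prop)).inter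
        ((MeasurableSet.iInter fun i => .iInter fun j => ?_).inter
          (.iInter fun i => measurableSet_lt (by fun_prop) (by fun_prop)))
      exact (MeasurableSet.const (i < j)).imp (measurableSet_lt (by fun_prop) (by fun_prop))
    set e := MeasurableEquiv.piFinSuccAbove (fun _ : Fin (n + 1) => ℝ) 0 with he
    have hset : {z : Fin (n + 1) → ℝ | (∀ i j, i < j → z i < z j) ∧ ∀ i, x < z i} =
        e ⁻¹' P := by
      ext z
      simp only [he, hP, hS, mem_ofPred_eq, mem_preimage, MeasurableEquiv.piFinSuccAbove_apply,
        Fin.insertNthEquiv_symm_apply, Fin.forall_fin_succ, Fin.removeNth_apply,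
        Fin.succAbove_zero, Fin.succ_lt_succ_iff, Fin.succ_pos, Fin.not_lt_zero,
        false_imp_iff, true_imp_iff, true_and]
      constructor
      · rintro ⟨⟨h1, h2⟩, h3, h4⟩
        exact ⟨h3, h2, h1⟩
      · rintro ⟨h3, h2, h1⟩
        exact ⟨⟨h1, h2⟩, h3, fun i => h3.trans (h1 i)⟩
    have hFe : ∀ z : Fin (n + 1) → ℝ,
        ∏ i, ENNReal.ofReal (Real.exp (-a * z i)) = F (e z) := by
      intro z
      rw [Fin.prod_univ_succ]
      rfl
    simp_rw [hFe]
    rw [hset, (volume_preserving_piFinSuccAbove (fun _ : Fin (n + 1) => ℝ)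
      0).setLIntegral_comp_preimage_emb e.measurableEmbedding F P, ← lintegral_indicator hPm,
      Measure.volume_eq_prod, lintegral_prod _ (hF.indicator hPm).aemeasurable]
    have hinner : ∀ t : ℝ, ∫⁻ w : Fin n → ℝ, P.indicator F (t, w) =
        (Ioi x).indicator (fun t => ENNReal.ofReal (Real.exp (-a * t)) *
          ∫⁻ w in S t, ∏ i, ENNReal.ofReal (Real.exp (-a * w i))) t := by
      intro t
      by_cases ht : x < t
      · rw [indicator_of_mem (mem_Ioi.2 ht), ← lintegral_const_mul _ (by fun_prop),
          ← lintegral_indicator (hSm t)]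
        refine lintegral_congr fun w => ?_
        simp [indicator, hP, ht, F]
      · rw [indicator_of_notMem (by simpa using ht)]
        simp [indicator, hP, ht]
    simp_rw [hinner]
    rw [lintegral_indicator measurableSet_Ioi]
    set b : ℝ := a * (n + 1) with hb
    have hb0 : 0 < b := by positivity
    have hint : Integrable (fun t => (a ^ n * n.factorial)⁻¹ * Real.exp (-b * t))
        (volume.restrict (Ioi x)) := (exp_neg_integrableOn_Ioi x hb0).const_mul _
    calc _ ≤ ∫⁻ t in Ioi x, ENNReal.ofReal ((a ^ n * n.factorial)⁻¹ * Real.exp (-b * t)) := by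
          refine lintegral_mono fun t => ?_
          refine (mul_le_mul_right (ih t) _).trans_eq ?_
          rw [← ENNReal.ofReal_mul (Real.exp_pos _).le]
          congr 1
          have : Real.exp (-b * t) = Real.exp (-a * t) * Real.exp (-(a * n) * t) := by
            rw [← Real.exp_add, hb]; ring_nf
          rw [this]
          ring
      _ = _ := by
          rw [← ofReal_integral_eq_lintegral_ofReal hint (.of_forall fun t => by positivity),
            integral_const_mul, integral_exp_mul_Ioi (by linarith), neg_div_neg_eq,
            Nat.factorial_succ]
          congr 1
          push_cast
          rw [← hb]
          field_simp
          rw [hb]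
          ring

/-- Along the chain `x < z₀ < ⋯ < z_{n-1} < y`, a product of kernels is bounded by the product of
their exponential bounds. -/
lemma prod_nnnorm_chain_le {T : ℝ → ℝ → ℂ} {M ε : ℝ} (hM : 0 ≤ M)
    (hbound : ∀ x y : ℝ, 0 < x → x < y → ‖T x y‖ ≤ M * Real.exp (-ε * (x + y)))
    {n : ℕ} {x y : ℝ} (hx : 0 < x) (hxy : x < y) {z : Fin n → ℝ}
    (hz : ∀ i j : Fin n, i < j → z i < z j) (hxz : ∀ i, x < z i ∧ z i < y) :
    ∏ i : Fin (n + 1),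
      (‖T ((Fin.cons x (Fin.snoc z y) : Fin (n + 2) → ℝ) i.castSucc)
        ((Fin.cons x (Fin.snoc z y) : Fin (n + 2) → ℝ) i.succ)‖₊ : ℝ≥0∞) ≤
    ENNReal.ofReal (M ^ (n + 1) * Real.exp (-ε * (x + y))) *
      ∏ i, ENNReal.ofReal (Real.exp (-(2 * ε) * z i)) := by
  set s : Fin (n + 1) → ℝ := Fin.snoc z y with hs
  set w : Fin (n + 2) → ℝ := Fin.cons x s with hw
  have hxs : ∀ k, x < s k := by
    intro k
    induction k using Fin.lastCases with
    | last => simpa [hs] using hxy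
    | cast k => simpa [hs] using (hxz k).1
  have hzs : ∀ (i : Fin n) (k : Fin (n + 1)), i.castSucc < k → z i < s k := by
    intro i k
    induction k using Fin.lastCases with
    | last => exact fun _ => by simpa [hs] using (hxz i).2
    | cast k => simpa [hs] using hz i k
  have hpos : ∀ k, 0 < w k := by
    intro k
    induction k using Fin.cases with
    | zero => simpa [hw] using hx
    | succ k => simpa [hw] using hx.trans (hxs k)
  have hlt : ∀ i : Fin (n + 1), w i.castSucc < w i.succ := by
    intro i
    induction i using Fin.cases with
    | zero => simpa [hw] using hxs 0
    | succ i =>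
      have := hzs i i.succ Fin.castSucc_lt_succ
      simpa [hw, hs, ← Fin.succ_castSucc] using this
  have hsum : ∑ i : Fin (n + 1), (w i.castSucc + w i.succ) = x + y + 2 * ∑ i, z i := by
    have h1 : ∑ i : Fin (n + 1), w i.castSucc = x + ∑ i, z i := by
      rw [Fin.sum_univ_succ]
      simp [hw, hs]
    have h2 : ∑ i : Fin (n + 1), w i.succ = ∑ i, z i + y := by
      rw [Fin.sum_univ_castSucc]
      simp [hw, hs]
    rw [Finset.sum_add_distrib, h1, h2]
    ring
  calc _ ≤ ∏ i : Fin (n + 1),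
        ENNReal.ofReal (M * Real.exp (-ε * (w i.castSucc + w i.succ))) := by
        refine Finset.prod_le_prod' fun i _ => ?_
        rw [← enorm_eq_nnnorm, ← ofReal_norm]
        exact ENNReal.ofReal_le_ofReal (hbound _ _ (hpos _) (hlt i))
    _ = _ := by
        rw [← ENNReal.ofReal_prod_of_nonneg fun i _ => by positivity,
          ← ENNReal.ofReal_prod_of_nonneg fun i _ => by positivity,
          ← ENNReal.ofReal_mul (by positivity), Finset.prod_mul_distrib, ← Real.exp_sum,
          ← Real.exp_sum, ← Finset.mul_sum, ← Finset.mul_sum, hsum, mul_assoc, ← Real.exp_add]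
        simp
        ring_nf

lemma setLIntegral_simplex_le {T : ℝ → ℝ → ℂ} {M ε : ℝ} (hM : 0 ≤ M) (hε : 0 < ε)
    (hbound : ∀ x y : ℝ, 0 < x → x < y → ‖T x y‖ ≤ M * Real.exp (-ε * (x + y)))
    (n : ℕ) {x y : ℝ} (hx : 0 < x) (hxy : x < y) :
    (∫⁻ z in {z : Fin n → ℝ | (∀ i j : Fin n, i < j → z i < z j) ∧ ∀ i, x < z i ∧ z i < y},
          ∏ i : Fin (n + 1),
            (‖T ((Fin.cons x (Fin.snoc z y) : Fin (n + 2) → ℝ) i.castSucc)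
                ((Fin.cons x (Fin.snoc z y) : Fin (n + 2) → ℝ) i.succ)‖₊ : ℝ≥0∞))
        ≤ ENNReal.ofReal (M ^ (n + 1) * Real.exp (-ε * (x + y))
            / (ε ^ n * 2 ^ n * n.factorial)) := by
  have hmeas : MeasurableSet
      {z : Fin n → ℝ | (∀ i j : Fin n, i < j → z i < z j) ∧ ∀ i, x < z i ∧ z i < y} := by
    measurability
  refine (setLIntegral_mono' hmeas fun z hz =>
    prod_nnnorm_chain_le hM hbound hx hxy hz.1 hz.2).trans ?_
  rw [lintegral_const_mul _ (by fun_prop)]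
  have hsub : {z : Fin n → ℝ | (∀ i j : Fin n, i < j → z i < z j) ∧ ∀ i, x < z i ∧ z i < y} ⊆
      {z | (∀ i j : Fin n, i < j → z i < z j) ∧ ∀ i, x < z i} :=
    fun z hz => ⟨hz.1, fun i => (hz.2 i).1⟩
  refine (mul_le_mul_right ((lintegral_mono_set hsub).trans
    (setLIntegral_simplex_prod_exp_le (a := 2 * ε) (by positivity) n x)) _).trans ?_
  rw [← ENNReal.ofReal_mul (by positivity)]
  refine ENNReal.ofReal_le_ofReal ?_
  have h1 : Real.exp (-(2 * ε * n) * x) ≤ 1 := by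
    rw [Real.exp_le_one_iff, neg_mul, neg_nonpos]
    positivity
  rw [mul_div_assoc', mul_pow, mul_comm (2 ^ n) (ε ^ n)]
  exact div_le_div_of_nonneg_right (mul_le_of_le_one_right (by positivity) h1) (by positivity)
/-- Let `T` be an upper-triangular kernel, continuous on `{0 < x < y}`, with
`|T(x,y)| ≤ M e^{-ε(x+y)}`.  Then:
(a) the iterated kernels satisfy the simplex bound
`∫_{x<y₁<⋯<yₙ<y} |T(x,y₁)| ⋯ |T(yₙ,y)| ≤ M^{n+1} e^{-ε(x+y)} / (εⁿ 2ⁿ n!)`;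
(b) the Neumann series `∑ (-1)ʲ Tʲ` converges (absolutely) in Hilbert–Schmidt norm, the
operator `V_T` has spectrum `{1}`, and `V_T` is invertible with `V_T⁻¹ - I` an integral
operator with an upper-triangular `L²` kernel. -/
theorem stmt_14 (T : ℝ → ℝ → ℂ)
    (hmeas : Measurable (Function.uncurry T))
    (htri : ∀ x y : ℝ, 0 < y → y < x → T x y = 0)
    (hcont : ContinuousOn (Function.uncurry T) {p : ℝ × ℝ | 0 < p.1 ∧ p.1 < p.2})
    (M ε : ℝ) (hM : 0 ≤ M) (hε : 0 < ε)
    (hbound : ∀ x y : ℝ, 0 < x → x < y → ‖T x y‖ ≤ M * Real.exp (-ε * (x + y)))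
    (V : Lp ℂ 2 (volume.restrict (Ioi (0 : ℝ))) →L[ℂ] Lp ℂ 2 (volume.restrict (Ioi (0 : ℝ))))
    (hV : RepresentsVT T V) :
    -- (a) the simplex bound for iterated kernels
    (∀ (n : ℕ) (x y : ℝ), 0 < x → x < y →
      (∫⁻ z in {z : Fin n → ℝ | (∀ i j : Fin n, i < j → z i < z j) ∧ ∀ i, x < z i ∧ z i < y},
          ∏ i : Fin (n + 1),
            (‖T ((Fin.cons x (Fin.snoc z y) : Fin (n + 2) → ℝ) i.castSucc)
                ((Fin.cons x (Fin.snoc z y) : Fin (n + 2) → ℝ) i.succ)‖₊ : ℝ≥0∞))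
        ≤ ENNReal.ofReal (M ^ (n + 1) * Real.exp (-ε * (x + y))
            / (ε ^ n * 2 ^ n * n.factorial)))
    ∧
    -- (b) absolute convergence of the Neumann series in Hilbert–Schmidt norm
    (Summable fun j : ℕ =>
      (eLpNorm (fun p : ℝ × ℝ => iterKernel T j p.1 p.2) 2
        (volume.restrict ((Ioi (0 : ℝ)) ×ˢ (Ioi (0 : ℝ))))).toReal)
    ∧
    -- (b) the spectrum of `V_T` is `{1}`
    (spectrum ℂ V = {1})
    ∧
    -- (b) `V_T` is invertible and `V_T⁻¹ - I` has an upper-triangular `L²` kernel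
    (∃ W : Lp ℂ 2 (volume.restrict (Ioi (0 : ℝ))) →L[ℂ]
        Lp ℂ 2 (volume.restrict (Ioi (0 : ℝ))),
      V.comp W = 1 ∧ W.comp V = 1 ∧ ∃ Hk : ℝ → ℝ → ℂ, MemT Hk ∧ RepresentsVT Hk W) := by
  have hG := isExpKernel_truncKernel hmeas hM hbound
  obtain ⟨K, rfl⟩ : ∃ K, V = 1 + K := ⟨V - 1, by abel⟩
  have hK := (representsVT_iff hG (fun _ _ => truncKernel_of_lt) K).1 hV
  obtain ⟨L, hL, h1, h2⟩ := hG.exists_inverse hε hK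
  have hR := hG.resolvent_isExpKernel hε
  refine ⟨fun n x y hx hxy => setLIntegral_simplex_le hM hε hbound n hx hxy, ?_,
    hG.spectrum_one_add hε hK, 1 + L, h1, h2, _, hR.memT hε,
    (representsVT_iff hR (fun _ _ _ _ => rfl) L).2 hL⟩
  refine Summable.of_nonneg_of_le (fun j => ENNReal.toReal_nonneg) (fun j => ?_)
    ((summable_iterBound ε M).mul_right (eLpNorm (fun p : ℝ × ℝ => Real.exp (-ε * p.1) *
      Real.exp (-ε * p.2)) 2 ((volume.restrict (Ioi 0)).prod (volume.restrict (Ioi 0)))).toReal)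
  refine (congrArg ENNReal.toReal (eLpNorm_congr_ae ?_)).trans_le
    ((hG.isExpKernel_iterKernel hε j).eLpNorm_toReal_le hε)
  filter_upwards [ae_prod_ne_and_pos] with p hp
  exact (iterKernel_truncKernel htri j hp.1 hp.2.1 hp.2.2).symm
end

section
/- Let u be a smooth function on an interval, λ ∈ ℂ, and let g be a smooth nonvanishing function satisfying g‴ = 2u′ g + 4(u − λ) g′. Then: (a) the quantity −(1/2) g g″ + (1/4)(g′)² + g²(u − λ) is constant in x; (b) if μ ∈ ℂ satisfies μ² = −(1/2) g g″ + (1/4)(g′)² + g²(u − λ), then the function ψ(x) = √(g(x)) · exp(∫₀ˣ μ/g(y) dy) satisfies the Schrödinger equation −ψ″ + u ψ = λ ψ. -/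
open Set intervalIntegral

/-- If `g` solves `g''' = 2 u' g + 4 (u - lam) g'` at `x`, then the first integral of this equation
has vanishing derivative at `x`. -/
theorem hasDerivAt_first_integral {u g g₁ g₂ : ℝ → ℂ} {x : ℝ} {lam u' g₃ : ℂ}
    (hu : HasDerivAt u u' x) (hg : HasDerivAt g (g₁ x) x) (hg₁ : HasDerivAt g₁ (g₂ x) x)
    (hg₂ : HasDerivAt g₂ g₃ x) (hODE : g₃ = 2 * u' * g x + 4 * (u x - lam) * g₁ x) :
    HasDerivAt (fun y => -(1 / 2) * g y * g₂ y + (1 / 4) * (g₁ y) ^ 2 + (g y) ^ 2 * (u y - lam))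
      0 x := by
  refine ((((hg.const_mul (-(1 / 2))).mul hg₂).add ((hg₁.pow 2).const_mul (1 / 4))).add
    ((hg.pow 2).mul (hu.sub_const lam))).congr_deriv ?_
  simp only [hODE, Pi.pow_apply]
  push_cast
  ring

/-- The fundamental theorem of calculus for a function continuous on an open interval. -/
theorem hasDerivAt_integral_of_continuousOn_Ioo {E : Type*} [NormedAddCommGroup E]
    [NormedSpace ℝ E] [CompleteSpace E] {f : ℝ → E} {a b c x : ℝ} (hf : ContinuousOn f (Ioo a b))
    (hc : c ∈ Ioo a b) (hx : x ∈ Ioo a b) :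
    HasDerivAt (fun y => ∫ t in c..y, f t) (f x) x :=
  integral_hasDerivAt_right
    (hf.mono (ordConnected_Ioo.uIcc_subset hc hx)).intervalIntegrable
    (hf.stronglyMeasurableAtFilter isOpen_Ioo x hx) (hf.continuousAt (isOpen_Ioo.mem_nhds hx))

/-- The logarithmic derivative of a differentiable branch `r` of `√g` is `g' / (2 g)`. -/
theorem deriv_sqrt_branch {g r : ℝ → ℂ} {x : ℝ} {g' r' : ℂ} (hg : HasDerivAt g g' x)
    (hr : HasDerivAt r r' x) (hrg : ∀ᶠ y in nhds x, r y ^ 2 = g y) (hgx : g x ≠ 0) :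
    r' = r x * (g' / 2 / g x) := by
  have h := (hg.congr_of_eventuallyEq hrg).unique (hr.pow 2)
  have hrx : r x ≠ 0 := fun h0 => hgx (by simp [← hrg.self_of_nhds, h0])
  rw [h, ← hrg.self_of_nhds]
  field_simp
  push_cast
  ring

/-- Let `u` be smooth on an interval `(a,b)` (containing `0`), `lam ∈ ℂ`, and let `g` be a smooth
nonvanishing function satisfying `g''' = 2 u' g + 4 (u - lam) g'`. Then:
(a) the quantity `Q = -(1/2) g g'' + (1/4) (g')² + g² (u - lam)` is constant in `x`
    (its derivative is `0` and it takes the same value at any two points of the interval);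
(b) if `μ ∈ ℂ` satisfies `μ² = Q`, then (for any branch `r` of the square root of `g`, i.e. any
    differentiable `r` with `r² = g`) the function
    `ψ(x) = √(g x) · exp (∫₀ˣ μ / g)` satisfies the Schrödinger equation `-ψ'' + u ψ = lam ψ`.
Derivatives are encoded by witness functions via `HasDerivAt` on the open interval `Ioo a b`. -/
theorem stmt_18 (a b : ℝ) (lam μ : ℂ)
    (u u' g g₁ g₂ g₃ : ℝ → ℂ)
    (hu : ∀ x ∈ Ioo a b, HasDerivAt u (u' x) x)
    (hg₁ : ∀ x ∈ Ioo a b, HasDerivAt g (g₁ x) x)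
    (hg₂ : ∀ x ∈ Ioo a b, HasDerivAt g₁ (g₂ x) x)
    (hg₃ : ∀ x ∈ Ioo a b, HasDerivAt g₂ (g₃ x) x)
    (hgne : ∀ x ∈ Ioo a b, g x ≠ 0)
    (hODE : ∀ x ∈ Ioo a b, g₃ x = 2 * u' x * g x + 4 * (u x - lam) * g₁ x) :
    -- (a) : `Q` has vanishing derivative, hence is constant on the interval
    (∀ x ∈ Ioo a b,
      HasDerivAt (fun y => -(1 / 2) * g y * g₂ y + (1 / 4) * (g₁ y) ^ 2 + (g y) ^ 2 * (u y - lam))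
        0 x)
    ∧ (∀ x ∈ Ioo a b, ∀ y ∈ Ioo a b,
        -(1 / 2) * g x * g₂ x + (1 / 4) * (g₁ x) ^ 2 + (g x) ^ 2 * (u x - lam)
          = -(1 / 2) * g y * g₂ y + (1 / 4) * (g₁ y) ^ 2 + (g y) ^ 2 * (u y - lam))
    ∧
    -- (b)
    ((0 : ℝ) ∈ Ioo a b →
      (∀ x ∈ Ioo a b,
        μ ^ 2 = -(1 / 2) * g x * g₂ x + (1 / 4) * (g₁ x) ^ 2 + (g x) ^ 2 * (u x - lam)) →
      ∀ r r' : ℝ → ℂ,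
        (∀ x ∈ Ioo a b, HasDerivAt r (r' x) x) →
        (∀ x ∈ Ioo a b, (r x) ^ 2 = g x) →
        ∃ ψ₁ ψ₂ : ℝ → ℂ,
          (∀ x ∈ Ioo a b,
            HasDerivAt (fun y => r y * Complex.exp (∫ t in (0 : ℝ)..y, μ / g t)) (ψ₁ x) x)
          ∧ (∀ x ∈ Ioo a b, HasDerivAt ψ₁ (ψ₂ x) x)
          ∧ (∀ x ∈ Ioo a b,
              -ψ₂ x + u x * (r x * Complex.exp (∫ t in (0 : ℝ)..x, μ / g t))
                = lam * (r x * Complex.exp (∫ t in (0 : ℝ)..x, μ / g t)))) := by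
  have hQ : ∀ x ∈ Ioo a b, HasDerivAt
      (fun y => -(1 / 2) * g y * g₂ y + (1 / 4) * (g₁ y) ^ 2 + (g y) ^ 2 * (u y - lam)) 0 x :=
    fun x hx => hasDerivAt_first_integral (hu x hx) (hg₁ x hx) (hg₂ x hx) (hg₃ x hx) (hODE x hx)
  refine ⟨hQ, fun x hx y hy => ?_, fun h0 hμ r r' hr hrg => ?_⟩
  · exact isOpen_Ioo.is_const_of_deriv_eq_zero isPreconnected_Ioo
      (fun z hz => (hQ z hz).differentiableAt.differentiableWithinAt)
      (fun z hz => (hQ z hz).deriv) hx hy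
  have hcont : ContinuousOn (fun t => μ / g t) (Ioo a b) :=
    continuousOn_const.div (fun x hx => (hg₁ x hx).continuousAt.continuousWithinAt) hgne
  set ψ : ℝ → ℂ := fun y => r y * Complex.exp (∫ t in (0 : ℝ)..y, μ / g t) with hψ_def
  have hψ : ∀ x ∈ Ioo a b, HasDerivAt ψ (ψ x * ((g₁ x / 2 + μ) / g x)) x := by
    intro x hx
    have hr' := deriv_sqrt_branch (hg₁ x hx) (hr x hx)
      (Filter.eventually_of_mem (isOpen_Ioo.mem_nhds hx) hrg) (hgne x hx)
    refine ((hr x hx).mul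
      (hasDerivAt_integral_of_continuousOn_Ioo hcont h0 hx).cexp).congr_deriv ?_
    rw [hr']
    simp only [hψ_def]
    ring
  refine ⟨fun x => ψ x * ((g₁ x / 2 + μ) / g x), fun x => ψ x * (u x - lam), hψ, fun x hx => ?_,
    fun x _ => ?_⟩
  · have hgx := hgne x hx
    refine ((hψ x hx).mul
      ((((hg₂ x hx).div_const 2).add_const μ).div (hg₁ x hx) hgx)).congr_deriv ?_
    have hu_eq : u x - lam = (μ ^ 2 + g x * g₂ x / 2 - g₁ x ^ 2 / 4) / g x ^ 2 := by
      rw [hμ x hx]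
      field_simp
      ring
    simp only [Pi.div_apply, hu_eq]
    field_simp
    ring
  · change -(ψ x * (u x - lam)) + u x * ψ x = lam * ψ x
    ring
end
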